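/- Let p be a classical stationary solution of the voltage–conductance equation such that ∫_Ω J(v,g)²·p dv dg < ∞, ∫_Ω (g + g_L)·|J(v,g)|·p dv dg < ∞, and ∫_Ω (|g − g_in|·p + a·|∂_g p|) dv dg < ∞. Then sup_{0 < v < V_F} ∫_0^∞ J(v,g)²·p(v,g) dg < ∞. -/

import Mathlib

open Real MeasureTheory Set Filter

noncomputable section

/-- The voltage flux `J(v,g) = -g_L v + g (V_E - v)`. -/
def Jflux (VE gL v g : ℝ) : ℝ := -gL * v + g * (VE - v)

/-- The Maxwellian `M(g) = exp(-(g - g_in)^2 / (2a))`. -/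
def Mw (gin a g : ℝ) : ℝ := Real.exp (-(g - gin) ^ 2 / (2 * a))

/-- A classical stationary solution of the voltage-conductance equation:
`p : (0,V_F) × [0,∞) → [0,∞)`, C¹ in `v` (with continuous boundary extension) and
C² in `g` up to `g = 0`, satisfying the stationary equation, the no-flux boundary
condition at `g = 0`, the `v`-boundary conditions changing type at `g_F = g_L V_F/(V_E - V_F)`,
the normalization, and decay (uniform in `v`) of `p`, `g² p`, `∂_g p` as `g → ∞`. -/
structure StatSol (VF VE gL gin a σE : ℝ) (p : ℝ → ℝ → ℝ) : Prop where
  nonneg : ∀ v ∈ Ioo 0 VF, ∀ g ∈ Ici (0:ℝ), 0 ≤ p v g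
  cont_v : ∀ g ∈ Ici (0:ℝ), ContinuousOn (fun v => p v g) (Icc 0 VF)
  diff_v : ∀ v ∈ Ioo 0 VF, ∀ g ∈ Ioi (0:ℝ), DifferentiableAt ℝ (fun v' => p v' g) v
  smooth_g : ∀ v ∈ Ioo 0 VF, ContDiffOn ℝ 2 (fun g => p v g) (Ici 0)
  pde : ∀ v ∈ Ioo 0 VF, ∀ g ∈ Ioi (0:ℝ),
    deriv (fun v' => Jflux VE gL v' g * p v' g) v
      + deriv (fun g' => ((gin - g') / σE) * p v g') g
      - (a / σE) * deriv (deriv (fun g' => p v g')) g = 0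
  bc_g : ∀ v ∈ Ioo 0 VF, (0 - gin) * p v 0 + a * deriv (fun g' => p v g') 0 = 0
  bc_v_low : ∀ g ∈ Ioo 0 (gL * VF / (VE - VF)),
    Jflux VE gL 0 g * p 0 g = 0 ∧ Jflux VE gL VF g * p VF g = 0
  bc_v_high : ∀ g ∈ Ici (gL * VF / (VE - VF)),
    Jflux VE gL 0 g * p 0 g = Jflux VE gL VF g * p VF g
  normalized : ∫ v in Ioo 0 VF, ∫ g in Ioi (0:ℝ), p v g = 1
  decay : ∀ ε > 0, ∃ G : ℝ, ∀ g ∈ Ici G, ∀ v ∈ Ioo 0 VF,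
    p v g < ε ∧ g ^ 2 * p v g < ε ∧ |deriv (fun g' => p v g') g| < ε

section Aux
open scoped Topology ENNReal
theorem dini_right {g H : ℝ → ℝ} {a b : ℝ} (hab : a ≤ b)
    (hcont : ContinuousOn g (Icc a b)) (φint : IntegrableOn H (Icc a b))
    (hd : ∀ t ∈ Ico a b, ∀ y, H t < y → ∀ᶠ u in 𝓝[>] t, g u - g t ≤ (u - t) * y) :
    g b - g a ≤ ∫ y in a..b, H y := by
  refine le_of_forall_pos_le_add fun ε εpos => ?_
  rcases exists_lt_lowerSemicontinuous_integral_lt H φint εpos with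
    ⟨G', f_lt_G', G'cont, G'int, G'lt_top, hG'⟩
  set s := {t | g t - g a ≤ ∫ u in a..t, (G' u).toReal} ∩ Icc a b
  have s_closed : IsClosed s := by
    have : ContinuousOn (fun t => (g t - g a, ∫ u in a..t, (G' u).toReal)) (Icc a b) := by
      rw [← uIcc_of_le hab] at G'int hcont ⊢
      exact (hcont.sub continuousOn_const).prodMk
        (intervalIntegral.continuousOn_primitive_interval G'int)
    simp only [s, inter_comm]
    exact this.preimage_isClosed_of_isClosed isClosed_Icc OrderClosedTopology.isClosed_le'
  have main : Icc a b ⊆ {t | g t - g a ≤ ∫ u in a..t, (G' u).toReal} := by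
    refine s_closed.Icc_subset_of_forall_exists_gt
      (by simp only [intervalIntegral.integral_same, mem_ofPred_eq, sub_self, le_rfl]) fun t ht v t_lt_v => ?_
    obtain ⟨y, g'_lt_y', y_lt_G'⟩ : ∃ y : ℝ, (H t : EReal) < y ∧ (y : EReal) < G' t :=
      EReal.lt_iff_exists_real_btwn.1 (f_lt_G' t)
    have I1 : ∀ᶠ u in 𝓝[>] t, (u - t) * y ≤ ∫ w in t..u, (G' w).toReal := by
      have B : ∀ᶠ u in 𝓝 t, (y : EReal) < G' u := G'cont.lowerSemicontinuousAt _ _ y_lt_G'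
      rcases mem_nhds_iff_exists_Ioo_subset.1 B with ⟨m, M, ⟨hm, hM⟩, H⟩
      have : Ioo t (min M b) ∈ 𝓝[>] t := Ioo_mem_nhdsGT (lt_min hM ht.right.right)
      filter_upwards [this] with u hu
      have I : Icc t u ⊆ Icc a b := Icc_subset_Icc ht.2.1 (hu.2.le.trans (min_le_right _ _))
      calc
        (u - t) * y = ∫ _ in Icc t u, y := by
          simp only [MeasureTheory.integral_const, MeasurableSet.univ, measureReal_restrict_apply,
            univ_inter, hu.left.le, Real.volume_real_Icc_of_le, smul_eq_mul]
        _ ≤ ∫ w in t..u, (G' w).toReal := by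
          rw [intervalIntegral.integral_of_le hu.1.le, ← integral_Icc_eq_integral_Ioc]
          apply setIntegral_mono_ae_restrict
          · simp
          · exact IntegrableOn.mono_set G'int I
          · have C1 : ∀ᵐ x : ℝ ∂volume.restrict (Icc t u), G' x < ∞ :=
              ae_mono (Measure.restrict_mono I le_rfl) G'lt_top
            have C2 : ∀ᵐ x : ℝ ∂volume.restrict (Icc t u), x ∈ Icc t u :=
              ae_restrict_mem measurableSet_Icc
            filter_upwards [C1, C2] with x G'x hx
            apply EReal.coe_le_coe_iff.1
            have : x ∈ Ioo m M := by
              simp only [hm.trans_le hx.left,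
                (hx.right.trans_lt hu.right).trans_le (min_le_left M b), mem_Ioo, and_self_iff]
            refine (H this).out.le.trans_eq ?_
            exact (EReal.coe_toReal G'x.ne (f_lt_G' x).ne_bot).symm
    have I2 : ∀ᶠ u in 𝓝[>] t, g u - g t ≤ (u - t) * y :=
      hd t ht.2 y (EReal.coe_lt_coe_iff.1 g'_lt_y')
    have I3 : ∀ᶠ u in 𝓝[>] t, g u - g t ≤ ∫ w in t..u, (G' w).toReal := by
      filter_upwards [I1, I2] with u hu1 hu2 using hu2.trans hu1
    have I4 : ∀ᶠ u in 𝓝[>] t, u ∈ Ioc t (min v b) := Ioc_mem_nhdsGT <| lt_min t_lt_v ht.2.2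
    rcases (I3.and I4).exists with ⟨x, hx, h'x⟩
    refine ⟨x, ?_, Ioc_subset_Ioc le_rfl (min_le_left _ _) h'x⟩
    calc
      g x - g a = g t - g a + (g x - g t) := by abel
      _ ≤ (∫ w in a..t, (G' w).toReal) + ∫ w in t..x, (G' w).toReal := add_le_add ht.1 hx
      _ = ∫ w in a..x, (G' w).toReal := by
        apply intervalIntegral.integral_add_adjacent_intervals
        · rw [intervalIntegrable_iff_integrableOn_Ioc_of_le ht.2.1]
          exact IntegrableOn.mono_set G'int
            (Ioc_subset_Icc_self.trans (Icc_subset_Icc le_rfl ht.2.2.le))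
        · rw [intervalIntegrable_iff_integrableOn_Ioc_of_le h'x.1.le]
          apply IntegrableOn.mono_set G'int
          exact Ioc_subset_Icc_self.trans (Icc_subset_Icc ht.2.1 (h'x.2.trans (min_le_right _ _)))
  calc
    g b - g a ≤ ∫ y in a..b, (G' y).toReal := main (right_mem_Icc.2 hab)
    _ ≤ (∫ y in a..b, H y) + ε := by
      convert! hG'.le <;>
        · rw [intervalIntegral.integral_of_le hab]
          simp only [integral_Icc_eq_integral_Ioc', Real.volume_singleton]

theorem dini_left {Y H : ℝ → ℝ} {a b : ℝ} (hab : a ≤ b)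
    (hcont : ContinuousOn Y (Icc a b)) (φint : IntegrableOn H (Icc a b))
    (hd : ∀ t ∈ Ioc a b, ∀ ε > 0, ∀ᶠ h in 𝓝[>] (0:ℝ), Y t - Y (t - h) ≤ (H t + ε) * h) :
    Y b - Y a ≤ ∫ y in a..b, H y := by
  have hc : ContinuousOn (fun s => - Y (-s)) (Icc (-b) (-a)) := by
    refine (hcont.comp continuousOn_neg ?_).neg
    intro x hx
    exact ⟨by linarith [hx.2], by linarith [hx.1]⟩
  have hi : IntegrableOn (fun s => H (-s)) (Icc (-b) (-a)) := by
    have h1 := (intervalIntegrable_iff_integrableOn_Icc_of_le hab).2 φint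
    have h2 : IntervalIntegrable (fun s => H (-s)) volume (-a) (-b) := by
      rw [← IntervalIntegrable.iff_comp_neg] ; exact h1
    exact (intervalIntegrable_iff_integrableOn_Icc_of_le (by linarith)).1 h2.symm
  have := dini_right (g := fun s => - Y (-s)) (H := fun s => H (-s)) (neg_le_neg hab) hc hi ?_
  · rw [intervalIntegral.integral_comp_neg] at this
    simp only [neg_neg] at this
    linarith
  · intro t ht y hy
    have h1 := hd (-t) ⟨by linarith [ht.2], by linarith [ht.1]⟩ (y - H (-t)) (by linarith)
    have h2 : Tendsto (fun u => u - t) (𝓝[>] t) (𝓝[>] 0) := by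
      apply tendsto_nhdsWithin_of_tendsto_nhds_of_eventually_within
      · have : Tendsto (fun u => u - t) (𝓝 t) (𝓝 (t - t)) := (continuous_sub_right t).tendsto t
        rw [sub_self] at this
        exact this.mono_left nhdsWithin_le_nhds
      · filter_upwards [self_mem_nhdsWithin] with u hu
        exact mem_Ioi.2 (sub_pos.2 (mem_Ioi.1 hu))
    filter_upwards [h2.eventually h1] with u hu
    have e : -t - (u - t) = -u := by ring
    rw [e] at hu
    nlinarith

/-- additive local-to-global -/
theorem cousin_add {Q : ℝ → ℝ → Prop} {a b : ℝ} (hab : a ≤ b)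
    (hadd : ∀ x y z, a ≤ x → x ≤ y → y ≤ z → z ≤ b → Q x y → Q y z → Q x z)
    (hrefl : Q a a)
    (hloc : ∀ x ∈ Icc a b, ∃ δ > 0, ∀ y z, a ≤ y → y ≤ x → x ≤ z → z ≤ b → z - y ≤ δ → Q y z) :
    Q a b := by
  set S := {y | y ∈ Icc a b ∧ Q a y} with hS
  have hne : S.Nonempty := ⟨a, ⟨le_rfl, hab⟩, hrefl⟩
  have hbdd : BddAbove S := ⟨b, fun y hy => hy.1.2⟩
  set c := sSup S
  have hac : a ≤ c := le_csSup hbdd ⟨⟨le_rfl, hab⟩, hrefl⟩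
  have hcb : c ≤ b := csSup_le hne fun y hy => hy.1.2
  obtain ⟨δ, hδ, h⟩ := hloc c ⟨hac, hcb⟩
  obtain ⟨y, hyS, hy⟩ := exists_lt_of_lt_csSup hne (show c - δ / 2 < c by linarith)
  have hyc : y ≤ c := le_csSup hbdd hyS
  have hz : Q y (min b (c + δ / 2)) :=
    h y _ hyS.1.1 hyc (le_min hcb (by linarith)) (min_le_left _ _)
      (by have := min_le_right b (c + δ/2); linarith)
  have h3 : Q a (min b (c + δ / 2)) :=
    hadd a y _ le_rfl hyS.1.1 (le_min hyS.1.2 (by linarith)) (min_le_left _ _) hyS.2 hz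
  have h4 : min b (c + δ / 2) ≤ c :=
    le_csSup hbdd ⟨⟨le_min hab (by linarith), min_le_left _ _⟩, h3⟩
  rcases le_total b (c + δ/2) with h5 | h5
  · rwa [min_eq_left h5] at h3
  · rw [min_eq_right h5] at h4; linarith

structure KEta where
  f : ℝ → ℝ
  f1 : ℝ → ℝ
  f2 : ℝ → ℝ
  f3 : ℝ → ℝ
  d1 : ∀ y, HasDerivAt f (f1 y) y
  d2 : ∀ y, HasDerivAt f1 (f2 y) y
  d3 : ∀ y, HasDerivAt f2 (f3 y) y
  c3 : Continuous f3
  f2_nonneg : ∀ y, 0 ≤ f2 y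

namespace KEta
variable (E : KEta)
theorem cf : Continuous E.f := continuous_iff_continuousAt.2 fun y => (E.d1 y).continuousAt
theorem cf1 : Continuous E.f1 := continuous_iff_continuousAt.2 fun y => (E.d2 y).continuousAt
theorem cf2 : Continuous E.f2 := continuous_iff_continuousAt.2 fun y => (E.d3 y).continuousAt
theorem mono1 : Monotone E.f1 := by
  apply monotone_of_deriv_nonneg (fun y => (E.d2 y).differentiableAt)
  intro y; rw [(E.d2 y).deriv]; exact E.f2_nonneg y
theorem convex_ineq (y z : ℝ) : E.f y - E.f z ≤ E.f1 y * (y - z) := by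
  rcases lt_trichotomy y z with h | h | h
  · obtain ⟨c, hc, h1⟩ := exists_hasDerivAt_eq_slope E.f E.f1 h E.cf.continuousOn (fun x _ => E.d1 x)
    rw [eq_div_iff (by linarith)] at h1
    have := E.mono1 hc.1.le
    nlinarith
  · simp [h]
  · obtain ⟨c, hc, h1⟩ := exists_hasDerivAt_eq_slope E.f E.f1 h E.cf.continuousOn (fun x _ => E.d1 x)
    rw [eq_div_iff (by linarith)] at h1
    have := E.mono1 hc.2.le
    nlinarith
end KEta

def idK : KEta where
  f := fun y => y
  f1 := fun _ => 1
  f2 := fun _ => 0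
  f3 := fun _ => 0
  d1 := fun y => hasDerivAt_id y
  d2 := fun y => hasDerivAt_const y 1
  d3 := fun y => hasDerivAt_const y 0
  c3 := continuous_const
  f2_nonneg := fun _ => le_rfl

theorem hasDerivAt_comp_max {F F' : ℝ → ℝ} (h : ∀ m, 0 ≤ m → HasDerivAt F (F' m) m)
    (h0 : F 0 = 0) (h1 : F' 0 = 0) (y : ℝ) :
    HasDerivAt (fun y => F (max y 0)) (F' (max y 0)) y := by
  rcases lt_trichotomy y 0 with hy | hy | hy
  · rw [max_eq_right hy.le, h1]
    refine (hasDerivAt_const y (0:ℝ)).congr_of_eventuallyEq ?_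
    filter_upwards [Iio_mem_nhds hy] with z hz
    rw [max_eq_right (le_of_lt hz), h0]
  · subst hy
    have hd := h 0 le_rfl
    rw [max_self, h1]
    rw [h1, hasDerivAt_iff_isLittleO] at hd
    rw [hasDerivAt_iff_isLittleO]
    simp only [h0, sub_zero, smul_zero, max_self] at hd ⊢
    have ht : Tendsto (fun y : ℝ => max y 0) (𝓝 0) (𝓝 0) := by
      have : Continuous (fun y : ℝ => max y 0) := by fun_prop
      simpa using this.tendsto 0
    refine (hd.comp_tendsto ht).trans_le ?_
    intro x
    simp only [Function.comp, Real.norm_eq_abs]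
    rcases le_total x 0 with hx | hx
    · rw [max_eq_right hx]; simp
    · rw [max_eq_left hx]
  · rw [max_eq_left hy.le]
    refine (h y hy.le).congr_of_eventuallyEq ?_
    filter_upwards [Ioi_mem_nhds hy] with z hz
    rw [max_eq_left (le_of_lt hz)]

def etaK : KEta where
  f := fun y => (max y 0)^4 / (1 + max y 0)^3
  f1 := fun y => (max y 0)^3 * (4 + max y 0) / (1 + max y 0)^4
  f2 := fun y => 12 * (max y 0)^2 / (1 + max y 0)^5
  f3 := fun y => (24 * max y 0 - 36 * (max y 0)^2) / (1 + max y 0)^6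
  d1 := by
    refine hasDerivAt_comp_max (F := fun m => m^4/(1+m)^3)
      (F' := fun m => m^3*(4+m)/(1+m)^4) ?_ (by norm_num) (by norm_num)
    intro m hm
    have hm' : (1 + m) ≠ 0 := by positivity
    have h1 : HasDerivAt (fun m : ℝ => 1 + m) 1 m := (hasDerivAt_id m).const_add 1
    refine HasDerivAt.congr_deriv ((hasDerivAt_pow 4 m).div (h1.pow 3) (pow_ne_zero _ hm')) ?_
    simp only [Pi.pow_apply, Pi.mul_apply, Nat.cast_ofNat]
    field_simp
    ring
  d2 := by
    refine hasDerivAt_comp_max (F := fun m => m^3*(4+m)/(1+m)^4)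
      (F' := fun m => 12 * m^2/(1+m)^5) ?_ (by norm_num) (by norm_num)
    intro m hm
    have hm' : (1 + m) ≠ 0 := by positivity
    have h1 : HasDerivAt (fun m : ℝ => 1 + m) 1 m := (hasDerivAt_id m).const_add 1
    have h4 : HasDerivAt (fun m : ℝ => 4 + m) 1 m := (hasDerivAt_id m).const_add 4
    refine HasDerivAt.congr_deriv (((hasDerivAt_pow 3 m).mul h4).div (h1.pow 4) (pow_ne_zero _ hm')) ?_
    simp only [Pi.pow_apply, Pi.mul_apply, Nat.cast_ofNat]
    field_simp
    ring
  d3 := by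
    refine hasDerivAt_comp_max (F := fun m => 12*m^2/(1+m)^5)
      (F' := fun m => (24 * m - 36*m^2)/(1+m)^6) ?_ (by norm_num) (by norm_num)
    intro m hm
    have hm' : (1 + m) ≠ 0 := by positivity
    have h1 : HasDerivAt (fun m : ℝ => 1 + m) 1 m := (hasDerivAt_id m).const_add 1
    refine HasDerivAt.congr_deriv (((hasDerivAt_pow 2 m).const_mul 12).div (h1.pow 5) (pow_ne_zero _ hm')) ?_
    simp only [Pi.pow_apply, Pi.mul_apply, Nat.cast_ofNat]
    field_simp
    ring
  c3 := by
    have : Continuous (fun y : ℝ => max y 0) := by fun_prop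
    refine Continuous.div (by fun_prop) (by fun_prop) ?_
    intro y
    have : 0 ≤ max y 0 := le_max_right _ _
    positivity
  f2_nonneg := by
    intro y
    have : 0 ≤ max y 0 := le_max_right _ _
    positivity

theorem etaK_nonneg (y : ℝ) : 0 ≤ etaK.f y := by
  have : 0 ≤ max y 0 := le_max_right _ _
  simp only [etaK]; positivity
theorem etaK_le (y : ℝ) : etaK.f y ≤ max y 0 := by
  have h : 0 ≤ max y 0 := le_max_right _ _
  simp only [etaK]
  generalize max y 0 = m at *
  rw [div_le_iff₀ (by positivity)]
  nlinarith [pow_nonneg h 2, pow_nonneg h 3, pow_nonneg h 4]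
theorem le_etaK (y : ℝ) : y ≤ etaK.f y + 3 := by
  have h : 0 ≤ max y 0 := le_max_right _ _
  refine (le_max_left y 0).trans ?_
  simp only [etaK]
  generalize max y 0 = m at *
  rw [← sub_le_iff_le_add, le_div_iff₀ (by positivity)]
  nlinarith [pow_nonneg h 2, pow_nonneg h 3, pow_nonneg h 4]
theorem etaK1_nonneg (y : ℝ) : 0 ≤ etaK.f1 y := by
  have : 0 ≤ max y 0 := le_max_right _ _
  simp only [etaK]; positivity
theorem etaK1_le (y : ℝ) : etaK.f1 y ≤ 1 := by
  have h : 0 ≤ max y 0 := le_max_right _ _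
  simp only [etaK]
  generalize max y 0 = m at *
  rw [div_le_iff₀ (by positivity)]
  nlinarith [pow_nonneg h 2, pow_nonneg h 3, pow_nonneg h 4]
theorem etaK_of_nonpos {y : ℝ} (hy : y ≤ 0) : etaK.f y = 0 := by
  simp only [etaK, max_eq_right hy]; norm_num
theorem etaK1_of_nonpos {y : ℝ} (hy : y ≤ 0) : etaK.f1 y = 0 := by
  simp only [etaK, max_eq_right hy]; norm_num
theorem etaK2_of_nonpos {y : ℝ} (hy : y ≤ 0) : etaK.f2 y = 0 := by
  simp only [etaK, max_eq_right hy]; norm_num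
theorem etaK_pos {y : ℝ} (hy : 0 < y) : 0 < etaK.f y := by
  simp only [etaK, max_eq_left hy.le]; positivity
theorem etaK1_mul_le (y : ℝ) : |etaK.f1 y * y| ≤ 4 * etaK.f y := by
  rcases le_total y 0 with hy | hy
  · rw [etaK1_of_nonpos hy, etaK_of_nonpos hy]; simp
  · rw [abs_of_nonneg (mul_nonneg (etaK1_nonneg y) hy)]
    simp only [etaK, max_eq_left hy]
    rw [div_mul_eq_mul_div, mul_div_assoc', div_le_div_iff₀ (by positivity) (by positivity)]
    have : 0 ≤ y^4 * (1+y)^3 := by positivity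
    nlinarith [mul_nonneg this hy]
theorem etaK_mono : Monotone etaK.f := by
  apply monotone_of_deriv_nonneg (fun y => (etaK.d1 y).differentiableAt)
  intro y; rw [(etaK.d1 y).deriv]; exact etaK1_nonneg y

/-- `w` is C² on `[l,r]` with derivatives `w1`, `w2`. -/
structure C2On (w w1 w2 : ℝ → ℝ) (l r : ℝ) : Prop where
  d1 : ∀ x ∈ Icc l r, HasDerivAt w (w1 x) x
  d2 : ∀ x ∈ Icc l r, HasDerivAt w1 (w2 x) x
  c : ContinuousOn w2 (Icc l r)

namespace C2On
variable {w w1 w2 v v1 v2 : ℝ → ℝ} {l r : ℝ}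
theorem cw (h : C2On w w1 w2 l r) : ContinuousOn w (Icc l r) :=
  fun x hx => (h.d1 x hx).continuousAt.continuousWithinAt
theorem cw1 (h : C2On w w1 w2 l r) : ContinuousOn w1 (Icc l r) :=
  fun x hx => (h.d2 x hx).continuousAt.continuousWithinAt
theorem mono (h : C2On w w1 w2 l r) {l' r' : ℝ} (hl : l ≤ l') (hr : r' ≤ r) :
    C2On w w1 w2 l' r' :=
  ⟨fun x hx => h.d1 x ⟨hl.trans hx.1, hx.2.trans hr⟩,
   fun x hx => h.d2 x ⟨hl.trans hx.1, hx.2.trans hr⟩, h.c.mono (Icc_subset_Icc hl hr)⟩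
theorem add (h : C2On w w1 w2 l r) (k : C2On v v1 v2 l r) :
    C2On (fun x => w x + v x) (fun x => w1 x + v1 x) (fun x => w2 x + v2 x) l r :=
  ⟨fun x hx => (h.d1 x hx).add (k.d1 x hx), fun x hx => (h.d2 x hx).add (k.d2 x hx), h.c.add k.c⟩
theorem const_mul (h : C2On w w1 w2 l r) (c : ℝ) :
    C2On (fun x => c * w x) (fun x => c * w1 x) (fun x => c * w2 x) l r :=
  ⟨fun x hx => (h.d1 x hx).const_mul c, fun x hx => (h.d2 x hx).const_mul c,
    continuousOn_const.mul h.c⟩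
theorem const (c l r : ℝ) : C2On (fun _ => c) (fun _ => 0) (fun _ => 0) l r :=
  ⟨fun x _ => hasDerivAt_const x c, fun x _ => hasDerivAt_const x 0, continuousOn_const⟩
theorem mul (h : C2On w w1 w2 l r) (k : C2On v v1 v2 l r) :
    C2On (fun x => w x * v x) (fun x => w1 x * v x + w x * v1 x)
      (fun x => w2 x * v x + 2 * (w1 x * v1 x) + w x * v2 x) l r := by
  refine ⟨fun x hx => (h.d1 x hx).mul (k.d1 x hx), fun x hx => ?_, ?_⟩
  · refine (((h.d2 x hx).mul (k.d1 x hx)).add ((h.d1 x hx).mul (k.d2 x hx))).congr_deriv ?_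
    ring
  · exact ((h.c.mul k.cw).add (continuousOn_const.mul (h.cw1.mul k.cw1))).add (h.cw.mul k.c)
theorem congr (h : C2On w w1 w2 l r) (e : ∀ x, w x = v x) (e1 : ∀ x, w1 x = v1 x)
    (e2 : ∀ x, w2 x = v2 x) : C2On v v1 v2 l r := by
  rw [← funext e, ← funext e1, ← funext e2]; exact h
theorem id (l r : ℝ) : C2On (fun x => x) (fun _ => 1) (fun _ => 0) l r :=
  ⟨fun x _ => hasDerivAt_id x, fun x _ => hasDerivAt_const x 1, continuousOn_const⟩
/-- composition with a C² function -/
theorem comp (h : C2On w w1 w2 l r) {F F1 F2 : ℝ → ℝ}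
    (hF : ∀ x ∈ Icc l r, HasDerivAt F (F1 (w x)) (w x))
    (hF1 : ∀ x ∈ Icc l r, HasDerivAt F1 (F2 (w x)) (w x))
    (hF2 : ContinuousOn (fun x => F2 (w x)) (Icc l r)) :
    C2On (fun x => F (w x)) (fun x => F1 (w x) * w1 x)
      (fun x => F2 (w x) * (w1 x)^2 + F1 (w x) * w2 x) l r := by
  refine ⟨fun x hx => (hF x hx).comp x (h.d1 x hx), fun x hx => ?_, ?_⟩
  · refine (((hF1 x hx).comp x (h.d1 x hx)).mul (h.d2 x hx)).congr_deriv ?_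
    simp only [Function.comp]
    ring
  · have : ContinuousOn (fun x => F1 (w x)) (Icc l r) := fun x hx =>
      ((hF1 x hx).comp x (h.d1 x hx)).continuousAt.continuousWithinAt
    exact (hF2.mul (h.cw1.pow 2)).add (this.mul h.c)
end C2On

theorem C2On.eta1 {w w1 w2 : ℝ → ℝ} {l r : ℝ} (h : C2On w w1 w2 l r) (E : KEta) :
    C2On (fun x => E.f1 (w x)) (fun x => E.f2 (w x) * w1 x)
      (fun x => E.f3 (w x) * (w1 x)^2 + E.f2 (w x) * w2 x) l r :=
  h.comp (fun x _ => E.d2 (w x)) (fun x _ => E.d3 (w x)) (E.c3.comp_continuousOn h.cw)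

structure Sys where
  (A b0 b1 jm Cc T1 T2 L R : ℝ)
  (j0 j1 : ℝ → ℝ)
  (u ut ux uxx : ℝ → ℝ → ℝ)
  hA : 0 < A
  hjm : 0 < jm
  hT : T1 < T2
  hLR : L < R
  cj0 : Continuous j0
  cj1 : Continuous j1
  u_nonneg : ∀ t ∈ Ioo T1 T2, ∀ x ∈ Icc L R, 0 ≤ u t x
  c2 : ∀ t ∈ Ioo T1 T2, C2On (u t) (ux t) (uxx t) L R
  dt : ∀ t ∈ Ioo T1 T2, ∀ x ∈ Icc L R, HasDerivAt (fun s => u s x) (ut t x) t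
  pde : ∀ t ∈ Ioo T1 T2, ∀ x ∈ Icc L R,
    j1 x * u t x + (j0 x + t * j1 x) * ut t x
      = A * uxx t x + (b0 + b1 * x) * ux t x + b1 * u t x
  j_lb : ∀ t ∈ Ioo T1 T2, ∀ x ∈ Icc L R, jm ≤ j0 x + t * j1 x
  j_ub : ∀ t ∈ Ioo T1 T2, ∀ x ∈ Icc L R, j0 x + t * j1 x ≤ Cc
  hj1 : ∀ x ∈ Icc L R, |j1 x| ≤ Cc
  hb : ∀ x ∈ Icc L R, |b0 + b1 * x| ≤ Cc
  hb1 : |b1| ≤ Cc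
  hAC : A ≤ Cc
  lat : ∀ x ∈ Icc L R, ∃ B, ∀ t ∈ Ioo T1 T2, u t x ≤ B
  small : 40 * Cc * (T2 - T1) ≤ jm

namespace Sys
variable (S : Sys)
def j (t x : ℝ) : ℝ := S.j0 x + t * S.j1 x
def b (x : ℝ) : ℝ := S.b0 + S.b1 * x
def Rr (t x : ℝ) : ℝ := S.A * S.uxx t x + S.b x * S.ux t x + S.b1 * S.u t x

theorem hCc : 0 < S.Cc := S.hA.trans_le S.hAC
theorem cj (t : ℝ) : Continuous (S.j t) := S.cj0.add (continuous_const.mul S.cj1)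
theorem cb : Continuous S.b := by unfold Sys.b; fun_prop
theorem jlb {t x : ℝ} (ht : t ∈ Ioo S.T1 S.T2) (hx : x ∈ Icc S.L S.R) : S.jm ≤ S.j t x :=
  S.j_lb t ht x hx
theorem jpos {t x : ℝ} (ht : t ∈ Ioo S.T1 S.T2) (hx : x ∈ Icc S.L S.R) : 0 < S.j t x :=
  S.hjm.trans_le (S.j_lb t ht x hx)
theorem jub {t x : ℝ} (ht : t ∈ Ioo S.T1 S.T2) (hx : x ∈ Icc S.L S.R) : S.j t x ≤ S.Cc :=
  S.j_ub t ht x hx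
theorem pde' {t x : ℝ} (ht : t ∈ Ioo S.T1 S.T2) (hx : x ∈ Icc S.L S.R) :
    S.j1 x * S.u t x + S.j t x * S.ut t x = S.Rr t x := S.pde t ht x hx
theorem bbd {x : ℝ} (hx : x ∈ Icc S.L S.R) : |S.b x| ≤ S.Cc := S.hb x hx
theorem cRr {t : ℝ} (ht : t ∈ Ioo S.T1 S.T2) : ContinuousOn (S.Rr t) (Icc S.L S.R) := by
  have h := S.c2 t ht
  exact ((continuousOn_const.mul h.c).add (S.cb.continuousOn.mul h.cw1)).add
    (continuousOn_const.mul h.cw)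

/-- general second order expression -/
def Lop (w w1 w2 : ℝ → ℝ) (x : ℝ) : ℝ := S.A * w2 x + S.b x * w1 x + S.b1 * w x

theorem byparts {φ φ1 φ2 w w1 w2 : ℝ → ℝ} {l r : ℝ} (hlr : l ≤ r)
    (hφ : C2On φ φ1 φ2 l r) (hw : C2On w w1 w2 l r) :
    ∫ x in l..r, φ x * S.Lop w w1 w2 x =
      (∫ x in l..r, (S.A * φ2 x - S.b x * φ1 x) * w x)
      + (S.A * (φ r * w1 r - φ1 r * w r) + φ r * S.b r * w r)
      - (S.A * (φ l * w1 l - φ1 l * w l) + φ l * S.b l * w l) := by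
  have cb := S.cb.continuousOn (s := Icc l r)
  have i1 : IntervalIntegrable (fun x => φ x * S.Lop w w1 w2 x) volume l r := by
    apply ContinuousOn.intervalIntegrable
    rw [uIcc_of_le hlr]
    exact hφ.cw.mul (((continuousOn_const.mul hw.c).add (cb.mul hw.cw1)).add
      (continuousOn_const.mul hw.cw))
  have i2 : IntervalIntegrable (fun x => (S.A * φ2 x - S.b x * φ1 x) * w x) volume l r := by
    apply ContinuousOn.intervalIntegrable
    rw [uIcc_of_le hlr]
    exact ((continuousOn_const.mul hφ.c).sub (cb.mul hφ.cw1)).mul hw.cw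
  have key := intervalIntegral.integral_eq_sub_of_hasDerivAt
    (f := fun x => S.A * (φ x * w1 x - φ1 x * w x) + φ x * S.b x * w x)
    (f' := fun x => φ x * S.Lop w w1 w2 x - (S.A * φ2 x - S.b x * φ1 x) * w x)
    (a := l) (b := r) ?_ (i1.sub i2)
  · rw [intervalIntegral.integral_sub i1 i2] at key
    linarith
  · intro x hx
    rw [uIcc_of_le hlr] at hx
    have hb : HasDerivAt S.b S.b1 x := by
      unfold Sys.b
      simpa using ((hasDerivAt_id x).const_mul S.b1).const_add S.b0
    have a1 := (((hφ.d1 x hx).mul (hw.d2 x hx)).sub ((hφ.d2 x hx).mul (hw.d1 x hx))).const_mul S.A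
    have a2 := ((hφ.d1 x hx).mul hb).mul (hw.d1 x hx)
    refine (a1.add a2).congr_deriv ?_
    simp only [Lop, Pi.mul_apply]
    ring

def Test (φ : ℝ → ℝ) (l r : ℝ) : Prop :=
  ContinuousOn φ (Icc l r) ∧ ∃ (κ : ℝ → ℝ) (m c1 c2 c3 : ℝ),
    IntervalIntegrable κ volume l r ∧ m ∈ Icc l r ∧
    ∀ w w1 w2 : ℝ → ℝ, C2On w w1 w2 l r →
      ∫ x in l..r, φ x * S.Lop w w1 w2 x =
        (∫ x in l..r, κ x * w x) + c1 * w l + c2 * w m + c3 * w r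

theorem test_c2 {φ φ1 φ2 : ℝ → ℝ} {l r : ℝ} (hlr : l ≤ r)
    (hφ : C2On φ φ1 φ2 l r) (h1 : φ l = 0) (h2 : φ r = 0) : S.Test φ l r := by
  refine ⟨hφ.cw, fun x => S.A * φ2 x - S.b x * φ1 x, l, S.A * φ1 l, 0, - S.A * φ1 r, ?_,
    left_mem_Icc.2 hlr, ?_⟩
  · apply ContinuousOn.intervalIntegrable
    rw [uIcc_of_le hlr]
    exact (continuousOn_const.mul hφ.c).sub (S.cb.continuousOn.mul hφ.cw1)
  · intro w w1 w2 hw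
    rw [S.byparts hlr hφ hw, h1, h2]
    ring

def GoodOn (α β : ℝ) : Prop :=
  (∀ l r, S.L < l → l ≤ r → r < S.R → ∃ B, ∀ t ∈ Ioo α β, ∀ x ∈ Icc l r, S.u t x ≤ B) ∧
  (∀ φ l r, S.L < l → l < r → r < S.R → S.Test φ l r → ∀ t ∈ Ioo α β,
    HasDerivAt (fun s => ∫ x in l..r, φ x * (S.j s x * S.u s x)) (∫ x in l..r, φ x * S.Rr t x) t)

def Good (t : ℝ) : Prop := ∃ α β, α < t ∧ t < β ∧ S.T1 ≤ α ∧ β ≤ S.T2 ∧ S.GoodOn α β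

theorem Good.mem {S : Sys} {t : ℝ} (h : S.Good t) : t ∈ Ioo S.T1 S.T2 := by
  obtain ⟨α, β, h1, h2, h3, h4, _⟩ := h
  exact ⟨h3.trans_lt h1, h2.trans_le h4⟩

theorem Good.nhds {S : Sys} {t : ℝ} (h : S.Good t) : ∀ᶠ s in 𝓝 t, S.Good s := by
  obtain ⟨α, β, h1, h2, h3, h4, h5⟩ := h
  filter_upwards [Ioo_mem_nhds h1 h2] with s hs
  exact ⟨α, β, hs.1, hs.2, h3, h4, h5⟩

theorem Good.bdd {S : Sys} {t : ℝ} (h : S.Good t) {l r : ℝ} (hl : S.L < l) (hlr : l ≤ r)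
    (hr : r < S.R) : ∃ B, ∀ᶠ s in 𝓝 t, ∀ x ∈ Icc l r, S.u s x ≤ B := by
  obtain ⟨α, β, h1, h2, h3, h4, h5⟩ := h
  obtain ⟨B, hB⟩ := h5.1 l r hl hlr hr
  refine ⟨B, ?_⟩
  filter_upwards [Ioo_mem_nhds h1 h2] with s hs x hx using hB s hs x hx

theorem Good.deriv {S : Sys} {t : ℝ} (h : S.Good t) {φ : ℝ → ℝ} {l r : ℝ} (hl : S.L < l)
    (hlr : l < r) (hr : r < S.R) (hφ : S.Test φ l r) :
    HasDerivAt (fun s => ∫ x in l..r, φ x * (S.j s x * S.u s x)) (∫ x in l..r, φ x * S.Rr t x) t := by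
  obtain ⟨α, β, h1, h2, h3, h4, h5⟩ := h
  exact h5.2 φ l r hl hlr hr hφ t ⟨h1, h2⟩

theorem cont_t {t x : ℝ} (ht : t ∈ Ioo S.T1 S.T2) (hx : x ∈ Icc S.L S.R) :
    ContinuousAt (fun s => S.u s x) t := (S.dt t ht x hx).continuousAt

end Sys

/-- bounded convergence on a compact interval -/
theorem bct {ι : Type*} {𝓕 : Filter ι} [𝓕.IsCountablyGenerated] {g : ι → ℝ → ℝ} {g0 : ℝ → ℝ} {l r : ℝ}
    (hlr : l ≤ r) (hc : ∀ᶠ s in 𝓕, ContinuousOn (g s) (Icc l r))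
    (hb : ∃ C, ∀ᶠ s in 𝓕, ∀ x ∈ Icc l r, |g s x| ≤ C)
    (hl : ∀ x ∈ Icc l r, Tendsto (fun s => g s x) 𝓕 (𝓝 (g0 x))) :
    Tendsto (fun s => ∫ x in l..r, g s x) 𝓕 (𝓝 (∫ x in l..r, g0 x)) := by
  obtain ⟨C, hC⟩ := hb
  have hsub : uIoc l r ⊆ Icc l r := by rw [uIoc_of_le hlr]; exact Ioc_subset_Icc_self
  apply intervalIntegral.tendsto_integral_filter_of_dominated_convergence (fun _ => C)
  · filter_upwards [hc] with s hs
    exact (hs.mono hsub).aestronglyMeasurable measurableSet_uIoc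
  · filter_upwards [hC] with s hs
    exact ae_of_all _ fun x hx => by rw [Real.norm_eq_abs]; exact hs x (hsub hx)
  · exact intervalIntegrable_const
  · exact ae_of_all _ fun x hx => hl x (hsub hx)

theorem contOn_bdd {g : ℝ → ℝ} {l r : ℝ} (hg : ContinuousOn g (Icc l r)) :
    ∃ C, 0 ≤ C ∧ ∀ x ∈ Icc l r, |g x| ≤ C := by
  obtain ⟨C, hC⟩ := isCompact_Icc.exists_bound_of_continuousOn hg
  exact ⟨max C 0, le_max_right _ _, fun x hx => (hC x hx).trans (le_max_left _ _)⟩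

theorem ii_of_contOn {g : ℝ → ℝ} {l r : ℝ} (hlr : l ≤ r) (hg : ContinuousOn g (Icc l r)) :
    IntervalIntegrable g volume l r := by
  apply ContinuousOn.intervalIntegrable
  rwa [uIcc_of_le hlr]

theorem tendsto_sub_right_nhds (τ : ℝ) : Tendsto (fun h : ℝ => τ - h) (𝓝[>] 0) (𝓝 τ) := by
  have : Tendsto (fun h : ℝ => τ - h) (𝓝 0) (𝓝 (τ - 0)) := (continuous_sub_left τ).tendsto 0
  rw [sub_zero] at this
  exact this.mono_left nhdsWithin_le_nhds

theorem tendsto_left_quot {N : ℝ → ℝ} {d τ : ℝ} (h : HasDerivAt N d τ) :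
    Tendsto (fun h => (N τ - N (τ - h)) / h) (𝓝[>] 0) (𝓝 d) := by
  have h1 := hasDerivAt_iff_tendsto_slope_zero.1 h
  have h2 : Tendsto (fun h : ℝ => -h) (𝓝[>] 0) (𝓝[≠] 0) := by
    apply tendsto_nhdsWithin_of_tendsto_nhds_of_eventually_within
    · have : Tendsto (fun h : ℝ => -h) (𝓝 0) (𝓝 (-0)) := continuous_neg.tendsto 0
      rw [neg_zero] at this
      exact this.mono_left nhdsWithin_le_nhds
    · filter_upwards [self_mem_nhdsWithin] with u hu
      have : (0:ℝ) < u := hu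
      exact mem_compl_singleton_iff.2 (by linarith)
  refine (h1.comp h2).congr fun h => ?_
  simp only [Function.comp, smul_eq_mul, ← sub_eq_add_neg]
  rw [inv_neg, neg_mul, ← mul_neg, neg_sub, div_eq_inv_mul]

namespace Sys
variable (S : Sys)

theorem Good.wbdd {S : Sys} {τ : ℝ} (hτ : S.Good τ) {l r : ℝ} (hl : S.L < l) (hlr : l ≤ r)
    (hr : r < S.R) {F0 : ℝ → ℝ} (hF : ContinuousOn F0 (Icc l r)) (F1 e : ℝ) :
    ∃ M, ∀ᶠ s in 𝓝 τ, ∀ x ∈ Icc l r, |e * (S.u s x - (F0 x + s * F1))| ≤ M := by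
  obtain ⟨B, hB⟩ := hτ.bdd hl hlr hr
  obtain ⟨C, hC0, hC⟩ := contOn_bdd hF
  refine ⟨|e| * (B + (C + (|τ| + 1) * |F1|)), ?_⟩
  have h1 : ∀ᶠ s in 𝓝 τ, |s| < |τ| + 1 :=
    (continuous_abs.tendsto τ).eventually (gt_mem_nhds (by linarith))
  filter_upwards [hB, h1, Ioo_mem_nhds hτ.mem.1 hτ.mem.2] with s hs hs1 hsT x hx
  have hu := S.u_nonneg s hsT x ⟨hl.le.trans hx.1, hx.2.trans hr.le⟩
  rw [abs_mul]
  refine mul_le_mul_of_nonneg_left ?_ (abs_nonneg e)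
  refine (abs_sub _ _).trans ?_
  rw [abs_of_nonneg hu]
  refine add_le_add (hs x hx) ((abs_add_le _ _).trans (add_le_add (hC x hx) ?_))
  rw [abs_mul]
  exact mul_le_mul_of_nonneg_right hs1.le (abs_nonneg _)

theorem Good.fbdd {S : Sys} {τ : ℝ} (hτ : S.Good τ) {l r : ℝ} (hl : S.L < l) (hlr : l ≤ r)
    (hr : r < S.R) {F0 : ℝ → ℝ} (hF : ContinuousOn F0 (Icc l r)) (F1 e : ℝ) {f : ℝ → ℝ}
    (hf : Continuous f) :
    ∃ M, 0 ≤ M ∧ ∀ᶠ s in 𝓝 τ, ∀ x ∈ Icc l r, |f (e * (S.u s x - (F0 x + s * F1)))| ≤ M := by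
  obtain ⟨M, hM⟩ := hτ.wbdd hl hlr hr hF F1 e
  obtain ⟨C, hC0, hC⟩ := contOn_bdd (hf.continuousOn (s := Icc (-M) M))
  refine ⟨C, hC0, ?_⟩
  filter_upwards [hM] with s hs x hx using hC _ (abs_le.1 (hs x hx))

theorem kato_slope (E : KEta) {τ : ℝ} (hτ : S.Good τ) {l r : ℝ} (hl : S.L < l) (hlr : l < r)
    (hr : r < S.R) {ψ : ℝ → ℝ → ℝ} {ψ1 ψ2 ψt : ℝ → ℝ}
    (hψ2 : C2On (ψ τ) ψ1 ψ2 l r)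
    (hψ0 : ∀ x ∈ Icc l r, 0 ≤ ψ τ x)
    (hψc : ∀ᶠ s in 𝓝 τ, ContinuousOn (ψ s) (Icc l r))
    (hψt : ∀ x ∈ Icc l r, HasDerivAt (fun s => ψ s x) (ψt x) τ)
    (hψL : ∃ C, ∀ᶠ s in 𝓝 τ, ∀ x ∈ Icc l r, |ψ τ x - ψ s x| ≤ C * |τ - s|)
    {F0 F01 F02 : ℝ → ℝ} (hF : C2On F0 F01 F02 l r) (F1 e : ℝ)
    (hφl : ψ τ l * E.f1 (e * (S.u τ l - (F0 l + τ * F1))) = 0)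
    (hφr : ψ τ r * E.f1 (e * (S.u τ r - (F0 r + τ * F1))) = 0)
    (ε : ℝ) (hε : 0 < ε) :
    ∀ᶠ h in 𝓝[>] (0:ℝ),
      (∫ x in l..r, ψ τ x * S.j τ x * E.f (e * (S.u τ x - (F0 x + τ * F1))))
      - (∫ x in l..r, ψ (τ - h) x * S.j (τ - h) x *
          E.f (e * (S.u (τ - h) x - (F0 x + (τ - h) * F1))))
      ≤ ((∫ x in l..r, ((ψt x * S.j τ x + ψ τ x * S.j1 x) *
            E.f (e * (S.u τ x - (F0 x + τ * F1)))
          + e * (ψ τ x * E.f1 (e * (S.u τ x - (F0 x + τ * F1))) *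
              (S.Rr τ x - S.j1 x * S.u τ x - S.j τ x * F1)))) + ε) * h := by
  have hsub : Icc l r ⊆ Icc S.L S.R := Icc_subset_Icc hl.le hr.le
  have hTn : Ioo S.T1 S.T2 ∈ 𝓝 τ := Ioo_mem_nhds hτ.mem.1 hτ.mem.2
  set w : ℝ → ℝ → ℝ := fun s x => e * (S.u s x - (F0 x + s * F1)) with hw
  set φ : ℝ → ℝ := fun x => ψ τ x * E.f1 (w τ x) with hφ
  have cu : ∀ s ∈ Ioo S.T1 S.T2, ContinuousOn (S.u s) (Icc l r) := fun s hs =>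
    (S.c2 s hs).cw.mono hsub
  have cw : ∀ s ∈ Ioo S.T1 S.T2, ContinuousOn (w s) (Icc l r) := fun s hs =>
    continuousOn_const.mul ((cu s hs).sub (hF.cw.add continuousOn_const))
  have hwC2 : ∃ w1 w2, C2On (w τ) w1 w2 l r := by
    have h1 := ((S.c2 τ hτ.mem).mono hl.le hr.le)
    exact ⟨_, _, ((h1.add ((hF.add (C2On.const (τ * F1) l r)).const_mul (-1))).const_mul e).congr
      (fun x => by simp only [hw]; ring) (fun x => rfl) (fun x => rfl)⟩
  obtain ⟨w1, w2, hwC2⟩ := hwC2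
  have hφC2 := hψ2.mul (hwC2.eta1 E)
  have hT : S.Test φ l r := S.test_c2 hlr.le hφC2 hφl hφr
  have cφ : ContinuousOn φ (Icc l r) := hφC2.cw
  have cj : ∀ s, ContinuousOn (S.j s) (Icc l r) := fun s => (S.cj s).continuousOn
  have cj1 : ContinuousOn S.j1 (Icc l r) := S.cj1.continuousOn
  have cRr : ContinuousOn (S.Rr τ) (Icc l r) := (S.cRr hτ.mem).mono hsub
  have cψ := hψ2.cw
  have hN := tendsto_left_quot (hτ.deriv hl hlr hr hT)
  have t0 := tendsto_sub_right_nhds τ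
  -- the limit of I3
  have h3 : Tendsto (fun h => ∫ x in l..r, φ x * S.j1 x * S.u (τ - h) x) (𝓝[>] 0)
      (𝓝 (∫ x in l..r, φ x * S.j1 x * S.u τ x)) := by
    apply bct hlr.le
    · filter_upwards [t0.eventually hTn] with h hh
      exact (cφ.mul cj1).mul (cu _ hh)
    · obtain ⟨C, hC0, hC⟩ := contOn_bdd (cφ.mul cj1)
      obtain ⟨B, hB0, hB⟩ := hτ.fbdd hl hlr.le hr (continuousOn_const (c := (0:ℝ))) 0 1 continuous_id
      refine ⟨C * B, ?_⟩
      filter_upwards [t0.eventually hB] with h hh x hx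
      have := hh x hx
      simp only [mul_zero, add_zero, sub_zero, one_mul, id] at this
      rw [abs_mul]
      exact mul_le_mul (hC x hx) this (abs_nonneg _) hC0
    · intro x hx
      exact (((S.cont_t hτ.mem (hsub hx)).tendsto.comp t0).const_mul _)
  -- the limit of I1
  have h1 : Tendsto (fun h => ∫ x in l..r,
        ((ψ τ x * S.j τ x - ψ (τ - h) x * S.j (τ - h) x) / h) * E.f (w (τ - h) x)) (𝓝[>] 0)
      (𝓝 (∫ x in l..r, (ψt x * S.j τ x + ψ τ x * S.j1 x) * E.f (w τ x))) := by
    apply bct hlr.le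
    · filter_upwards [t0.eventually hTn, t0.eventually hψc] with h hh hh2
      exact (((cψ.mul (cj τ)).sub (hh2.mul (cj _))).div_const h).mul (E.cf.comp_continuousOn (cw _ hh))
    · obtain ⟨C, hC⟩ := hψL
      obtain ⟨B, hB0, hB⟩ := hτ.fbdd hl hlr.le hr hF.cw F1 e E.cf
      obtain ⟨D, hD0, hD⟩ := contOn_bdd cψ
      refine ⟨(|C| * S.Cc + D * S.Cc) * B, ?_⟩
      filter_upwards [t0.eventually hB, t0.eventually hC, t0.eventually hTn, self_mem_nhdsWithin]
        with h hhB hhC hhT hpos x hx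
      have hpos : 0 < h := hpos
      rw [abs_mul]
      refine mul_le_mul ?_ (hhB x hx) (abs_nonneg _)
        (add_nonneg (mul_nonneg (abs_nonneg _) S.hCc.le) (mul_nonneg hD0 S.hCc.le))
      have e1 : ψ τ x * S.j τ x - ψ (τ - h) x * S.j (τ - h) x
        = (ψ τ x - ψ (τ - h) x) * S.j (τ - h) x + ψ τ x * (h * S.j1 x) := by
        simp only [Sys.j]; ring
      rw [e1, abs_div, abs_of_pos hpos, div_le_iff₀ hpos]
      refine (abs_add_le _ _).trans ?_
      rw [abs_mul, abs_mul, abs_mul]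
      have i1 := hhC x hx
      rw [show τ - (τ - h) = h by ring, abs_of_pos hpos] at i1
      have i2 : |S.j (τ - h) x| ≤ S.Cc := by
        rw [abs_of_pos (S.jpos hhT (hsub hx))]; exact S.jub hhT (hsub hx)
      have i3 := S.hj1 x (hsub hx)
      have i4 := hD x hx
      rw [abs_of_pos hpos]
      have k1 : |ψ τ x - ψ (τ - h) x| * |S.j (τ - h) x| ≤ (|C| * h) * S.Cc :=
        mul_le_mul (i1.trans (mul_le_mul_of_nonneg_right (le_abs_self C) hpos.le)) i2 (abs_nonneg _)
          (by positivity)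
      have k2 : |ψ τ x| * (h * |S.j1 x|) ≤ D * (h * S.Cc) :=
        mul_le_mul i4 (mul_le_mul_of_nonneg_left i3 hpos.le) (by positivity) hD0
      linarith
    · intro x hx
      refine Tendsto.mul ?_ ?_
      · have hj : HasDerivAt (fun s => S.j s x) (S.j1 x) τ := by
          unfold Sys.j
          simpa using ((hasDerivAt_id τ).mul_const (S.j1 x)).const_add (S.j0 x)
        exact tendsto_left_quot ((hψt x hx).mul hj)
      · refine (E.cf.tendsto _).comp ?_
        refine Tendsto.const_mul _ (Tendsto.sub ?_ (Tendsto.add tendsto_const_nhds (t0.mul_const F1)))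
        exact (S.cont_t hτ.mem (hsub hx)).tendsto.comp t0
  have hlim := (h1.add (((hN.sub h3).sub_const (∫ x in l..r, φ x * (S.j τ x * F1))).const_mul e))
  have iφu : IntervalIntegrable (fun x => φ x * S.Rr τ x) volume l r := ii_of_contOn hlr.le (cφ.mul cRr)
  have i4 : IntervalIntegrable (fun x => φ x * (S.j τ x * F1)) volume l r :=
    ii_of_contOn hlr.le (cφ.mul ((cj τ).mul continuousOn_const))
  have i3 : ∀ s ∈ Ioo S.T1 S.T2, IntervalIntegrable (fun x => φ x * S.j1 x * S.u s x) volume l r :=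
    fun s hs => ii_of_contOn hlr.le ((cφ.mul cj1).mul (cu s hs))
  have hval : (∫ x in l..r, ((ψt x * S.j τ x + ψ τ x * S.j1 x) * E.f (w τ x)
          + e * (φ x * (S.Rr τ x - S.j1 x * S.u τ x - S.j τ x * F1))))
      = (∫ x in l..r, (ψt x * S.j τ x + ψ τ x * S.j1 x) * E.f (w τ x))
        + e * ((∫ x in l..r, φ x * S.Rr τ x) - (∫ x in l..r, φ x * S.j1 x * S.u τ x)
          - ∫ x in l..r, φ x * (S.j τ x * F1)) := by
    rw [← intervalIntegral.integral_sub iφu (i3 τ hτ.mem),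
      ← intervalIntegral.integral_sub (iφu.sub (i3 τ hτ.mem)) i4,
      ← intervalIntegral.integral_const_mul, ← intervalIntegral.integral_add]
    · refine intervalIntegral.integral_congr fun x _ => ?_
      ring
    · -- integrability of the ψt part
      have m1 : AEStronglyMeasurable ψt (volume.restrict (Ioc l r)) := by
        -- limit of measurable functions
        have hsq : ∃ N : ℕ → ℝ, Tendsto N atTop (𝓝[>] (0:ℝ)) := exists_seq_tendsto _
        obtain ⟨N, hN⟩ := hsq
        obtain ⟨K, hK⟩ := ((hN.eventually (t0.eventually hψc))).exists_forall_of_atTop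
        refine aestronglyMeasurable_of_tendsto_ae (u := atTop)
          (f := fun n x => (ψ τ x - ψ (τ - N (n + K)) x) / N (n + K)) ?_ ?_
        · intro n
          have c1 : ContinuousOn (fun x => (ψ τ x - ψ (τ - N (n + K)) x) / N (n + K)) (Icc l r) :=
            (cψ.sub (hK (n + K) (by omega))).div_const _
          exact (c1.mono Ioc_subset_Icc_self).aestronglyMeasurable measurableSet_Ioc
        · refine (ae_restrict_iff' measurableSet_Ioc).2 (ae_of_all _ fun x hx => ?_)
          have := (tendsto_left_quot (hψt x (Ioc_subset_Icc_self hx))).comp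
            (hN.comp (tendsto_add_atTop_nat K))
          exact this
      obtain ⟨C, hC⟩ := hψL
      have b1 : ∀ x ∈ Icc l r, |ψt x| ≤ C := by
        intro x hx
        have := (tendsto_left_quot (hψt x hx)).abs
        refine le_of_tendsto this ?_
        filter_upwards [t0.eventually hC, self_mem_nhdsWithin] with h hh hpos
        have hpos : 0 < h := hpos
        have i1 := hh x hx
        rw [show τ - (τ - h) = h by ring, abs_of_pos hpos] at i1
        rw [abs_div, abs_of_pos hpos, div_le_iff₀ hpos]
        exact i1
      have i0 : IntervalIntegrable ψt volume l r := by
        rw [intervalIntegrable_iff_integrableOn_Ioc_of_le hlr.le]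
        refine Integrable.mono' (integrable_const C) m1 ?_
        refine (ae_restrict_iff' measurableSet_Ioc).2 (ae_of_all _ fun x hx => ?_)
        exact b1 x (Ioc_subset_Icc_self hx)
      have cc : ContinuousOn (fun x => E.f (w τ x)) (Icc l r) := E.cf.comp_continuousOn (cw _ hτ.mem)
      have i5 : IntervalIntegrable (fun x => ψt x * (S.j τ x * E.f (w τ x))
          + ψ τ x * S.j1 x * E.f (w τ x)) volume l r := by
        refine (i0.mul_continuousOn ?_).add (ii_of_contOn hlr.le ((cψ.mul cj1).mul cc))
        rw [uIcc_of_le hlr.le]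
        exact (cj τ).mul cc
      refine i5.congr ?_
      exact fun x _ => by ring
    · exact ((iφu.sub (i3 τ hτ.mem)).sub i4).const_mul e
  rw [← hval] at hlim
  have hev := hlim.eventually (gt_mem_nhds (lt_add_of_pos_right _ hε))
  filter_upwards [hev, t0.eventually hTn, t0.eventually hψc, self_mem_nhdsWithin] with h hh hhT hhc hpos
  have hpos : 0 < h := hpos
  refine le_trans ?_ (mul_le_mul_of_nonneg_right hh.le hpos.le)
  have cf0 : ContinuousOn (fun x => E.f (w τ x)) (Icc l r) := E.cf.comp_continuousOn (cw _ hτ.mem)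
  have cfh : ContinuousOn (fun x => E.f (w (τ - h) x)) (Icc l r) := E.cf.comp_continuousOn (cw _ hhT)
  have I0 : IntervalIntegrable (fun x => ψ τ x * S.j τ x * E.f (w τ x)) volume l r :=
    ii_of_contOn hlr.le ((cψ.mul (cj τ)).mul cf0)
  have Ih : IntervalIntegrable (fun x => ψ (τ-h) x * S.j (τ-h) x * E.f (w (τ-h) x)) volume l r :=
    ii_of_contOn hlr.le ((hhc.mul (cj _)).mul cfh)
  have J1 : IntervalIntegrable (fun x => ((ψ τ x * S.j τ x - ψ (τ - h) x * S.j (τ - h) x) / h)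
      * E.f (w (τ - h) x)) volume l r :=
    ii_of_contOn hlr.le ((((cψ.mul (cj τ)).sub (hhc.mul (cj _))).div_const h).mul cfh)
  have J2 : IntervalIntegrable (fun x => φ x * (S.j τ x * S.u τ x)) volume l r :=
    ii_of_contOn hlr.le (cφ.mul ((cj τ).mul (cu _ hτ.mem)))
  have J3 : IntervalIntegrable (fun x => φ x * (S.j (τ-h) x * S.u (τ-h) x)) volume l r :=
    ii_of_contOn hlr.le (cφ.mul ((cj _).mul (cu _ hhT)))
  have J4 := i3 (τ - h) hhT
  rw [← intervalIntegral.integral_sub I0 Ih, ← intervalIntegral.integral_sub J2 J3,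
    ← intervalIntegral.integral_div, ← intervalIntegral.integral_sub ((J2.sub J3).div_const h) J4,
    ← intervalIntegral.integral_sub (((J2.sub J3).div_const h).sub J4) i4,
    ← intervalIntegral.integral_const_mul,
    ← intervalIntegral.integral_add J1 (((((J2.sub J3).div_const h).sub J4).sub i4).const_mul e),
    ← intervalIntegral.integral_mul_const]
  refine intervalIntegral.integral_mono_on hlr.le (I0.sub Ih)
    ((J1.add (((((J2.sub J3).div_const h).sub J4).sub i4).const_mul e)).mul_const h) ?_
  intro x hx
  have hconv := E.convex_ineq (w τ x) (w (τ - h) x)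
  have hj0 : 0 ≤ ψ τ x * S.j τ x := mul_nonneg (hψ0 x hx) (S.jpos hτ.mem (hsub hx)).le
  have h5 := mul_le_mul_of_nonneg_left hconv hj0
  have e1 : ((ψ τ x * S.j τ x - ψ (τ - h) x * S.j (τ - h) x) / h * E.f (w (τ - h) x)
      + e * ((φ x * (S.j τ x * S.u τ x) - φ x * (S.j (τ - h) x * S.u (τ - h) x)) / h
        - φ x * S.j1 x * S.u (τ - h) x - φ x * (S.j τ x * F1))) * h
      = (ψ τ x * S.j τ x - ψ (τ - h) x * S.j (τ - h) x) * E.f (w (τ - h) x)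
        + ψ τ x * S.j τ x * (E.f1 (w τ x) * (w τ x - w (τ - h) x)) := by
    field_simp
    simp only [hφ, hw, Sys.j]
    ring
  rw [e1]
  linarith
end Sys

namespace Sys
variable (S : Sys)

theorem comp_slice {τ : ℝ} (hτ : τ ∈ Ioo S.T1 S.T2) {l r : ℝ} (hl : S.L < l) (hlr : l < r)
    (hr : r < S.R) {F0 F01 F02 : ℝ → ℝ} (hF : C2On F0 F01 F02 l r) (F1 e : ℝ)
    (hwl : e * (S.u τ l - (F0 l + τ * F1)) ≤ 0) (hwr : e * (S.u τ r - (F0 r + τ * F1)) ≤ 0)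
    (hsup : ∀ x ∈ Icc l r, e * (S.A * F02 x + S.b x * F01 x + (S.b1 - S.j1 x) * (F0 x + τ * F1)
      - S.j τ x * F1) ≤ 0) :
    (∫ x in l..r, ((0 * S.j τ x + 1 * S.j1 x) *
            etaK.f (e * (S.u τ x - (F0 x + τ * F1)))
          + e * (1 * etaK.f1 (e * (S.u τ x - (F0 x + τ * F1))) *
              (S.Rr τ x - S.j1 x * S.u τ x - S.j τ x * F1))))
      ≤ 10 * S.Cc / S.jm * ∫ x in l..r, 1 * S.j τ x * etaK.f (e * (S.u τ x - (F0 x + τ * F1))) := by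
  have hsub : Icc l r ⊆ Icc S.L S.R := Icc_subset_Icc hl.le hr.le
  set w : ℝ → ℝ := fun x => e * (S.u τ x - (F0 x + τ * F1)) with hw
  set w1 : ℝ → ℝ := fun x => e * (S.ux τ x - F01 x) with hw1
  set w2 : ℝ → ℝ := fun x => e * (S.uxx τ x - F02 x) with hw2
  have hwC : C2On w w1 w2 l r := by
    have h1 := ((S.c2 τ hτ).mono hl.le hr.le)
    exact ((h1.add ((hF.add (C2On.const (τ * F1) l r)).const_mul (-1))).const_mul e).congr
      (fun x => by simp only [hw]; ring) (fun x => by simp only [hw1]; ring)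
      (fun x => by simp only [hw2]; ring)
  have cb := S.cb.continuousOn (s := Icc l r)
  have cη : ContinuousOn (fun x => etaK.f (w x)) (Icc l r) := etaK.cf.comp_continuousOn hwC.cw
  have cη1 : ContinuousOn (fun x => etaK.f1 (w x)) (Icc l r) := etaK.cf1.comp_continuousOn hwC.cw
  have cη2 : ContinuousOn (fun x => etaK.f2 (w x)) (Icc l r) := etaK.cf2.comp_continuousOn hwC.cw
  have cj : ContinuousOn (S.j τ) (Icc l r) := (S.cj τ).continuousOn
  have cj1 : ContinuousOn S.j1 (Icc l r) := S.cj1.continuousOn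
  -- by parts
  have hc' : ContinuousOn (fun x => S.A * (etaK.f2 (w x) * w1 x * w1 x + etaK.f1 (w x) * w2 x)
      + (S.b1 * etaK.f (w x) + S.b x * (etaK.f1 (w x) * w1 x))) (Icc l r) :=
    (continuousOn_const.mul (((cη2.mul hwC.cw1).mul hwC.cw1).add (cη1.mul hwC.c))).add
      ((continuousOn_const.mul cη).add (cb.mul (cη1.mul hwC.cw1)))
  have key := intervalIntegral.integral_eq_sub_of_hasDerivAt
    (f := fun x => S.A * (etaK.f1 (w x) * w1 x) + S.b x * etaK.f (w x))
    (f' := fun x => S.A * (etaK.f2 (w x) * w1 x * w1 x + etaK.f1 (w x) * w2 x)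
      + (S.b1 * etaK.f (w x) + S.b x * (etaK.f1 (w x) * w1 x)))
    (a := l) (b := r) ?_ (ii_of_contOn hlr.le hc')
  swap
  · intro x hx
    rw [uIcc_of_le hlr.le] at hx
    have hb : HasDerivAt S.b S.b1 x := by
      unfold Sys.b
      simpa using ((hasDerivAt_id x).const_mul S.b1).const_add S.b0
    have a1 := ((etaK.d2 (w x)).comp x (hwC.d1 x hx)).mul (hwC.d2 x hx)
    have a2 := hb.mul ((etaK.d1 (w x)).comp x (hwC.d1 x hx))
    exact (a1.const_mul S.A).add a2
  simp only [show w l ≤ 0 from hwl, show w r ≤ 0 from hwr, etaK1_of_nonpos, etaK_of_nonpos] at key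
  simp only [zero_mul, mul_zero, add_zero, sub_zero] at key
  have hjm := S.hjm
  have hCc := S.hCc
  have cR : ContinuousOn (S.Rr τ) (Icc l r) := (S.cRr hτ).mono hsub
  have cu : ContinuousOn (S.u τ) (Icc l r) := (S.c2 τ hτ).cw.mono hsub
  rw [← intervalIntegral.integral_const_mul]
  have cL : ContinuousOn (fun x => ((0 * S.j τ x + 1 * S.j1 x) * etaK.f (w x)
          + e * (1 * etaK.f1 (w x) * (S.Rr τ x - S.j1 x * S.u τ x - S.j τ x * F1)))) (Icc l r) :=
    (((continuousOn_const.mul cj).add (continuousOn_const.mul cj1)).mul cη).add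
      (continuousOn_const.mul ((continuousOn_const.mul cη1).mul
        ((cR.sub (cj1.mul cu)).sub (cj.mul continuousOn_const))))
  have cRt : ContinuousOn (fun x => 10 * S.Cc / S.jm * (1 * S.j τ x * etaK.f (w x))) (Icc l r) :=
    continuousOn_const.mul ((continuousOn_const.mul cj).mul cη)
  have hmono := intervalIntegral.integral_mono_on (μ := volume) hlr.le (ii_of_contOn hlr.le cL)
    ((ii_of_contOn hlr.le cRt).add (ii_of_contOn hlr.le hc')) ?_
  · rw [intervalIntegral.integral_add (ii_of_contOn hlr.le cRt) (ii_of_contOn hlr.le hc'), key,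
      add_zero] at hmono
    exact hmono
  intro x hx
  have h1 := mul_le_mul_of_nonneg_left (hsup x hx) (etaK1_nonneg (w x))
  have h2 := mul_nonneg S.hA.le (mul_nonneg (etaK.f2_nonneg (w x)) (mul_self_nonneg (w1 x)))
  have hη := etaK_nonneg (w x)
  have h3 := etaK1_mul_le (w x)
  have hj1 := S.hj1 x (hsub hx)
  have hb1 := S.hb1
  have h4 : (S.b1 - S.j1 x) * (etaK.f1 (w x) * w x) ≤ 2 * S.Cc * (4 * etaK.f (w x)) := by
    refine (le_abs_self _).trans ?_
    rw [abs_mul]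
    refine mul_le_mul ((abs_sub _ _).trans (by linarith)) h3 (abs_nonneg _) (by positivity)
  have h5 : S.j1 x * etaK.f (w x) ≤ S.Cc * etaK.f (w x) :=
    mul_le_mul_of_nonneg_right ((le_abs_self _).trans hj1) hη
  have h6 : - S.b1 * etaK.f (w x) ≤ S.Cc * etaK.f (w x) :=
    mul_le_mul_of_nonneg_right ((neg_le_abs _).trans hb1) hη
  have h7 : 10 * S.Cc * etaK.f (w x) ≤ 10 * S.Cc / S.jm * (1 * S.j τ x * etaK.f (w x)) := by
    rw [div_mul_eq_mul_div, le_div_iff₀ hjm]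
    have := mul_le_mul_of_nonneg_right (S.jlb hτ (hsub hx)) hη
    nlinarith
  have e1 : e * (1 * etaK.f1 (w x) * (S.Rr τ x - S.j1 x * S.u τ x - S.j τ x * F1))
    = etaK.f1 (w x) * (S.A * w2 x + S.b x * w1 x) + (S.b1 - S.j1 x) * (etaK.f1 (w x) * w x)
      + etaK.f1 (w x) * (e * (S.A * F02 x + S.b x * F01 x + (S.b1 - S.j1 x) * (F0 x + τ * F1)
      - S.j τ x * F1)) := by
    simp only [hw, hw1, hw2, Sys.Rr]
    ring
  rw [e1]
  nlinarith

theorem Y_cont (E : KEta) {τ : ℝ} (hτ : S.Good τ) {l r : ℝ} (hl : S.L < l) (hlr : l < r)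
    (hr : r < S.R) {ψ : ℝ → ℝ → ℝ}
    (hψc : ∀ᶠ s in 𝓝 τ, ContinuousOn (ψ s) (Icc l r))
    (hψt : ∀ x ∈ Icc l r, ContinuousAt (fun s => ψ s x) τ)
    (hψL : ∃ C, ∀ᶠ s in 𝓝 τ, ∀ x ∈ Icc l r, |ψ s x| ≤ C)
    {F0 : ℝ → ℝ} (hF : ContinuousOn F0 (Icc l r)) (F1 e : ℝ) :
    ContinuousAt (fun s => ∫ x in l..r, ψ s x * S.j s x * E.f (e * (S.u s x - (F0 x + s * F1)))) τ := by
  have hsub : Icc l r ⊆ Icc S.L S.R := Icc_subset_Icc hl.le hr.le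
  have hTn : Ioo S.T1 S.T2 ∈ 𝓝 τ := Ioo_mem_nhds hτ.mem.1 hτ.mem.2
  apply bct hlr.le
  · filter_upwards [hTn, hψc] with s hs hs2
    exact (hs2.mul (S.cj s).continuousOn).mul (E.cf.comp_continuousOn
      (continuousOn_const.mul (((S.c2 s hs).cw.mono hsub).sub (hF.add continuousOn_const))))
  · obtain ⟨C, hC⟩ := hψL
    obtain ⟨M, hM0, hM⟩ := hτ.fbdd hl hlr.le hr hF F1 e E.cf
    refine ⟨|C| * S.Cc * M, ?_⟩
    filter_upwards [hC, hM, hTn] with s h1 h2 h3 x hx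
    rw [abs_mul, abs_mul, abs_of_pos (S.jpos h3 (hsub hx))]
    exact mul_le_mul (mul_le_mul ((h1 x hx).trans (le_abs_self _)) (S.jub h3 (hsub hx))
      (S.jpos h3 (hsub hx)).le (abs_nonneg _)) (h2 x hx) (abs_nonneg _)
      (mul_nonneg (abs_nonneg _) S.hCc.le)
  · intro x hx
    have hj : ContinuousAt (fun s => S.j s x) τ := by
      unfold Sys.j; fun_prop
    have hu := S.cont_t hτ.mem (hsub hx)
    refine Tendsto.mul (Tendsto.mul (hψt x hx) hj) ?_
    refine (E.cf.tendsto _).comp (Tendsto.const_mul _ (Tendsto.sub hu ?_))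
    exact Tendsto.add tendsto_const_nhds (tendsto_id.mul_const F1)

theorem comp {c d l r : ℝ} (hc : S.T1 ≤ c) (hd : d ≤ S.T2)
    (hG : ∀ t ∈ Ioo c d, S.Good t) (hl : S.L < l) (hlr : l < r) (hr : r < S.R)
    {F0 F01 F02 : ℝ → ℝ} (hF : C2On F0 F01 F02 l r) (F1 e : ℝ)
    (hwl : ∀ t ∈ Ioo c d, e * (S.u t l - (F0 l + t * F1)) ≤ 0)
    (hwr : ∀ t ∈ Ioo c d, e * (S.u t r - (F0 r + t * F1)) ≤ 0)
    (hsup : ∀ t ∈ Ioo c d, ∀ x ∈ Icc l r,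
      e * (S.A * F02 x + S.b x * F01 x + (S.b1 - S.j1 x) * (F0 x + t * F1) - S.j t x * F1) ≤ 0)
    (hinit : Tendsto (fun t => ∫ x in l..r, etaK.f (e * (S.u t x - (F0 x + t * F1))))
      (𝓝[>] c) (𝓝 0)) :
    ∀ t ∈ Ioo c d, ∀ x ∈ Icc l r, e * (S.u t x - (F0 x + t * F1)) ≤ 0 := by
  intro b hb
  have hsub : Icc l r ⊆ Icc S.L S.R := Icc_subset_Icc hl.le hr.le
  have hT : ∀ t ∈ Ioo c d, t ∈ Ioo S.T1 S.T2 := fun t ht => (hG t ht).mem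
  set Y : ℝ → ℝ := fun s => ∫ x in l..r, 1 * S.j s x * etaK.f (e * (S.u s x - (F0 x + s * F1))) with hY
  have cη : ∀ t ∈ Ioo c d, ContinuousOn (fun x => etaK.f (e * (S.u t x - (F0 x + t * F1)))) (Icc l r) :=
    fun t ht => etaK.cf.comp_continuousOn
      (continuousOn_const.mul (((S.c2 t (hT t ht)).cw.mono hsub).sub (hF.cw.add continuousOn_const)))
  have cY : ∀ t ∈ Ioo c d, ContinuousOn
      (fun x => 1 * S.j t x * etaK.f (e * (S.u t x - (F0 x + t * F1)))) (Icc l r) :=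
    fun t ht => (continuousOn_const.mul (S.cj t).continuousOn).mul (cη t ht)
  have nY : ∀ t ∈ Ioo c d, ∀ x ∈ Icc l r,
      0 ≤ 1 * S.j t x * etaK.f (e * (S.u t x - (F0 x + t * F1))) := fun t ht x hx =>
    mul_nonneg (by rw [one_mul]; exact (S.jpos (hT t ht) (hsub hx)).le) (etaK_nonneg _)
  have Y0 : ∀ t ∈ Ioo c d, 0 ≤ Y t := fun t ht =>
    intervalIntegral.integral_nonneg hlr.le (nY t ht)
  have Yle : ∀ t ∈ Ioo c d, Y t ≤ S.Cc * ∫ x in l..r, etaK.f (e * (S.u t x - (F0 x + t * F1))) := by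
    intro t ht
    rw [← intervalIntegral.integral_const_mul]
    refine intervalIntegral.integral_mono_on hlr.le (ii_of_contOn hlr.le (cY t ht))
      ((ii_of_contOn hlr.le (cη t ht)).const_mul _) fun x hx => ?_
    refine mul_le_mul_of_nonneg_right ?_ (etaK_nonneg _)
    rw [one_mul]; exact S.jub (hT t ht) (hsub hx)
  have hcd : c < d := hb.1.trans hb.2
  have Yinit : Tendsto Y (𝓝[>] c) (𝓝 0) := by
    have h2 := hinit.const_mul S.Cc
    rw [mul_zero] at h2
    refine tendsto_of_tendsto_of_tendsto_of_le_of_le' tendsto_const_nhds h2 ?_ ?_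
    · filter_upwards [Ioo_mem_nhdsGT hcd] with t ht using Y0 t ht
    · filter_upwards [Ioo_mem_nhdsGT hcd] with t ht using Yle t ht
  have Ycont : ∀ t ∈ Ioo c d, ContinuousAt Y t := fun t ht =>
    S.Y_cont etaK (hG t ht) hl hlr hr (ψ := fun _ _ => 1)
      (Eventually.of_forall fun s => continuousOn_const) (fun x _ => continuousAt_const)
      ⟨1, Eventually.of_forall fun s x _ => by simp⟩ hF.cw F1 e
  set Λ := 10 * S.Cc / S.jm with hΛ
  have hΛ0 : 0 < Λ := div_pos (by linarith [S.hCc]) S.hjm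
  have hΛT : Λ * (S.T2 - S.T1) ≤ 1 / 4 := by
    rw [hΛ, div_mul_eq_mul_div, div_le_iff₀ S.hjm]
    linarith [S.small]
  have hdini : ∀ a ∈ Ioo c d, ∀ t ∈ Ioo c d, a ≤ t → Y t - Y a ≤ ∫ s in a..t, Λ * Y s := by
    intro a ha t ht hat
    have hs : Icc a t ⊆ Ioo c d := fun s hs => ⟨ha.1.trans_le hs.1, hs.2.trans_lt ht.2⟩
    have hcY : ContinuousOn Y (Icc a t) := fun s hs' => (Ycont s (hs hs')).continuousWithinAt
    refine dini_left hat hcY (continuousOn_const.mul hcY).integrableOn_Icc ?_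
    intro s hs' ε hε
    have hsI := hs (Ioc_subset_Icc_self hs')
    have hk := S.kato_slope etaK (hG s hsI) hl hlr hr (ψ := fun _ _ => 1) (ψt := fun _ => 0)
      (C2On.const 1 l r) (fun _ _ => zero_le_one) (Eventually.of_forall fun s => continuousOn_const)
      (fun x _ => hasDerivAt_const s 1) ⟨0, Eventually.of_forall fun s x _ => by simp⟩
      hF F1 e (by rw [etaK1_of_nonpos (hwl s hsI), mul_zero])
      (by rw [etaK1_of_nonpos (hwr s hsI), mul_zero]) ε hε
    have hsl := S.comp_slice (hT s hsI) hl hlr hr hF F1 e (hwl s hsI) (hwr s hsI) (hsup s hsI)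
    filter_upwards [hk, self_mem_nhdsWithin] with h hh hpos
    have hpos : 0 < h := hpos
    refine hh.trans (mul_le_mul_of_nonneg_right ?_ hpos.le)
    linarith
  -- maximum argument
  have hYb : Y b ≤ 0 := by
    by_contra hpos
    push Not at hpos
    set Z : ℝ → ℝ := fun t => if t ≤ c then 0 else Y t with hZ
    have hZeq : ∀ t, c < t → Z t = Y t := fun t ht => by simp only [hZ, not_le.2 ht, if_false]
    have hZc : ContinuousOn Z (Icc c b) := by
      intro t ht
      rcases ht.1.eq_or_lt with rfl | hct
      · have : Tendsto Z (𝓝[>] c) (𝓝 (Z c)) := by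
          have e0 : Z c = 0 := by simp [hZ]
          rw [e0]
          refine Yinit.congr' ?_
          filter_upwards [self_mem_nhdsWithin] with t ht using (hZeq t ht).symm
        have h3 : ContinuousWithinAt Z (Ioi c) c := this
        exact (continuousWithinAt_Ioi_iff_Ici.1 h3).mono Icc_subset_Ici_self
      · refine ((Ycont t ⟨hct, ht.2.trans_lt hb.2⟩).congr ?_).continuousWithinAt
        filter_upwards [Ioi_mem_nhds hct] with s hs using (hZeq s hs).symm
    obtain ⟨m, hm, hmax⟩ := isCompact_Icc.exists_isMaxOn (nonempty_Icc.2 hb.1.le) hZc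
    have hM : Y b ≤ Z m := by
      have := hmax (right_mem_Icc.2 hb.1.le)
      rw [← hZeq b hb.1]; exact this
    have hcm : c < m := by
      by_contra hle
      have : Z m = 0 := by simp only [hZ, not_lt.1 hle, if_true]
      linarith
    have hmI : m ∈ Ioo c d := ⟨hcm, hm.2.trans_lt hb.2⟩
    have hle : ∀ a ∈ Ioo c m, Y m ≤ Y a + Y m / 4 := by
      intro a ha
      have haI : a ∈ Ioo c d := ⟨ha.1, ha.2.trans hmI.2⟩
      have h1 := hdini a haI m hmI ha.2.le
      have hcY : ContinuousOn Y (Icc a m) := fun s hs' =>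
        (Ycont s ⟨ha.1.trans_le hs'.1, hs'.2.trans_lt hmI.2⟩).continuousWithinAt
      have h2 : ∫ s in a..m, Λ * Y s ≤ ∫ s in a..m, Λ * Y m := by
        refine intervalIntegral.integral_mono_on ha.2.le
          (ii_of_contOn ha.2.le (continuousOn_const.mul hcY)) intervalIntegrable_const fun s hs => ?_
        refine mul_le_mul_of_nonneg_left ?_ hΛ0.le
        have hcs : c < s := ha.1.trans_le hs.1
        have := hmax (show s ∈ Icc c b from ⟨hcs.le, hs.2.trans hm.2⟩)
        rw [← hZeq s hcs, ← hZeq m hcm]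
        exact this
      rw [intervalIntegral.integral_const, smul_eq_mul] at h2
      have h3 : (m - a) * (Λ * Y m) ≤ Y m / 4 := by
        have hYm := Y0 m hmI
        have : Λ * (m - a) ≤ 1 / 4 := by
          refine le_trans (mul_le_mul_of_nonneg_left ?_ hΛ0.le) hΛT
          linarith [ha.1, hmI.2]
        nlinarith
      linarith
    have hlim : Y m ≤ 0 + Y m / 4 := by
      refine ge_of_tendsto (Yinit.add_const (Y m / 4)) ?_
      filter_upwards [Ioo_mem_nhdsGT hcm] with a ha using hle a ha
    have := hZeq m hcm
    linarith
  intro x hx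
  by_contra hpos
  push Not at hpos
  have : 0 < Y b := intervalIntegral.integral_pos hlr (cY b hb)
    (fun y hy => nY b hb y (Ioc_subset_Icc_self hy)) ⟨x, hx, mul_pos
      (by rw [one_mul]; exact S.jpos (hT b hb) (hsub hx)) (etaK_pos hpos)⟩
  linarith
end Sys

/-- the kinked test function -/
def kphi (x ρ y : ℝ) : ℝ := ((ρ - |y - x|) / ρ) ^ 2

theorem kphi_cont (x ρ : ℝ) : Continuous (kphi x ρ) := by unfold kphi; fun_prop
theorem kphi_nonneg (x ρ y : ℝ) : 0 ≤ kphi x ρ y := sq_nonneg _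
theorem kphi_le {x ρ y : ℝ} (hρ : 0 < ρ) (hy : |y - x| ≤ ρ) : kphi x ρ y ≤ 1 := by
  unfold kphi
  have h0 : 0 ≤ (ρ - |y - x|) / ρ := div_nonneg (by linarith) hρ.le
  have h1 : (ρ - |y - x|) / ρ ≤ 1 := by
    rw [div_le_one hρ]; linarith [abs_nonneg (y - x)]
  nlinarith
theorem kphi_ge {x ρ y : ℝ} (hρ : 0 < ρ) (hy : |y - x| ≤ ρ / 2) : 1 / 4 ≤ kphi x ρ y := by
  unfold kphi
  have h1 : 1 / 2 ≤ (ρ - |y - x|) / ρ := by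
    rw [le_div_iff₀ hρ]; linarith
  nlinarith

namespace Sys
variable (S : Sys)

def kk1 (x ρ y : ℝ) : ℝ := S.A * (2 / ρ^2) - S.b y * (2 * (ρ + (y - x)) / ρ^2)
def kk2 (x ρ y : ℝ) : ℝ := S.A * (2 / ρ^2) - S.b y * (-(2 * (ρ - (y - x)) / ρ^2))

theorem ckk1 (x ρ : ℝ) : Continuous (S.kk1 x ρ) := by
  have := S.cb
  unfold kk1; fun_prop
theorem ckk2 (x ρ : ℝ) : Continuous (S.kk2 x ρ) := by
  have := S.cb
  unfold kk2; fun_prop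

theorem kink {x ρ : ℝ} (hρ : 0 < ρ) {w w1 w2 : ℝ → ℝ} (hw : C2On w w1 w2 (x - ρ) (x + ρ)) :
    ∫ y in (x - ρ)..(x + ρ), kphi x ρ y * S.Lop w w1 w2 y =
      (∫ y in (x - ρ)..x, S.kk1 x ρ y * w y) + (∫ y in x..(x + ρ), S.kk2 x ρ y * w y)
        - 4 * S.A / ρ * w x := by
  have hw1 : C2On w w1 w2 (x - ρ) x := hw.mono le_rfl (by linarith)
  have hw2 : C2On w w1 w2 x (x + ρ) := hw.mono (by linarith) le_rfl
  have p1 : C2On (fun y => ((ρ + (y - x)) / ρ)^2) (fun y => 2 * (ρ + (y - x)) / ρ^2)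
      (fun _ => 2 / ρ^2) (x - ρ) x := by
    refine ⟨fun y _ => ?_, fun y _ => ?_, continuousOn_const⟩
    · have := ((((hasDerivAt_id y).sub_const x).const_add ρ).div_const ρ).pow 2
      refine this.congr_deriv ?_
      simp
      field_simp
    · have := ((((hasDerivAt_id y).sub_const x).const_add ρ).const_mul 2).div_const (ρ^2)
      refine this.congr_deriv ?_
      simp
  have p2 : C2On (fun y => ((ρ - (y - x)) / ρ)^2) (fun y => -(2 * (ρ - (y - x)) / ρ^2))
      (fun _ => 2 / ρ^2) x (x + ρ) := by
    refine ⟨fun y _ => ?_, fun y _ => ?_, continuousOn_const⟩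
    · have := ((((hasDerivAt_id y).sub_const x).const_sub ρ).div_const ρ).pow 2
      refine this.congr_deriv ?_
      simp
      field_simp
    · have := (((((hasDerivAt_id y).sub_const x).const_sub ρ).const_mul 2).div_const (ρ^2)).neg
      refine this.congr_deriv ?_
      simp
      ring
  have b1 := S.byparts (by linarith) p1 hw1
  have b2 := S.byparts (by linarith) p2 hw2
  have cL : ContinuousOn (fun y => kphi x ρ y * S.Lop w w1 w2 y) (Icc (x - ρ) (x + ρ)) :=
    (kphi_cont x ρ).continuousOn.mul (((continuousOn_const.mul hw.c).add
      (S.cb.continuousOn.mul hw.cw1)).add (continuousOn_const.mul hw.cw))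
  have hs := intervalIntegral.integral_add_adjacent_intervals (μ := volume)
    (ii_of_contOn (l := x - ρ) (r := x) (by linarith) (cL.mono (Icc_subset_Icc le_rfl (by linarith))))
    (ii_of_contOn (l := x) (r := x + ρ) (by linarith) (cL.mono (Icc_subset_Icc (by linarith) le_rfl)))
  rw [← hs]
  have e1 : ∫ y in (x - ρ)..x, kphi x ρ y * S.Lop w w1 w2 y =
      ∫ y in (x - ρ)..x, ((ρ + (y - x)) / ρ)^2 * S.Lop w w1 w2 y := by
    refine intervalIntegral.integral_congr fun y hy => ?_
    rw [uIcc_of_le (by linarith)] at hy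
    simp only [kphi, abs_of_nonpos (show y - x ≤ 0 by linarith [hy.2])]
    ring
  have e2 : ∫ y in x..(x + ρ), kphi x ρ y * S.Lop w w1 w2 y =
      ∫ y in x..(x + ρ), ((ρ - (y - x)) / ρ)^2 * S.Lop w w1 w2 y := by
    refine intervalIntegral.integral_congr fun y hy => ?_
    rw [uIcc_of_le (by linarith)] at hy
    simp only [kphi, abs_of_nonneg (show 0 ≤ y - x by linarith [hy.1])]
  rw [e1, e2, b1, b2]
  simp only [kk1, kk2]
  have hρ' : ρ ≠ 0 := hρ.ne'
  field_simp
  ring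

theorem kink_test {x ρ : ℝ} (hρ : 0 < ρ) : S.Test (kphi x ρ) (x - ρ) (x + ρ) := by
  refine ⟨(kphi_cont x ρ).continuousOn, fun y => if y ≤ x then S.kk1 x ρ y else S.kk2 x ρ y, x,
    0, - (4 * S.A / ρ), 0, ?_, ⟨by linarith, by linarith⟩, ?_⟩
  · refine IntervalIntegrable.trans (b := x) ?_ ?_
    · refine ((S.ckk1 x ρ).intervalIntegrable (x - ρ) x).congr ?_
      intro y hy
      rw [uIoc_of_le (by linarith)] at hy
      simp only [hy.2, if_true]
    · refine ((S.ckk2 x ρ).intervalIntegrable x (x + ρ)).congr ?_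
      intro y hy
      rw [uIoc_of_le (by linarith)] at hy
      simp only [not_le.2 hy.1, if_false]
  · intro w w1 w2 hw
    rw [S.kink hρ hw]
    have e1 : ∫ y in (x - ρ)..x, (if y ≤ x then S.kk1 x ρ y else S.kk2 x ρ y) * w y
        = ∫ y in (x - ρ)..x, S.kk1 x ρ y * w y := by
      refine intervalIntegral.integral_congr fun y hy => ?_
      rw [uIcc_of_le (by linarith)] at hy
      simp only [hy.2, if_true]
    have e2 : ∫ y in x..(x + ρ), (if y ≤ x then S.kk1 x ρ y else S.kk2 x ρ y) * w y
        = ∫ y in x..(x + ρ), S.kk2 x ρ y * w y := by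
      refine intervalIntegral.integral_congr_ae (ae_of_all _ fun y hy => ?_)
      rw [uIoc_of_le (by linarith)] at hy
      simp only [not_le.2 hy.1, if_false]
    have k1 : IntervalIntegrable (fun y => (if y ≤ x then S.kk1 x ρ y else S.kk2 x ρ y) * w y)
        volume (x - ρ) x := by
      refine ((ii_of_contOn (by linarith) ((S.ckk1 x ρ).continuousOn.mul
        (hw.cw.mono (Icc_subset_Icc le_rfl (by linarith))))) :
        IntervalIntegrable (fun y => S.kk1 x ρ y * w y) volume (x - ρ) x).congr ?_
      intro y hy
      rw [uIoc_of_le (by linarith)] at hy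
      simp only [hy.2, if_true]
    have k2 : IntervalIntegrable (fun y => (if y ≤ x then S.kk1 x ρ y else S.kk2 x ρ y) * w y)
        volume x (x + ρ) := by
      refine ((ii_of_contOn (by linarith) ((S.ckk2 x ρ).continuousOn.mul
        (hw.cw.mono (Icc_subset_Icc (by linarith) le_rfl)))) :
        IntervalIntegrable (fun y => S.kk2 x ρ y * w y) volume x (x + ρ)).congr ?_
      intro y hy
      rw [uIoc_of_le (by linarith)] at hy
      simp only [not_le.2 hy.1, if_false]
    have hadd := intervalIntegral.integral_add_adjacent_intervals k1 k2
    rw [e1, e2] at hadd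
    rw [hadd]
    ring

theorem kink_lower {x ρ : ℝ} (hρ : 0 < ρ) (hρA : 2 * S.Cc * ρ ≤ S.A) (hxl : S.L ≤ x - ρ)
    (hxr : x + ρ ≤ S.R) {w w1 w2 : ℝ → ℝ} (hw : C2On w w1 w2 (x - ρ) (x + ρ))
    (hw0 : ∀ y ∈ Icc (x - ρ) (x + ρ), 0 ≤ w y) :
    S.A / ρ^2 * (∫ y in (x - ρ)..(x + ρ), w y) - 4 * S.A / ρ * w x ≤
      ∫ y in (x - ρ)..(x + ρ), kphi x ρ y * S.Lop w w1 w2 y := by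
  have hk : ∀ β z : ℝ, |β| ≤ S.Cc → |z| ≤ ρ → S.A / ρ^2 ≤ S.A * (2 / ρ^2) - β * (2 * z / ρ^2) := by
    intro β z hβ hz
    have h1 : β * z ≤ S.Cc * ρ := (le_abs_self _).trans (by
      rw [abs_mul]; exact mul_le_mul hβ hz (abs_nonneg _) S.hCc.le)
    rw [show S.A * (2 / ρ^2) - β * (2 * z / ρ^2) = (2 * S.A - 2 * (β * z)) / ρ^2 by ring]
    refine div_le_div_of_nonneg_right ?_ (by positivity)
    linarith
  rw [S.kink hρ hw]
  have c1 : ContinuousOn w (Icc (x - ρ) x) := hw.cw.mono (Icc_subset_Icc le_rfl (by linarith))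
  have c2 : ContinuousOn w (Icc x (x + ρ)) := hw.cw.mono (Icc_subset_Icc (by linarith) le_rfl)
  have i1 : S.A / ρ^2 * (∫ y in (x - ρ)..x, w y) ≤ ∫ y in (x - ρ)..x, S.kk1 x ρ y * w y := by
    rw [← intervalIntegral.integral_const_mul]
    refine intervalIntegral.integral_mono_on (by linarith)
      ((ii_of_contOn (by linarith) c1).const_mul _)
      (ii_of_contOn (by linarith) ((S.ckk1 x ρ).continuousOn.mul c1)) fun y hy => ?_
    refine mul_le_mul_of_nonneg_right ?_ (hw0 y ⟨hy.1, by linarith [hy.2]⟩)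
    exact hk _ _ (S.bbd ⟨hxl.trans hy.1, by linarith [hy.2]⟩)
      (abs_le.2 ⟨by linarith [hy.1], by linarith [hy.2]⟩)
  have i2 : S.A / ρ^2 * (∫ y in x..(x + ρ), w y) ≤ ∫ y in x..(x + ρ), S.kk2 x ρ y * w y := by
    rw [← intervalIntegral.integral_const_mul]
    refine intervalIntegral.integral_mono_on (by linarith)
      ((ii_of_contOn (by linarith) c2).const_mul _)
      (ii_of_contOn (by linarith) ((S.ckk2 x ρ).continuousOn.mul c2)) fun y hy => ?_
    refine mul_le_mul_of_nonneg_right ?_ (hw0 y ⟨by linarith [hy.1], hy.2⟩)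
    have := hk (S.b y) (-(ρ - (y - x))) (S.bbd ⟨by linarith [hy.1], by linarith [hy.2]⟩)
      (abs_le.2 ⟨by linarith [hy.1], by linarith [hy.2]⟩)
    unfold kk2
    rw [show -(2 * (ρ - (y - x)) / ρ^2) = 2 * (-(ρ - (y - x))) / ρ^2 by ring]
    exact this
  rw [← intervalIntegral.integral_add_adjacent_intervals (a := x - ρ) (b := x)
    (ii_of_contOn (by linarith) c1) (ii_of_contOn (by linarith) c2), mul_add]
  linarith
end Sys

theorem int5 {g1 g2 g3 g4 g5 : ℝ → ℝ} {l r : ℝ} (hlr : l ≤ r)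
    (h1 : ContinuousOn g1 (Icc l r)) (h2 : ContinuousOn g2 (Icc l r))
    (h3 : ContinuousOn g3 (Icc l r)) (h4 : ContinuousOn g4 (Icc l r))
    (h5 : ContinuousOn g5 (Icc l r)) (c1 c2 c3 c4 c5 : ℝ) :
    ∫ x in l..r, (c1 * g1 x + c2 * g2 x + c3 * g3 x + c4 * g4 x + c5 * g5 x) =
      c1 * (∫ x in l..r, g1 x) + c2 * (∫ x in l..r, g2 x) + c3 * (∫ x in l..r, g3 x)
       + c4 * (∫ x in l..r, g4 x) + c5 * (∫ x in l..r, g5 x) := by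
  have i1 := (ii_of_contOn hlr h1).const_mul c1
  have i2 := (ii_of_contOn hlr h2).const_mul c2
  have i3 := (ii_of_contOn hlr h3).const_mul c3
  have i4 := (ii_of_contOn hlr h4).const_mul c4
  have i5 := (ii_of_contOn hlr h5).const_mul c5
  rw [intervalIntegral.integral_add (((i1.add i2).add i3).add i4) i5,
    intervalIntegral.integral_add ((i1.add i2).add i3) i4,
    intervalIntegral.integral_add (i1.add i2) i3,
    intervalIntegral.integral_add i1 i2]
  simp only [intervalIntegral.integral_const_mul]

namespace Sys
variable (S : Sys)

theorem X_deriv {t : ℝ} (ht : S.Good t) {l r : ℝ} (hl : S.L < l) (hlr : l < r) (hr : r < S.R)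
    {φ : ℝ → ℝ} (hφ : S.Test φ l r) {f : ℝ → ℝ} (hf : ContinuousOn f (Icc l r)) (K0 c : ℝ) :
    HasDerivAt (fun s => ∫ x in l..r, φ x * (S.j s x * (S.u s x - f x + K0 * (s - c))))
      (∫ x in l..r, φ x * (S.Rr t x - S.j1 x * (f x - K0 * (t - c)) + K0 * S.j t x)) t := by
  have hsub : Icc l r ⊆ Icc S.L S.R := Icc_subset_Icc hl.le hr.le
  have cφ := hφ.1
  have c0 : ContinuousOn S.j0 (Icc l r) := S.cj0.continuousOn
  have c1 : ContinuousOn S.j1 (Icc l r) := S.cj1.continuousOn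
  have e1 : ∀ s ∈ Ioo S.T1 S.T2, ∫ x in l..r, φ x * (S.j s x * (S.u s x - f x + K0 * (s - c))) =
      1 * (∫ x in l..r, φ x * (S.j s x * S.u s x)) + (-1) * (∫ x in l..r, φ x * S.j0 x * f x)
      + (-s) * (∫ x in l..r, φ x * S.j1 x * f x) + (K0 * (s - c)) * (∫ x in l..r, φ x * S.j0 x)
      + (K0 * (s - c) * s) * (∫ x in l..r, φ x * S.j1 x) := by
    intro s hs
    refine Eq.trans ?_ (int5 hlr.le (cφ.mul ((S.cj s).continuousOn.mul ((S.c2 s hs).cw.mono hsub)))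
      ((cφ.mul c0).mul hf) ((cφ.mul c1).mul hf) (cφ.mul c0) (cφ.mul c1) _ _ _ _ _)
    refine intervalIntegral.integral_congr fun x _ => ?_
    simp only [Sys.j, Pi.mul_apply]
    ring
  have e2 : ∫ x in l..r, φ x * (S.Rr t x - S.j1 x * (f x - K0 * (t - c)) + K0 * S.j t x) =
      1 * (∫ x in l..r, φ x * S.Rr t x) + 0 * (∫ x in l..r, φ x * S.j0 x * f x)
      + (-1) * (∫ x in l..r, φ x * S.j1 x * f x) + K0 * (∫ x in l..r, φ x * S.j0 x)
      + (K0 * (t - c) + K0 * t) * (∫ x in l..r, φ x * S.j1 x) := by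
    refine Eq.trans ?_ (int5 hlr.le (cφ.mul ((S.cRr ht.mem).mono hsub))
      ((cφ.mul c0).mul hf) ((cφ.mul c1).mul hf) (cφ.mul c0) (cφ.mul c1) _ _ _ _ _)
    refine intervalIntegral.integral_congr fun x _ => ?_
    simp only [Sys.j, Pi.mul_apply]
    ring
  rw [e2]
  have hN := ht.deriv hl hlr hr hφ
  set P0 := ∫ x in l..r, φ x * S.j0 x * f x
  set P1 := ∫ x in l..r, φ x * S.j1 x * f x
  set Q0 := ∫ x in l..r, φ x * S.j0 x
  set Q1 := ∫ x in l..r, φ x * S.j1 x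
  have hK : HasDerivAt (fun s : ℝ => K0 * (s - c)) K0 t := by
    simpa using ((hasDerivAt_id t).sub_const c).const_mul K0
  have hD := ((((hN.const_mul 1).add (hasDerivAt_const t ((-1) * P0))).add
    ((hasDerivAt_id t).neg.mul_const P1)).add (hK.mul_const Q0)).add
    ((hK.mul (hasDerivAt_id t)).mul_const Q1)
  refine (hD.congr_deriv ?_).congr_of_eventuallyEq ?_
  · simp only [id]; ring
  · filter_upwards [Ioo_mem_nhds ht.mem.1 ht.mem.2] with s hs
    rw [e1 s hs]
    simp only [id, Pi.add_apply, Pi.neg_apply, Pi.mul_apply]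

set_option maxHeartbeats 1000000 in
theorem trace_local {c d l r K0 : ℝ} (hc : S.T1 ≤ c) (hcd : c < d)
    (hG : ∀ t ∈ Ioo c d, S.Good t) (hl : S.L < l) (hr : r < S.R)
    {f f1 f2 : ℝ → ℝ} (hf : C2On f f1 f2 l r)
    (hw0 : ∀ t ∈ Ioo c d, ∀ y ∈ Icc l r, 0 ≤ S.u t y - f y + K0 * (t - c))
    (hsup : ∀ t ∈ Ioo c d, ∀ y ∈ Icc l r,
      0 ≤ S.A * f2 y + S.b y * f1 y + (S.b1 - S.j1 y) * (f y - K0 * (t - c)) + S.j t y * K0)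
    {x : ℝ} (hx : x ∈ Ioo l r)
    (hlim : Tendsto (fun t => S.u t x) (𝓝[>] c) (𝓝 (f x))) {ε : ℝ} (hε : 0 < ε) :
    ∃ ρ0 > 0, ∃ s0 > c, s0 < d ∧ ∀ ρ, 0 < ρ → ρ ≤ ρ0 → l ≤ x - ρ ∧ x + ρ ≤ r ∧ ∀ s ∈ Ioo c s0,
      ∫ y in (x - ρ / 2)..(x + ρ / 2), (S.u s y - f y + K0 * (s - c)) ≤ 24 * S.Cc / S.jm * ε * ρ := by
  have hsub : Icc l r ⊆ Icc S.L S.R := Icc_subset_Icc hl.le hr.le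
  have hT : ∀ t ∈ Ioo c d, t ∈ Ioo S.T1 S.T2 := fun t ht => (hG t ht).mem
  have hA := S.hA
  have hC := S.hCc
  have hjm := S.hjm
  -- choose τ
  have hlim2 : Tendsto (fun t => S.u t x - f x + K0 * (t - c)) (𝓝[>] c) (𝓝 0) := by
    have h1 : Tendsto (fun t : ℝ => K0 * (t - c)) (𝓝[>] c) (𝓝 (K0 * (c - c))) :=
      ((by fun_prop : Continuous fun t : ℝ => K0 * (t - c)).tendsto c).mono_left nhdsWithin_le_nhds
    have h2 := (hlim.sub_const (f x)).add h1
    simpa using h2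
  have hev : ∀ᶠ t in 𝓝[>] c, S.u t x - f x + K0 * (t - c) < ε := hlim2.eventually (gt_mem_nhds hε)
  obtain ⟨τ1, hτ1, hτ1'⟩ := (mem_nhdsGT_iff_exists_Ioo_subset).1 hev
  have hτ1c : c < τ1 := hτ1
  set τ := (c + min τ1 d) / 2 with hτdef
  have hmc : c < min τ1 d := lt_min hτ1c hcd
  have hτc : c < τ := by rw [hτdef]; linarith
  have hτm : τ < min τ1 d := by rw [hτdef]; linarith
  have hτd : τ < d := hτm.trans_le (min_le_right _ _)
  have hwε : ∀ t, c < t → t ≤ τ → S.u t x - f x + K0 * (t - c) ≤ ε := fun t h1 h2 =>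
    le_of_lt (hτ1' ⟨h1, h2.trans_lt (hτm.trans_le (min_le_left _ _))⟩)
  have cw : ∀ t ∈ Ioo c d, ContinuousOn (fun y => S.u t y - f y + K0 * (t - c)) (Icc l r) :=
    fun t ht => (((S.c2 t (hT t ht)).cw.mono hsub).sub hf.cw).add continuousOn_const
  obtain ⟨B, hB0, hB⟩ := contOn_bdd (cw τ ⟨hτc, hτd⟩)
  set Δ := τ - c with hΔ
  have hΔ0 : 0 < Δ := sub_pos.2 hτc
  set lam := S.A / S.Cc with hlam
  have hlam0 : 0 < lam := div_pos hA hC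
  set ρ0 := min (min (x - l) (r - x)) (min (S.A / (2 * S.Cc)) (min 1 (ε * lam * Δ / (2 * (B + 1))))) with hρ0
  have hρ0p : 0 < ρ0 := by
    refine lt_min (lt_min (sub_pos.2 hx.1) (sub_pos.2 hx.2)) (lt_min (by positivity) (lt_min one_pos (by positivity)))
  refine ⟨ρ0, hρ0p, (c + τ) / 2, by linarith, by linarith, fun ρ hρ hρle => ?_⟩
  have r1 : ρ ≤ x - l := hρle.trans ((min_le_left _ _).trans (min_le_left _ _))
  have r2 : ρ ≤ r - x := hρle.trans ((min_le_left _ _).trans (min_le_right _ _))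
  have r3 : ρ ≤ S.A / (2 * S.Cc) := hρle.trans ((min_le_right _ _).trans (min_le_left _ _))
  have r4 : ρ ≤ 1 := hρle.trans ((min_le_right _ _).trans ((min_le_right _ _).trans (min_le_left _ _)))
  have r5 : ρ ≤ ε * lam * Δ / (2 * (B + 1)) :=
    hρle.trans ((min_le_right _ _).trans ((min_le_right _ _).trans (min_le_right _ _)))
  refine ⟨by linarith, by linarith, fun s hs => ?_⟩
  have hsI : Icc (x - ρ) (x + ρ) ⊆ Icc l r := Icc_subset_Icc (by linarith) (by linarith)
  have hsI2 : Icc (x - ρ / 2) (x + ρ / 2) ⊆ Icc (x - ρ) (x + ρ) := Icc_subset_Icc (by linarith) (by linarith)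
  have hρA : 2 * S.Cc * ρ ≤ S.A := by
    rw [le_div_iff₀ (by positivity)] at r3; linarith
  set X : ℝ → ℝ := fun s => ∫ y in (x - ρ)..(x + ρ), kphi x ρ y * (S.j s y * (S.u s y - f y + K0 * (s - c))) with hX
  set X' : ℝ → ℝ := fun t => ∫ y in (x - ρ)..(x + ρ), kphi x ρ y * (S.Rr t y - S.j1 y * (f y - K0 * (t - c)) + K0 * S.j t y) with hX'
  have hXd : ∀ t ∈ Ioo c d, HasDerivAt X (X' t) t := fun t ht =>
    S.X_deriv (hG t ht) (by linarith) (by linarith) (by linarith) (S.kink_test hρ)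
      (hf.cw.mono hsI) K0 c
  have hle : x - ρ ≤ x + ρ := by linarith
  have kab : ∀ y ∈ Icc (x - ρ) (x + ρ), |y - x| ≤ ρ := fun y hy =>
    abs_le.2 ⟨by linarith [hy.1], by linarith [hy.2]⟩
  have cX : ∀ t ∈ Ioo c d, ContinuousOn (fun y => kphi x ρ y * (S.j t y * (S.u t y - f y + K0 * (t - c)))) (Icc (x - ρ) (x + ρ)) :=
    fun t ht => (kphi_cont x ρ).continuousOn.mul ((S.cj t).continuousOn.mul ((cw t ht).mono hsI))
  have Xub : ∀ t ∈ Ioo c d, X t ≤ S.Cc * ∫ y in (x - ρ)..(x + ρ), (S.u t y - f y + K0 * (t - c)) := by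
    intro t ht
    rw [← intervalIntegral.integral_const_mul]
    refine intervalIntegral.integral_mono_on hle (ii_of_contOn hle (cX t ht))
      ((ii_of_contOn hle ((cw t ht).mono hsI)).const_mul _) fun y hy => ?_
    have h1 := kphi_le hρ (kab y hy)
    have h2 := kphi_nonneg x ρ y
    have h3 := hw0 t ht y (hsI hy)
    have h4 := S.jub (hT t ht) (hsub (hsI hy))
    have h5 := S.jpos (hT t ht) (hsub (hsI hy))
    calc _ ≤ 1 * (S.j t y * (S.u t y - f y + K0 * (t - c))) :=
          mul_le_mul_of_nonneg_right h1 (mul_nonneg h5.le h3)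
      _ ≤ _ := by rw [one_mul]; exact mul_le_mul_of_nonneg_right h4 h3
  set θ := 4 * S.Cc * ε * ρ with hθ
  have hdiff : ∀ t, c < t → t ≤ τ → lam / ρ^2 * (X t - θ) ≤ X' t := by
    intro t h1 h2
    have ht : t ∈ Ioo c d := ⟨h1, h2.trans_lt hτd⟩
    have hc2 : C2On (fun y => S.u t y - f y + K0 * (t - c)) (fun y => S.ux t y - f1 y)
        (fun y => S.uxx t y - f2 y) (x - ρ) (x + ρ) := by
      have := ((((S.c2 t (hT t ht)).mono (l' := x - ρ) (r' := x + ρ) (by linarith) (by linarith)).add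
        ((hf.mono (l' := x - ρ) (r' := x + ρ) (by linarith) (by linarith)).const_mul (-1))).add
        (C2On.const (K0 * (t - c)) (x - ρ) (x + ρ)))
      exact this.congr (fun y => by ring) (fun y => by ring) (fun y => by ring)
    have hk := S.kink_lower hρ hρA (by linarith) (by linarith) hc2 (fun y hy => hw0 t ht y (hsI hy))
    have hk2 : ∫ y in (x - ρ)..(x + ρ), kphi x ρ y * S.Lop (fun y => S.u t y - f y + K0 * (t - c)) (fun y => S.ux t y - f1 y)
        (fun y => S.uxx t y - f2 y) y ≤ X' t := by
      refine intervalIntegral.integral_mono_on hle (ii_of_contOn hle ?_) (ii_of_contOn hle ?_) fun y hy => ?_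
      · exact (kphi_cont x ρ).continuousOn.mul (((continuousOn_const.mul hc2.c).add
          (S.cb.continuousOn.mul hc2.cw1)).add (continuousOn_const.mul hc2.cw))
      · exact (kphi_cont x ρ).continuousOn.mul
          ((((S.cRr (hT t ht)).mono (hsI.trans hsub)).sub
            (S.cj1.continuousOn.mul ((hf.cw.mono hsI).sub continuousOn_const))).add
            (continuousOn_const.mul (S.cj t).continuousOn))
      · refine mul_le_mul_of_nonneg_left ?_ (kphi_nonneg _ _ _)
        have := hsup t ht y (hsI hy)
        simp only [Lop, Rr]
        nlinarith
    have h3 := hwε t h1 h2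
    have h4 := Xub t ht
    have h5 : S.A / ρ^2 * (X t / S.Cc) ≤ S.A / ρ^2 * ∫ y in (x - ρ)..(x + ρ), (S.u t y - f y + K0 * (t - c)) := by
      refine mul_le_mul_of_nonneg_left ?_ (by positivity)
      rw [div_le_iff₀ hC]; linarith
    have h6 : 4 * S.A / ρ * (S.u t x - f x + K0 * (t - c)) ≤ 4 * S.A / ρ * ε :=
      mul_le_mul_of_nonneg_left h3 (by positivity)
    have h7 : lam / ρ^2 * (X t - θ) = S.A / ρ^2 * (X t / S.Cc) - 4 * S.A / ρ * ε := by
      rw [hlam, hθ]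
      field_simp
    rw [h7]
    linarith
  -- monotonicity
  have hsd : s ∈ Ioo c d := ⟨hs.1, by linarith [hs.2]⟩
  have hsτ : s ≤ τ := by linarith [hs.2]
  have hmono : (X s - θ) * exp (-(lam / ρ^2) * s) ≤ (X τ - θ) * exp (-(lam / ρ^2) * τ) := by
    have hder : ∀ t ∈ Icc s τ, HasDerivAt (fun t => (X t - θ) * exp (-(lam / ρ^2) * t))
        ((X' t - lam / ρ^2 * (X t - θ)) * exp (-(lam / ρ^2) * t)) t := by
      intro t ht
      have h1 := (hXd t ⟨hs.1.trans_le ht.1, ht.2.trans_lt hτd⟩).sub_const θ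
      have h2 := ((hasDerivAt_id t).const_mul (-(lam / ρ^2))).exp
      refine (h1.mul h2).congr_deriv ?_
      simp only [id, mul_one]
      ring
    have : MonotoneOn (fun t => (X t - θ) * exp (-(lam / ρ^2) * t)) (Icc s τ) := by
      refine monotoneOn_of_deriv_nonneg (convex_Icc _ _) (fun t ht => (hder t ht).continuousAt.continuousWithinAt)
        (fun t ht => (hder t (interior_subset ht)).differentiableAt.differentiableWithinAt) ?_
      intro t ht
      have ht' := interior_subset ht
      rw [(hder t ht').deriv]
      refine mul_nonneg ?_ (exp_pos _).le
      linarith [hdiff t (hs.1.trans_le ht'.1) ht'.2]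
    exact this (left_mem_Icc.2 hsτ) (right_mem_Icc.2 hsτ) hsτ
  have hθ0 : 0 ≤ θ := by positivity
  have hXτ : X τ ≤ S.Cc * (B * (2 * ρ)) := by
    refine (Xub τ ⟨hτc, hτd⟩).trans (mul_le_mul_of_nonneg_left ?_ hC.le)
    have := intervalIntegral.integral_mono_on hle (ii_of_contOn hle ((cw τ ⟨hτc, hτd⟩).mono hsI))
      (intervalIntegrable_const (c := B)) fun y hy => (le_abs_self _).trans (hB y (hsI hy))
    refine this.trans (le_of_eq ?_)
    rw [intervalIntegral.integral_const, smul_eq_mul]; ring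
  have hXs : X s ≤ 6 * S.Cc * ε * ρ := by
    have h1 : X s - θ ≤ (X τ - θ) * exp (-(lam / ρ^2) * (τ - s)) := by
      have h2 := mul_le_mul_of_nonneg_right hmono (exp_pos ((lam / ρ^2) * s)).le
      rw [mul_assoc, mul_assoc, ← exp_add, ← exp_add] at h2
      rw [show -(lam / ρ^2) * s + lam / ρ^2 * s = 0 by ring, exp_zero, mul_one,
        show -(lam / ρ^2) * τ + lam / ρ^2 * s = -(lam / ρ^2) * (τ - s) by ring] at h2
      exact h2
    have hz : 0 < lam / ρ^2 * (Δ / 2) := by positivity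
    have h3 : exp (-(lam / ρ^2) * (τ - s)) ≤ 1 / (lam / ρ^2 * (Δ / 2)) := by
      have hge : lam / ρ^2 * (Δ / 2) ≤ lam / ρ^2 * (τ - s) :=
        mul_le_mul_of_nonneg_left (by rw [hΔ]; linarith [hs.2]) (by positivity)
      rw [neg_mul, exp_neg, one_div]
      refine inv_anti₀ hz ?_
      linarith [add_one_le_exp (lam / ρ^2 * (τ - s))]
    have h4 : (X τ - θ) * exp (-(lam / ρ^2) * (τ - s)) ≤ S.Cc * (B * (2 * ρ)) * (1 / (lam / ρ^2 * (Δ / 2))) :=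
      mul_le_mul (by linarith) h3 (exp_pos _).le (by positivity)
    have h5 : S.Cc * (B * (2 * ρ)) * (1 / (lam / ρ^2 * (Δ / 2))) ≤ 2 * S.Cc * ε * ρ := by
      have : S.Cc * (B * (2 * ρ)) * (1 / (lam / ρ^2 * (Δ / 2))) = 2 * S.Cc * ρ * (2 * B * ρ^2 / (lam * Δ)) := by
        field_simp
      rw [this, show 2 * S.Cc * ε * ρ = 2 * S.Cc * ρ * ε by ring]
      refine mul_le_mul_of_nonneg_left ?_ (by positivity)
      rw [div_le_iff₀ (by positivity)]
      rw [le_div_iff₀ (by positivity)] at r5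
      have : 2 * B * ρ^2 ≤ ρ * (2 * (B + 1)) := by nlinarith [mul_nonneg hB0 hρ.le]
      linarith
    linarith
  have hlow : S.jm / 4 * (∫ y in (x - ρ / 2)..(x + ρ / 2), (S.u s y - f y + K0 * (s - c))) ≤ X s := by
    have hle2 : x - ρ / 2 ≤ x + ρ / 2 := by linarith
    have h1 : S.jm / 4 * (∫ y in (x - ρ / 2)..(x + ρ / 2), (S.u s y - f y + K0 * (s - c))) ≤
        ∫ y in (x - ρ / 2)..(x + ρ / 2), kphi x ρ y * (S.j s y * (S.u s y - f y + K0 * (s - c))) := by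
      rw [← intervalIntegral.integral_const_mul]
      refine intervalIntegral.integral_mono_on hle2 ((ii_of_contOn hle2 ((cw s hsd).mono (hsI2.trans hsI))).const_mul _)
        (ii_of_contOn hle2 ((cX s hsd).mono hsI2)) fun y hy => ?_
      have h1 := kphi_ge hρ (y := y) (x := x) (abs_le.2 ⟨by linarith [hy.1], by linarith [hy.2]⟩)
      have h3 := hw0 s hsd y (hsI (hsI2 hy))
      have h4 := S.jlb (hT s hsd) (hsub (hsI (hsI2 hy)))
      rw [← mul_assoc]
      refine mul_le_mul_of_nonneg_right ?_ h3
      nlinarith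
    refine h1.trans ?_
    refine intervalIntegral.integral_mono_interval (by linarith) hle2 (by linarith) ?_ (ii_of_contOn hle (cX s hsd))
    refine (ae_restrict_iff' measurableSet_Ioc).2 (ae_of_all _ fun y hy => ?_)
    have hy' : y ∈ Icc (x - ρ) (x + ρ) := Ioc_subset_Icc_self hy
    exact mul_nonneg (kphi_nonneg _ _ _) (mul_nonneg (S.jpos (hT s hsd) (hsub (hsI hy'))).le (hw0 s hsd y (hsI hy')))
  rw [show 24 * S.Cc / S.jm * ε * ρ = (6 * S.Cc * ε * ρ) / (S.jm / 4) by field_simp; ring]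
  rw [le_div_iff₀ (by positivity)]
  linarith

theorem trace {c d l r K0 : ℝ} (hc : S.T1 ≤ c) (hcd : c < d)
    (hG : ∀ t ∈ Ioo c d, S.Good t) (hl : S.L < l) (hr : r < S.R)
    {f f1 f2 : ℝ → ℝ} (hf : C2On f f1 f2 l r)
    (hw0 : ∀ t ∈ Ioo c d, ∀ y ∈ Icc l r, 0 ≤ S.u t y - f y + K0 * (t - c))
    (hsup : ∀ t ∈ Ioo c d, ∀ y ∈ Icc l r,
      0 ≤ S.A * f2 y + S.b y * f1 y + (S.b1 - S.j1 y) * (f y - K0 * (t - c)) + S.j t y * K0)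
    (hlim : ∀ x ∈ Icc l r, Tendsto (fun t => S.u t x) (𝓝[>] c) (𝓝 (f x)))
    {l' r' : ℝ} (hl' : l < l') (hlr' : l' < r') (hr' : r' < r) :
    Tendsto (fun t => ∫ y in l'..r', (S.u t y - f y + K0 * (t - c))) (𝓝[>] c) (𝓝 0) := by
  have hsub : Icc l r ⊆ Icc S.L S.R := Icc_subset_Icc hl.le hr.le
  have hT : ∀ t ∈ Ioo c d, t ∈ Ioo S.T1 S.T2 := fun t ht => (hG t ht).mem
  have hC := S.hCc
  have hjm := S.hjm
  have cw : ∀ t ∈ Ioo c d, ContinuousOn (fun y => S.u t y - f y + K0 * (t - c)) (Icc l r) :=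
    fun t ht => (((S.c2 t (hT t ht)).cw.mono hsub).sub hf.cw).add continuousOn_const
  have key : ∀ ε > 0, ∃ s0 > c, s0 < d ∧ ∀ s ∈ Ioo c s0,
      ∫ y in l'..r', (S.u s y - f y + K0 * (s - c)) ≤ 48 * S.Cc / S.jm * ε * (r' - l') := by
    intro ε hε
    refine cousin_add (Q := fun y z => ∃ s0 > c, s0 < d ∧ ∀ s ∈ Ioo c s0,
      ∫ y in y..z, (S.u s y - f y + K0 * (s - c)) ≤ 48 * S.Cc / S.jm * ε * (z - y)) hlr'.le ?_ ?_ ?_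
    · rintro x y z hx hxy hyz hz ⟨s0, h0, h0d, h1⟩ ⟨s1, h2, h2d, h3⟩
      refine ⟨min s0 s1, lt_min h0 h2, (min_le_left _ _).trans_lt h0d, fun s hs => ?_⟩
      have hs0 : s ∈ Ioo c s0 := ⟨hs.1, hs.2.trans_le (min_le_left _ _)⟩
      have hs1 : s ∈ Ioo c s1 := ⟨hs.1, hs.2.trans_le (min_le_right _ _)⟩
      have hc' := cw s ⟨hs.1, hs0.2.trans h0d⟩
      rw [← intervalIntegral.integral_add_adjacent_intervals
        (ii_of_contOn hxy (hc'.mono (Icc_subset_Icc (by linarith) (by linarith))))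
        (ii_of_contOn hyz (hc'.mono (Icc_subset_Icc (by linarith) (by linarith))))]
      have := h1 s hs0
      have := h3 s hs1
      nlinarith
    · refine ⟨(c + d) / 2, by linarith, by linarith, fun s _ => ?_⟩
      simp
    · intro x hx
      obtain ⟨ρ0, hρ0, s0, hs0, hs0d, h⟩ := S.trace_local hc hcd hG hl hr hf hw0 hsup
        (x := x) ⟨by linarith [hx.1], by linarith [hx.2]⟩ (hlim x ⟨by linarith [hx.1], by linarith [hx.2]⟩) hε
      refine ⟨ρ0 / 2, by linarith, fun y z hy hyx hxz hz hd => ?_⟩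
      rcases eq_or_lt_of_le (hyx.trans hxz) with hyz | hyz
      · subst hyz
        refine ⟨s0, hs0, hs0d, fun s _ => ?_⟩
        simp
      refine ⟨s0, hs0, hs0d, fun s hs => ?_⟩
      obtain ⟨k1, k2, k3⟩ := h (2 * (z - y)) (by linarith) (by linarith)
      refine le_trans ?_ ((k3 s hs).trans (le_of_eq (by ring)))
      have hsd : s ∈ Ioo c d := ⟨hs.1, hs.2.trans hs0d⟩
      refine intervalIntegral.integral_mono_interval (by linarith) hyz.le (by linarith) ?_
        (ii_of_contOn (by linarith) ((cw s hsd).mono (Icc_subset_Icc (by linarith) (by linarith))))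
      refine (ae_restrict_iff' measurableSet_Ioc).2 (ae_of_all _ fun w hw => ?_)
      exact hw0 s hsd w ⟨by linarith [hw.1], by linarith [hw.2]⟩
  rw [Metric.tendsto_nhds]
  intro ε hε
  have hM : 0 < 48 * S.Cc / S.jm * (r' - l') := mul_pos (by positivity) (by linarith)
  obtain ⟨s0, hs0, hs0d, h⟩ := key (ε / 2 / (48 * S.Cc / S.jm * (r' - l'))) (by positivity)
  filter_upwards [Ioo_mem_nhdsGT hs0] with s hs
  have h1 := h s hs
  have e1 : 48 * S.Cc / S.jm * (ε / 2 / (48 * S.Cc / S.jm * (r' - l'))) * (r' - l') = ε / 2 := by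
    have : r' - l' ≠ 0 := by linarith
    field_simp
  have h0 : 0 ≤ ∫ y in l'..r', (S.u s y - f y + K0 * (s - c)) :=
    intervalIntegral.integral_nonneg hlr'.le fun y hy =>
      hw0 s ⟨hs.1, hs.2.trans hs0d⟩ y ⟨by linarith [hy.1], by linarith [hy.2]⟩
  rw [Real.dist_eq, sub_zero, abs_of_nonneg h0]
  linarith
end Sys

namespace Sys
variable (S : Sys)

theorem barrier_bound {x n κ W K f f1 f2 k0 k1 k2 z : ℝ} (hx : x ∈ Icc S.L S.R)
    (hκ : 0 ≤ κ) (hW : 0 ≤ W) (hn : 0 ≤ n)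
    (hK : 2 * S.Cc * (4 * n + 2 * κ + 2 * κ * W + 2 * κ * W^2) / S.jm ≤ K)
    (hf : |f| ≤ n) (hf1 : |f1| ≤ n) (hf2 : |f2| ≤ n) (h0 : |k0| ≤ κ * W^2) (h1 : |k1| ≤ 2 * κ * W)
    (h2 : |k2| ≤ 2 * κ) (hz : |z| ≤ K * (S.T2 - S.T1)) :
    |S.A * (f2 + k2) + S.b x * (f1 + k1) + (S.b1 - S.j1 x) * (f + k0 + z)| ≤ S.jm * K := by
  have hC := S.hCc
  have hjm := S.hjm
  have hA := S.hA
  have hK0 : 0 ≤ K := le_trans (by positivity) hK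
  rw [div_le_iff₀ hjm] at hK
  have e1 : |S.A * (f2 + k2)| ≤ S.Cc * (n + 2 * κ) := by
    rw [abs_mul, abs_of_pos hA]
    exact mul_le_mul S.hAC ((abs_add_le _ _).trans (add_le_add hf2 h2)) (abs_nonneg _) hC.le
  have e2 : |S.b x * (f1 + k1)| ≤ S.Cc * (n + 2 * κ * W) := by
    rw [abs_mul]
    exact mul_le_mul (S.bbd hx) ((abs_add_le _ _).trans (add_le_add hf1 h1)) (abs_nonneg _) hC.le
  have e3 : |(S.b1 - S.j1 x) * (f + k0 + z)| ≤ (2 * S.Cc) * (n + κ * W^2 + K * (S.T2 - S.T1)) := by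
    rw [abs_mul]
    refine mul_le_mul ?_ ?_ (abs_nonneg _) (by linarith)
    · have := abs_sub (S.b1) (S.j1 x)
      linarith [S.hb1, S.hj1 x hx]
    · exact (abs_add_le _ _).trans (add_le_add ((abs_add_le _ _).trans (add_le_add hf h0)) hz)
  have e4 := (abs_add_le (S.A * (f2 + k2) + S.b x * (f1 + k1)) ((S.b1 - S.j1 x) * (f + k0 + z)))
  have e5 := abs_add_le (S.A * (f2 + k2)) (S.b x * (f1 + k1))
  have hs := mul_le_mul_of_nonneg_right S.small hK0
  nlinarith

theorem c2_quad (κ x0 l r : ℝ) : C2On (fun x => κ * (x - x0)^2) (fun x => 2 * κ * (x - x0)) (fun _ => 2 * κ) l r := by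
  refine ⟨fun x _ => ?_, fun x _ => ?_, continuousOn_const⟩
  · refine ((((hasDerivAt_id x).sub_const x0).pow 2).const_mul κ).congr_deriv ?_
    simp; ring
  · refine (((hasDerivAt_id x).sub_const x0).const_mul (2 * κ)).congr_deriv ?_
    simp

structure GapData (c d n : ℝ) (f f1 f2 : ℝ → ℝ) : Prop where
  hc : S.T1 ≤ c
  hcd : c < d
  hd : d ≤ S.T2
  hG : ∀ t ∈ Ioo c d, S.Good t
  hf : C2On f f1 f2 S.L S.R
  h0 : ∀ x ∈ Icc S.L S.R, 0 ≤ f x ∧ f x ≤ n ∧ |f1 x| ≤ n ∧ |f2 x| ≤ n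
  hlim : ∀ x ∈ Icc S.L S.R, Tendsto (fun t => S.u t x) (𝓝[>] c) (𝓝 (f x))

set_option maxHeartbeats 1000000 in
theorem gap_lower {l1 r1 l2 r2 : ℝ} (a1 : S.L < l1) (a2 : l1 < l2) (a3 : l2 < r2) (a4 : r2 < r1) (a5 : r1 < S.R)
    {n : ℝ} (hn : 0 ≤ n) : ∃ K, 2 * S.Cc * (4 * n) / S.jm ≤ K ∧ ∀ c d f f1 f2, S.GapData c d n f f1 f2 →
      ∀ t ∈ Ioo c d, ∀ x ∈ Icc l2 r2, 0 ≤ S.u t x - f x + K * (t - c) := by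
  set δ := min (l2 - l1) (r1 - r2) with hδ
  have hδ0 : 0 < δ := lt_min (by linarith) (by linarith)
  set κ := n / δ^2 with hκ
  have hκ0 : 0 ≤ κ := by positivity
  have hκδ : κ * δ^2 = n := by rw [hκ]; field_simp
  set W := S.R - S.L with hW
  have hW0 : 0 ≤ W := by rw [hW]; linarith [S.hLR]
  have hjm := S.hjm
  have hC := S.hCc
  set K := 2 * S.Cc * (4 * n + 2 * κ + 2 * κ * W + 2 * κ * W^2) / S.jm with hK
  have hK0 : 0 ≤ K := by positivity
  refine ⟨K, ?_, ?_⟩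
  · refine div_le_div_of_nonneg_right (mul_le_mul_of_nonneg_left ?_ (by positivity)) hjm.le
    have : 0 ≤ 2 * κ + 2 * κ * W + 2 * κ * W^2 := by positivity
    linarith
  intro c d f f1 f2 D t ht x0 hx0
  have hc0 : c < d := D.hcd
  have hsub : Icc l1 r1 ⊆ Icc S.L S.R := Icc_subset_Icc a1.le a5.le
  have hT : ∀ t ∈ Ioo c d, t ∈ Ioo S.T1 S.T2 := fun t ht => (D.hG t ht).mem
  have hl0 : δ ≤ x0 - l1 := (min_le_left _ _).trans (by linarith [hx0.1])
  have hr0 : δ ≤ r1 - x0 := (min_le_right _ _).trans (by linarith [hx0.2])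
  have hF : C2On (fun x => f x + (K * c + (-κ) * (x - x0)^2)) (fun x => f1 x + (2 * (-κ) * (x - x0)))
      (fun x => f2 x + 2 * (-κ)) l1 r1 := by
    refine ((D.hf.mono a1.le a5.le).add ((C2On.const (K * c) l1 r1).add (c2_quad (-κ) x0 l1 r1))).congr
      (fun _ => rfl) (fun _ => by ring) (fun _ => by ring)
  have hcomp := S.comp D.hc D.hd D.hG a1 (by linarith : l1 < r1) a5 hF (-K) (-1) ?_ ?_ ?_ ?_ t ht x0
    ⟨by linarith [hx0.1], by linarith [hx0.2]⟩
  · simp only [sub_self] at hcomp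
    nlinarith
  · intro s hs
    have h1 := S.u_nonneg s (hT s hs) l1 (hsub ⟨le_rfl, by linarith⟩)
    have h2 := (D.h0 l1 (hsub ⟨le_rfl, by linarith⟩)).2.1
    have h3 : n ≤ κ * (l1 - x0)^2 := by
      rw [← hκδ]; refine mul_le_mul_of_nonneg_left ?_ hκ0; nlinarith
    have h4 : 0 ≤ K * (s - c) := mul_nonneg hK0 (by linarith [hs.1])
    nlinarith
  · intro s hs
    have h1 := S.u_nonneg s (hT s hs) r1 (hsub ⟨by linarith, le_rfl⟩)
    have h2 := (D.h0 r1 (hsub ⟨by linarith, le_rfl⟩)).2.1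
    have h3 : n ≤ κ * (r1 - x0)^2 := by
      rw [← hκδ]; refine mul_le_mul_of_nonneg_left ?_ hκ0; nlinarith
    have h4 : 0 ≤ K * (s - c) := mul_nonneg hK0 (by linarith [hs.1])
    nlinarith
  · intro s hs x hx
    have hxx := hsub hx
    obtain ⟨g1, g2, g3, g4⟩ := D.h0 x hxx
    have hxW : |x - x0| ≤ W := abs_le.2 ⟨by rw [hW]; linarith [hx.1, hx0.2], by rw [hW]; linarith [hx.2, hx0.1]⟩
    have hb := S.barrier_bound (k0 := (-κ) * (x - x0)^2) (k1 := 2 * (-κ) * (x - x0)) (k2 := 2 * (-κ))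
      (z := -(K * (s - c))) hxx hκ0 hW0 hn (le_of_eq hK.symm) (abs_le.2 ⟨by linarith, g2⟩) g3 g4 ?_ ?_ ?_ ?_
    · have h1 := (abs_le.1 hb).1
      have h2 := mul_le_mul_of_nonneg_right (S.jlb (hT s hs) hxx) hK0
      have : f x + (K * c + -κ * (x - x0)^2) + s * -K = f x + -κ * (x - x0)^2 + -(K * (s - c)) := by ring
      rw [this]
      linarith
    · rw [abs_mul, abs_neg, abs_of_nonneg hκ0, abs_of_nonneg (sq_nonneg _)]
      exact mul_le_mul_of_nonneg_left (sq_le_sq' (by linarith [(abs_le.1 hxW).1]) (abs_le.1 hxW).2) hκ0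
    · rw [abs_mul, abs_mul, abs_neg, abs_of_nonneg hκ0, abs_two]
      exact mul_le_mul_of_nonneg_left hxW (by positivity)
    · rw [abs_mul, abs_neg, abs_of_nonneg hκ0, abs_two]
    · rw [abs_neg, abs_mul, abs_of_nonneg hK0, abs_of_nonneg (by linarith [hs.1])]
      exact mul_le_mul_of_nonneg_left (by linarith [hs.2, D.hd, D.hc]) hK0
  · have : (0:ℝ) = ∫ x in l1..r1, (0:ℝ) := by simp
    rw [this]
    have hnb : ∀ᶠ s in 𝓝[>] c, s ∈ Ioo c d := Ioo_mem_nhdsGT D.hcd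
    refine bct (by linarith) ?_ ⟨n, ?_⟩ ?_
    · filter_upwards [hnb] with s hs
      exact etaK.cf.comp_continuousOn (continuousOn_const.mul
        (((S.c2 s (hT s hs)).cw.mono hsub).sub (hF.cw.add continuousOn_const)))
    · filter_upwards [hnb] with s hs x hx
      rw [abs_of_nonneg (etaK_nonneg _)]
      refine (etaK_le _).trans (max_le ?_ hn)
      have h1 := S.u_nonneg s (hT s hs) x (hsub hx)
      have h2 := (D.h0 x (hsub hx)).2.1
      have h4 : 0 ≤ K * (s - c) := mul_nonneg hK0 (by linarith [hs.1])
      have h5 : 0 ≤ κ * (x - x0)^2 := by positivity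
      nlinarith
    · intro x hx
      have hl := D.hlim x (hsub hx)
      have h2 : Tendsto (fun s : ℝ => f x + (K * c + (-κ) * (x - x0)^2) + s * (-K)) (𝓝[>] c)
          (𝓝 (f x + (K * c + (-κ) * (x - x0)^2) + c * (-K))) :=
        ((by fun_prop : Continuous fun s : ℝ => f x + (K * c + (-κ) * (x - x0)^2) + s * (-K)).tendsto c).mono_left nhdsWithin_le_nhds
      have h3 := (etaK.cf.tendsto _).comp ((hl.sub h2).const_mul (-1))
      rw [etaK_of_nonpos] at h3
      · exact h3
      · have h5 : 0 ≤ κ * (x - x0)^2 := by positivity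
        nlinarith

set_option maxHeartbeats 1000000 in
theorem gap {l r : ℝ} (hl : S.L < l) (hlr : l ≤ r) (hr : r < S.R) {n : ℝ} (hn : 0 ≤ n) :
    ∃ K, 0 ≤ K ∧ ∀ c d f f1 f2, S.GapData c d n f f1 f2 →
      ∀ t ∈ Ioo c d, ∀ x ∈ Icc l r, |S.u t x - f x| ≤ K * (t - c) := by
  obtain ⟨l1, a1, q1⟩ := exists_between hl
  obtain ⟨l2, a2, q2⟩ := exists_between q1
  obtain ⟨l3, a3, q3⟩ := exists_between q2
  obtain ⟨r1, b1, b1'⟩ := exists_between hr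
  obtain ⟨r2, b2, b2'⟩ := exists_between b1
  obtain ⟨r3, b3, b3'⟩ := exists_between b2
  obtain ⟨K1, hK1, low⟩ := S.gap_lower a1 a2 (by linarith : l2 < r2) b2' b1' hn
  have hjm := S.hjm
  have hC := S.hCc
  have hK10 : 0 ≤ K1 := le_trans (by positivity) hK1
  obtain ⟨B1, hB1⟩ := S.lat l3 ⟨by linarith, by linarith⟩
  obtain ⟨B2, hB2⟩ := S.lat r3 ⟨by linarith, by linarith⟩
  set B := max 0 (max B1 B2) with hB
  have hB0 : 0 ≤ B := le_max_left _ _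
  have hB1' : B1 ≤ B := (le_max_left _ _).trans (le_max_right _ _)
  have hB2' : B2 ≤ B := (le_max_right _ _).trans (le_max_right _ _)
  set δ := min (l - l3) (r3 - r) with hδ
  have hδ0 : 0 < δ := lt_min (by linarith) (by linarith)
  set κ := B / δ^2 with hκ
  have hκ0 : 0 ≤ κ := by positivity
  have hκδ : κ * δ^2 = B := by rw [hκ]; field_simp
  set W := S.R - S.L with hW
  have hW0 : 0 ≤ W := by rw [hW]; linarith [S.hLR]
  set K := 2 * S.Cc * (4 * n + 2 * κ + 2 * κ * W + 2 * κ * W^2) / S.jm with hK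
  have hK0 : 0 ≤ K := by positivity
  refine ⟨max K K1, hK0.trans (le_max_left _ _), ?_⟩
  intro c d f f1 f2 D t ht x0 hx0
  have hc0 : c < d := D.hcd
  have htc : 0 ≤ t - c := by linarith [ht.1]
  have hsub : Icc l3 r3 ⊆ Icc S.L S.R := Icc_subset_Icc (by linarith) (by linarith)
  have hsub2 : Icc l2 r2 ⊆ Icc S.L S.R := Icc_subset_Icc (by linarith) (by linarith)
  have hT : ∀ t ∈ Ioo c d, t ∈ Ioo S.T1 S.T2 := fun t ht => (D.hG t ht).mem
  have hlow := low c d f f1 f2 D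
  have htr := S.trace (l := l2) (r := r2) D.hc D.hcd D.hG (by linarith) (by linarith)
    (D.hf.mono (by linarith) (by linarith)) hlow ?_ (fun x hx => D.hlim x (hsub2 hx)) a3 (by linarith : l3 < r3) b3'
  swap
  · intro s hs y hy
    have hyy := hsub2 hy
    obtain ⟨g1, g2, g3, g4⟩ := D.h0 y hyy
    have hb := S.barrier_bound (k0 := 0) (k1 := 0) (k2 := 0) (K := K1) (κ := 0)
      (z := -(K1 * (s - c))) hyy le_rfl hW0 hn (by simpa using hK1)
      (abs_le.2 ⟨by linarith, g2⟩) g3 g4 (by simp) (by simp) (by simp) ?_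
    · have h1 := (abs_le.1 hb).1
      have h2 := mul_le_mul_of_nonneg_right (S.jlb (hT s hs) hyy) hK10
      simp only [add_zero] at h1
      rw [sub_eq_add_neg (f y)]
      linarith
    · rw [abs_neg, abs_mul, abs_of_nonneg hK10, abs_of_nonneg (by linarith [hs.1])]
      exact mul_le_mul_of_nonneg_left (by linarith [hs.2, D.hd, D.hc]) hK10
  have hl0 : δ ≤ x0 - l3 := (min_le_left _ _).trans (by linarith [hx0.1])
  have hr0 : δ ≤ r3 - x0 := (min_le_right _ _).trans (by linarith [hx0.2])
  have hF : C2On (fun x => f x + (-(K * c) + κ * (x - x0)^2)) (fun x => f1 x + (2 * κ * (x - x0)))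
      (fun x => f2 x + 2 * κ) l3 r3 := by
    refine ((D.hf.mono (by linarith) (by linarith)).add ((C2On.const (-(K * c)) l3 r3).add (c2_quad κ x0 l3 r3))).congr
      (fun _ => rfl) (fun _ => by ring) (fun _ => by ring)
  have hcomp := S.comp D.hc D.hd D.hG (by linarith) (by linarith : l3 < r3) (by linarith) hF K 1 ?_ ?_ ?_ ?_ t ht x0
    ⟨by linarith [hx0.1], by linarith [hx0.2]⟩
  · simp only [sub_self] at hcomp
    have h1 := hlow t ht x0 ⟨by linarith [hx0.1], by linarith [hx0.2]⟩
    have h2 := mul_le_mul_of_nonneg_right (le_max_left K K1) htc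
    have h3 := mul_le_mul_of_nonneg_right (le_max_right K K1) htc
    rw [abs_le]
    constructor <;> nlinarith
  · intro s hs
    have h1 := hB1 s (hT s hs)
    have h2 := (D.h0 l3 (hsub ⟨le_rfl, by linarith⟩)).1
    have h3 : B ≤ κ * (l3 - x0)^2 := by
      rw [← hκδ]; refine mul_le_mul_of_nonneg_left ?_ hκ0; nlinarith
    have h4 : 0 ≤ K * (s - c) := mul_nonneg hK0 (by linarith [hs.1])
    nlinarith
  · intro s hs
    have h1 := hB2 s (hT s hs)
    have h2 := (D.h0 r3 (hsub ⟨by linarith, le_rfl⟩)).1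
    have h3 : B ≤ κ * (r3 - x0)^2 := by
      rw [← hκδ]; refine mul_le_mul_of_nonneg_left ?_ hκ0; nlinarith
    have h4 : 0 ≤ K * (s - c) := mul_nonneg hK0 (by linarith [hs.1])
    nlinarith
  · intro s hs x hx
    have hxx := hsub hx
    obtain ⟨g1, g2, g3, g4⟩ := D.h0 x hxx
    have hxW : |x - x0| ≤ W := abs_le.2 ⟨by rw [hW]; linarith [hx.1, hx0.2], by rw [hW]; linarith [hx.2, hx0.1]⟩
    have hb := S.barrier_bound (k0 := κ * (x - x0)^2) (k1 := 2 * κ * (x - x0)) (k2 := 2 * κ)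
      (z := (K * (s - c))) hxx hκ0 hW0 hn (le_of_eq hK.symm) (abs_le.2 ⟨by linarith, g2⟩) g3 g4 ?_ ?_ ?_ ?_
    · have h1 := (abs_le.1 hb).2
      have h2 := mul_le_mul_of_nonneg_right (S.jlb (hT s hs) hxx) hK0
      have : f x + (-(K * c) + κ * (x - x0)^2) + s * K = f x + κ * (x - x0)^2 + (K * (s - c)) := by ring
      rw [this]
      linarith
    · rw [abs_mul, abs_of_nonneg hκ0, abs_of_nonneg (sq_nonneg _)]
      exact mul_le_mul_of_nonneg_left (sq_le_sq' (by linarith [(abs_le.1 hxW).1]) (abs_le.1 hxW).2) hκ0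
    · rw [abs_mul, abs_mul, abs_of_nonneg hκ0, abs_two]
      exact mul_le_mul_of_nonneg_left hxW (by positivity)
    · rw [abs_mul, abs_of_nonneg hκ0, abs_two]
    · rw [abs_mul, abs_of_nonneg hK0, abs_of_nonneg (by linarith [hs.1])]
      exact mul_le_mul_of_nonneg_left (by linarith [hs.2, D.hd, D.hc]) hK0
  · have hnb : ∀ᶠ s in 𝓝[>] c, s ∈ Ioo c d := Ioo_mem_nhdsGT D.hcd
    refine tendsto_of_tendsto_of_tendsto_of_le_of_le' tendsto_const_nhds htr ?_ ?_
    · filter_upwards with s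
      exact intervalIntegral.integral_nonneg (by linarith) fun x _ => etaK_nonneg _
    · filter_upwards [hnb] with s hs
      refine intervalIntegral.integral_mono_on (by linarith)
        (ii_of_contOn (by linarith) (etaK.cf.comp_continuousOn (continuousOn_const.mul
        (((S.c2 s (hT s hs)).cw.mono hsub).sub (hF.cw.add continuousOn_const)))))
        (ii_of_contOn (by linarith) ((((S.c2 s (hT s hs)).cw.mono hsub).sub (D.hf.cw.mono hsub)).add continuousOn_const))
        fun x hx => ?_
      have h1 := hlow s hs x ⟨by linarith [hx.1], by linarith [hx.2]⟩
      refine (etaK_le _).trans (max_le ?_ h1)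
      have h4 : 0 ≤ K * (s - c) := mul_nonneg hK0 (by linarith [hs.1])
      have h5 : 0 ≤ K1 * (s - c) := mul_nonneg hK10 (by linarith [hs.1])
      have h6 : 0 ≤ κ * (x - x0)^2 := by positivity
      nlinarith
end Sys

namespace Sys
variable (S : Sys)

def SB (n t : ℝ) : Prop := ∀ x ∈ Icc S.L S.R, S.u t x ≤ n ∧ |S.ux t x| ≤ n ∧ |S.uxx t x| ≤ n

theorem SB_exists {t : ℝ} (ht : t ∈ Ioo S.T1 S.T2) : ∃ n, 0 ≤ n ∧ S.SB n t := by
  obtain ⟨a, ha, ha'⟩ := contOn_bdd (S.c2 t ht).cw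
  obtain ⟨b, hb, hb'⟩ := contOn_bdd (S.c2 t ht).cw1
  obtain ⟨c, hc, hc'⟩ := contOn_bdd (S.c2 t ht).c
  refine ⟨a + b + c, by linarith, fun x hx => ⟨?_, ?_, ?_⟩⟩
  · linarith [le_abs_self (S.u t x), ha' x hx]
  · linarith [hb' x hx]
  · linarith [hc' x hx]

theorem SB.mono {S : Sys} {n m t : ℝ} (h : S.SB n t) (hnm : n ≤ m) : S.SB m t := fun x hx =>
  ⟨(h x hx).1.trans hnm, (h x hx).2.1.trans hnm, (h x hx).2.2.trans hnm⟩

theorem SB.ut_le {S : Sys} {n t : ℝ} (ht : t ∈ Ioo S.T1 S.T2) (h : S.SB n t) (hn : 0 ≤ n) {x : ℝ}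
    (hx : x ∈ Icc S.L S.R) : |S.ut t x| ≤ 4 * S.Cc * n / S.jm := by
  have hjm := S.hjm
  have hC := S.hCc
  obtain ⟨h1, h2, h3⟩ := h x hx
  have h0 := S.u_nonneg t ht x hx
  have hu : |S.u t x| ≤ n := by rw [abs_of_nonneg h0]; exact h1
  have hp := S.pde' ht hx
  have e : S.j t x * S.ut t x = S.A * S.uxx t x + S.b x * S.ux t x + S.b1 * S.u t x - S.j1 x * S.u t x := by
    unfold Rr at hp; linarith
  rw [le_div_iff₀ hjm]
  have e1 : |S.A * S.uxx t x| ≤ S.Cc * n := by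
    rw [abs_mul, abs_of_pos S.hA]; exact mul_le_mul S.hAC h3 (abs_nonneg _) hC.le
  have e2 : |S.b x * S.ux t x| ≤ S.Cc * n := by
    rw [abs_mul]; exact mul_le_mul (S.bbd hx) h2 (abs_nonneg _) hC.le
  have e3 : |S.b1 * S.u t x| ≤ S.Cc * n := by
    rw [abs_mul]; exact mul_le_mul S.hb1 hu (abs_nonneg _) hC.le
  have e4 : |S.j1 x * S.u t x| ≤ S.Cc * n := by
    rw [abs_mul]; exact mul_le_mul (S.hj1 x hx) hu (abs_nonneg _) hC.le
  have e5 : |S.j t x * S.ut t x| ≤ 4 * S.Cc * n := by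
    rw [e]
    rw [abs_le] at *
    constructor <;> linarith [e1.1, e1.2, e2.1, e2.2, e3.1, e3.2, e4.1, e4.2]
  rw [abs_mul, abs_of_pos (S.jpos ht hx)] at e5
  have := mul_le_mul_of_nonneg_right (S.jlb ht hx) (abs_nonneg (S.ut t x))
  linarith

theorem cross_lip {α β n : ℝ} (hα : S.T1 ≤ α) (hβ : β ≤ S.T2) (hn : 0 ≤ n)
    (h : ∀ t ∈ Ioo α β, S.Good t ∨ S.SB n t) {l r : ℝ} (hl : S.L < l) (hlr : l ≤ r) (hr : r < S.R)
    {c : ℝ} (hc : c ∈ Ioo α β) :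
    ∃ K, 0 ≤ K ∧ ∀ v ∈ Ico c β, ∀ x ∈ Icc l r, |S.u v x - S.u c x| ≤ K * (v - c) := by
  have hT : ∀ t ∈ Ioo α β, t ∈ Ioo S.T1 S.T2 := fun t ht => ⟨hα.trans_lt ht.1, ht.2.trans_le hβ⟩
  have hsub : Icc l r ⊆ Icc S.L S.R := Icc_subset_Icc hl.le hr.le
  obtain ⟨nc, hnc, hSBc⟩ := S.SB_exists (hT c hc)
  set n' := max n nc with hn'
  have hn0 : 0 ≤ n' := hn.trans (le_max_left _ _)
  obtain ⟨K0, hK0, hgap⟩ := S.gap hl hlr hr hn0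
  set K := max K0 (4 * S.Cc * n' / S.jm + 1) with hK
  have hK0' : K0 ≤ K := le_max_left _ _
  refine ⟨K, hK0.trans hK0', ?_⟩
  intro v hv x hx
  set s : Set ℝ := {t | |S.u t x - S.u c x| ≤ K * (t - c)} with hs
  have hIcc : ∀ t ∈ Icc c v, t ∈ Ioo α β := fun t ht => ⟨hc.1.trans_le ht.1, ht.2.trans_lt hv.2⟩
  have hclosed : IsClosed (s ∩ Icc c v) := by
    have h1 : ContinuousOn (fun t => |S.u t x - S.u c x|) (Icc c v) := fun t ht =>
      ((S.cont_t (hT t (hIcc t ht)) (hsub hx)).continuousWithinAt.sub continuousWithinAt_const).abs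
    have h2 : ContinuousOn (fun t => K * (t - c)) (Icc c v) := by fun_prop
    have := isClosed_Icc.isClosed_le h1 h2
    convert this using 1
    ext t; simp only [hs, mem_inter_iff, mem_setOf_eq]; tauto
  have hcs : c ∈ s := by simp [hs]
  refine IsClosed.Icc_subset_of_forall_mem_nhdsGT_of_Icc_subset hclosed hcs ?_ (right_mem_Icc.2 hv.1)
  intro t ht hsubt
  have htαβ := hIcc t ⟨ht.1, ht.2.le⟩
  have hts : |S.u t x - S.u c x| ≤ K * (t - c) := hsubt (right_mem_Icc.2 ht.1)
  by_cases hsb : S.SB n' t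
  · have hut := hsb.ut_le (hT t htαβ) hn0 (hsub hx)
    have hd := (S.dt t (hT t htαβ) x (hsub hx)).hasDerivWithinAt (s := Ioi t)
    rw [hasDerivWithinAt_iff_tendsto_slope' (by simp)] at hd
    have hlt : |S.ut t x| < K := lt_of_lt_of_le (by linarith) (le_max_right _ _)
    have hev := (hd.abs).eventually (gt_mem_nhds hlt)
    filter_upwards [hev, self_mem_nhdsWithin] with τ h1 h2
    have hτ : 0 < τ - t := sub_pos.2 h2
    rw [slope_def_field, abs_div, abs_of_pos hτ, div_lt_iff₀ hτ] at h1
    show |S.u τ x - S.u c x| ≤ K * (τ - c)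
    have := abs_sub_le (S.u τ x) (S.u t x) (S.u c x)
    nlinarith
  · have htc : t ≠ c := by
      rintro rfl; exact hsb (hSBc.mono (le_max_right _ _))
    have htG : S.Good t := (h t htαβ).resolve_right fun h' => hsb (h'.mono (le_max_left _ _))
    set Ch : Set ℝ := Icc c t ∩ ({s | S.Good s}ᶜ ∪ {c}) with hCh
    have hopen : IsOpen {s | S.Good s} := isOpen_iff_mem_nhds.2 fun s hs => Good.nhds hs
    have hcomp : IsCompact Ch := isCompact_Icc.inter_right (hopen.isClosed_compl.union isClosed_singleton)
    have hne : Ch.Nonempty := ⟨c, left_mem_Icc.2 ht.1, Or.inr rfl⟩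
    set c' := sSup Ch with hc'
    have hmem : c' ∈ Ch := hcomp.sSup_mem hne
    have hub : ∀ s ∈ Ch, s ≤ c' := fun s hs => le_csSup hcomp.bddAbove hs
    have hc't : c' < t := by
      refine lt_of_le_of_ne hmem.1.2 fun e => ?_
      rcases hmem.2 with h1 | h1
      · rw [e] at h1; exact h1 htG
      · rw [mem_singleton_iff] at h1; exact htc (e.symm.trans h1)
    have hc'I : c' ∈ Icc c v := ⟨hmem.1.1, hc't.le.trans ht.2.le⟩
    have hc'T := hT c' (hIcc c' hc'I)
    have hSB' : S.SB n' c' := by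
      rcases hmem.2 with h1 | h1
      · exact ((h c' (hIcc c' hc'I)).resolve_left h1).mono (le_max_left _ _)
      · rw [mem_singleton_iff] at h1; rw [h1]; exact hSBc.mono (le_max_right _ _)
    obtain ⟨d1, hd1, hd1'⟩ := mem_nhdsGE_iff_exists_Ico_subset.1 (mem_nhdsWithin_of_mem_nhds (Good.nhds htG) : {s | S.Good s} ∈ 𝓝[≥] t)
    set d := min d1 v with hd
    have htd : t < d := lt_min hd1 ht.2
    have hGood : ∀ s ∈ Ioo c' d, S.Good s := by
      intro s hs
      rcases le_or_gt t s with h1 | h1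
      · exact hd1' ⟨h1, hs.2.trans_le (min_le_left _ _)⟩
      · by_contra hng
        have : s ∈ Ch := ⟨⟨hmem.1.1.trans hs.1.le, h1.le⟩, Or.inl hng⟩
        exact absurd (hub s this) (not_le.2 hs.1)
    have D : S.GapData c' d n' (S.u c') (S.ux c') (S.uxx c') := by
      refine ⟨hc'T.1.le, hc't.trans htd, ?_, hGood, S.c2 c' hc'T, fun y hy => ⟨S.u_nonneg c' hc'T y hy, hSB' y hy⟩, fun y hy => ?_⟩
      · exact (min_le_right _ _).trans (hv.2.le.trans hβ)
      · exact (S.cont_t hc'T hy).tendsto.mono_left nhdsWithin_le_nhds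
    have hg := hgap c' d _ _ _ D
    have hc's : |S.u c' x - S.u c x| ≤ K * (c' - c) := hsubt hmem.1
    filter_upwards [Ioo_mem_nhdsGT htd] with τ hτ
    show |S.u τ x - S.u c x| ≤ K * (τ - c)
    have h1 := hg τ ⟨hc't.trans hτ.1, hτ.2⟩ x hx
    have h2 := mul_le_mul_of_nonneg_right hK0' (show 0 ≤ τ - c' by linarith [hτ.1])
    have := abs_sub_le (S.u τ x) (S.u c' x) (S.u c x)
    nlinarith

theorem cross_good {α β n : ℝ} (hα : S.T1 ≤ α) (hβ : β ≤ S.T2) (hn : 0 ≤ n)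
    (h : ∀ t ∈ Ioo α β, S.Good t ∨ S.SB n t) {c : ℝ} (hc : c ∈ Ioo α β) : S.GoodOn c β := by
  have hT : ∀ t ∈ Ioo α β, t ∈ Ioo S.T1 S.T2 := fun t ht => ⟨hα.trans_lt ht.1, ht.2.trans_le hβ⟩
  have hbd : ∀ l r, S.L < l → l ≤ r → r < S.R → ∃ B, ∀ t ∈ Ioo c β, ∀ x ∈ Icc l r, S.u t x ≤ B := by
    intro l r hl hlr hr
    obtain ⟨K, hK, hKl⟩ := S.cross_lip hα hβ hn h hl hlr hr hc
    obtain ⟨m, hm, hm'⟩ := S.SB_exists (hT c hc)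
    refine ⟨m + K * (β - c), fun t ht x hx => ?_⟩
    have h1 := (abs_le.1 (hKl t ⟨ht.1.le, ht.2⟩ x hx)).2
    have h2 := (hm' x ⟨hl.le.trans hx.1, hx.2.trans hr.le⟩).1
    have h3 := mul_le_mul_of_nonneg_left (show t - c ≤ β - c by linarith [ht.2]) hK
    linarith
  refine ⟨hbd, ?_⟩
  intro φ l r hl hlr hr hφ
  have hsub : Icc l r ⊆ Icc S.L S.R := Icc_subset_Icc hl.le hr.le
  obtain ⟨B, hB⟩ := hbd l r hl hlr.le hr
  have hB' : ∀ t ∈ Ioo c β, ∀ x ∈ Icc l r, |S.u t x| ≤ B := fun t ht x hx => by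
    rw [abs_of_nonneg (S.u_nonneg t (hT t ⟨hc.1.trans ht.1, ht.2⟩) x (hsub hx))]; exact hB t ht x hx
  have hT' : ∀ t ∈ Ioo c β, t ∈ Ioo S.T1 S.T2 := fun t ht => hT t ⟨hc.1.trans ht.1, ht.2⟩
  obtain ⟨P, hP0, hP⟩ := contOn_bdd hφ.1
  set N : ℝ → ℝ := fun s => ∫ x in l..r, φ x * (S.j s x * S.u s x) with hN
  set D : ℝ → ℝ := fun s => ∫ x in l..r, φ x * S.Rr s x with hD
  have cN : ∀ t ∈ Ioo c β, ContinuousAt N t := by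
    intro t ht
    have hnb : ∀ᶠ s in 𝓝 t, s ∈ Ioo c β := Ioo_mem_nhds ht.1 ht.2
    refine bct hlr.le ?_ ⟨P * (S.Cc * B), ?_⟩ ?_
    · filter_upwards [hnb] with s hs
      exact hφ.1.mul ((S.cj s).continuousOn.mul ((S.c2 s (hT' s hs)).cw.mono hsub))
    · filter_upwards [hnb] with s hs x hx
      rw [abs_mul, abs_mul, abs_of_pos (S.jpos (hT' s hs) (hsub hx))]
      exact mul_le_mul (hP x hx) (mul_le_mul (S.jub (hT' s hs) (hsub hx)) (hB' s hs x hx) (abs_nonneg _) S.hCc.le)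
        (mul_nonneg (S.jpos (hT' s hs) (hsub hx)).le (abs_nonneg _)) hP0
    · intro x hx
      have hj : ContinuousAt (fun s => S.j s x) t := by unfold Sys.j; fun_prop
      exact tendsto_const_nhds.mul (Tendsto.mul hj (S.cont_t (hT' t ht) (hsub hx)))
  have cD : ∀ t ∈ Ioo c β, ContinuousAt D t := by
    intro t ht
    have hnb : ∀ᶠ s in 𝓝 t, s ∈ Ioo c β := Ioo_mem_nhds ht.1 ht.2
    obtain ⟨_, κ, m, c1, c2, c3, hκ, hm, hform⟩ := hφ
    have e : ∀ᶠ s in 𝓝 t, (∫ x in l..r, κ x * S.u s x) + c1 * S.u s l + c2 * S.u s m + c3 * S.u s r = D s := by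
      filter_upwards [hnb] with s hs
      exact (hform _ _ _ ((S.c2 s (hT' s hs)).mono hl.le hr.le)).symm
    refine ContinuousAt.congr ?_ e
    have hl' : l ∈ Icc S.L S.R := hsub (left_mem_Icc.2 hlr.le)
    have hr' : r ∈ Icc S.L S.R := hsub (right_mem_Icc.2 hlr.le)
    refine ((ContinuousAt.add ?_ (continuousAt_const.mul (S.cont_t (hT' t ht) hl'))).add
      (continuousAt_const.mul (S.cont_t (hT' t ht) (hsub hm)))).add (continuousAt_const.mul (S.cont_t (hT' t ht) hr'))
    have hsub2 : uIoc l r ⊆ Icc l r := by rw [uIoc_of_le hlr.le]; exact Ioc_subset_Icc_self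
    apply intervalIntegral.tendsto_integral_filter_of_dominated_convergence (fun x => ‖κ x‖ * B)
    · filter_upwards [hnb] with s hs
      refine AEStronglyMeasurable.mul ?_ ?_
      · rw [uIoc_of_le hlr.le]; exact hκ.1.aestronglyMeasurable
      · exact (((S.c2 s (hT' s hs)).cw.mono (hsub2.trans hsub))).aestronglyMeasurable measurableSet_uIoc
    · filter_upwards [hnb] with s hs
      refine ae_of_all _ fun x hx => ?_
      rw [norm_mul]
      exact mul_le_mul_of_nonneg_left (by rw [Real.norm_eq_abs]; exact hB' s hs x (hsub2 hx)) (norm_nonneg _)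
    · exact hκ.norm.mul_const B
    · exact ae_of_all _ fun x hx => tendsto_const_nhds.mul (S.cont_t (hT' t ht) (hsub (hsub2 hx)))
  have rN : ∀ t ∈ Ioo c β, HasDerivWithinAt N (D t) (Ici t) t := by
    intro t ht
    rw [← hasDerivWithinAt_Ioi_iff_Ici, hasDerivWithinAt_iff_tendsto_slope' (by simp)]
    obtain ⟨K, hK, hKl⟩ := S.cross_lip hα hβ hn h hl hlr.le hr (c := t) ⟨hc.1.trans ht.1, ht.2⟩
    have hnb : ∀ᶠ s in 𝓝[>] t, s ∈ Ioo t β := Ioo_mem_nhdsGT ht.2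
    have hin : ∀ s ∈ Ioo t β, s ∈ Ioo c β := fun s hs => ⟨ht.1.trans hs.1, hs.2⟩
    have cq : ∀ s ∈ Ioo c β, ContinuousOn (fun x => φ x * (S.j s x * S.u s x)) (Icc l r) := fun s hs =>
      hφ.1.mul ((S.cj s).continuousOn.mul ((S.c2 s (hT' s hs)).cw.mono hsub))
    have e : ∀ᶠ s in 𝓝[>] t, (∫ x in l..r, φ x * ((S.j s x * S.u s x - S.j t x * S.u t x) / (s - t))) = slope N t s := by
      filter_upwards [hnb] with s hs
      rw [slope_def_field, hN]
      simp only
      rw [← intervalIntegral.integral_sub (ii_of_contOn hlr.le (cq s (hin s hs))) (ii_of_contOn hlr.le (cq t ht)),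
        ← intervalIntegral.integral_div]
      refine intervalIntegral.integral_congr fun x _ => ?_
      ring
    refine Tendsto.congr' e ?_
    refine bct hlr.le ?_ ⟨P * (S.Cc * B + S.Cc * K), ?_⟩ ?_
    · filter_upwards [hnb] with s hs
      refine hφ.1.mul (ContinuousOn.div_const ?_ _)
      exact ((S.cj s).continuousOn.mul ((S.c2 s (hT' s (hin s hs))).cw.mono hsub)).sub
        ((S.cj t).continuousOn.mul ((S.c2 t (hT' t ht)).cw.mono hsub))
    · filter_upwards [hnb] with s hs x hx
      have hst : 0 < s - t := sub_pos.2 hs.1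
      rw [abs_mul]
      refine mul_le_mul (hP x hx) ?_ (abs_nonneg _) hP0
      rw [abs_div, abs_of_pos hst, div_le_iff₀ hst]
      have e1 : S.j s x * S.u s x - S.j t x * S.u t x = (s - t) * S.j1 x * S.u s x + S.j t x * (S.u s x - S.u t x) := by
        unfold Sys.j; ring
      rw [e1]
      refine (abs_add_le _ _).trans ?_
      rw [add_mul]
      refine add_le_add ?_ ?_
      · rw [abs_mul, abs_mul, abs_of_pos hst]
        have := mul_le_mul (S.hj1 x (hsub hx)) (hB' s (hin s hs) x hx) (abs_nonneg _) S.hCc.le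
        nlinarith
      · rw [abs_mul, abs_of_pos (S.jpos (hT' t ht) (hsub hx)), mul_assoc]
        exact mul_le_mul (S.jub (hT' t ht) (hsub hx)) (hKl s ⟨hs.1.le, hs.2⟩ x hx) (abs_nonneg _) S.hCc.le
    · intro x hx
      have hj : HasDerivAt (fun s => S.j s x) (S.j1 x) t := by
        unfold Sys.j
        simpa using ((hasDerivAt_id t).mul_const (S.j1 x)).const_add (S.j0 x)
      have hd := (hj.mul (S.dt t (hT' t ht) x (hsub hx))).hasDerivWithinAt (s := Ioi t)
      rw [hasDerivWithinAt_iff_tendsto_slope' (by simp), S.pde' (hT' t ht) (hsub hx)] at hd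
      refine Tendsto.const_mul _ (hd.congr fun s => ?_)
      rw [slope_def_field]
      simp only [Pi.mul_apply]
  intro t ht
  obtain ⟨a, ha, hat⟩ := exists_between ht.1
  obtain ⟨b, htb, hb⟩ := exists_between ht.2
  have hIcc : ∀ s ∈ Icc a b, s ∈ Ioo c β := fun s hs => ⟨ha.trans_le hs.1, hs.2.trans_lt hb⟩
  have cDI : ContinuousOn D (Icc a b) := fun s hs => (cD s (hIcc s hs)).continuousWithinAt
  have iD : ∀ s ∈ Icc a b, IntervalIntegrable D volume a s := fun s hs =>
    ii_of_contOn hs.1 (cDI.mono (Icc_subset_Icc le_rfl hs.2))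
  have hI : ∀ s ∈ Icc a b, HasDerivAt (fun s => ∫ y in a..s, D y) (D s) s := by
    intro s hs
    refine intervalIntegral.integral_hasDerivAt_right (iD s hs) ?_ (cD s (hIcc s hs))
    have hopen : ContinuousOn D (Ioo c β) := fun s hs => (cD s hs).continuousWithinAt
    exact hopen.stronglyMeasurableAtFilter isOpen_Ioo s (hIcc s hs)
  have hconst := constant_of_has_deriv_right_zero (f := fun s => N s - ∫ y in a..s, D y) (a := a) (b := b)
    (fun s hs => ((cN s (hIcc s hs)).sub (hI s hs).continuousAt).continuousWithinAt)
    (fun s hs => by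
      have := (rN s (hIcc s ⟨hs.1, hs.2.le⟩)).sub (hI s ⟨hs.1, hs.2.le⟩).hasDerivWithinAt
      rw [sub_self] at this
      exact this)
  have hfin := (hI t ⟨hat.le, htb.le⟩).const_add (N a)
  refine hfin.congr_of_eventuallyEq ?_
  filter_upwards [Ioo_mem_nhds hat htb] with s hs
  have := hconst s ⟨hs.1.le, hs.2.le⟩
  simp only [intervalIntegral.integral_same, sub_zero] at this
  show N s = _
  linarith

theorem crossing {α β n : ℝ} (hα : S.T1 ≤ α) (hβ : β ≤ S.T2) (hn : 0 ≤ n)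
    (h : ∀ t ∈ Ioo α β, S.Good t ∨ S.SB n t) : ∀ t ∈ Ioo α β, S.Good t := by
  intro t ht
  obtain ⟨c, hc, hct⟩ := exists_between ht.1
  exact ⟨c, β, hct, ht.2, hα.trans hc.le, hβ, S.cross_good hα hβ hn h ⟨hc, hct.trans ht.2⟩⟩
end Sys

theorem nonneg_of_mono {f f1 : ℝ → ℝ} {l r : ℝ} (hlr : l < r) (hm : MonotoneOn f (Icc l r))
    {x : ℝ} (hx : x ∈ Icc l r) (hd : HasDerivAt f (f1 x) x) : 0 ≤ f1 x := by
  refine HasDerivWithinAt.nonneg_of_monotoneOn (s := Icc l r) ?_ hd.hasDerivWithinAt hm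
  have : (Icc l r).Nontrivial := ⟨l, left_mem_Icc.2 hlr.le, r, right_mem_Icc.2 hlr.le, hlr.ne⟩
  exact (uniqueDiffOn_Icc hlr x hx).accPt

theorem convex_second {f f1 f2 : ℝ → ℝ} {l r : ℝ} (hlr : l < r) (h : C2On f f1 f2 l r)
    (hc : ConvexOn ℝ (Icc l r) f) {x : ℝ} (hx : x ∈ Icc l r) : 0 ≤ f2 x := by
  refine nonneg_of_mono hlr (f := f1) ?_ hx (h.d2 x hx)
  intro a ha b hb hab
  rcases eq_or_lt_of_le hab with h1 | h1
  · rw [h1]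
  · exact (hc.le_slope_of_hasDerivAt ha hb h1 (h.d1 a ha)).trans (hc.slope_le_of_hasDerivAt ha hb h1 (h.d1 b hb))

theorem convex_of_second {f f1 f2 : ℝ → ℝ} {l r : ℝ} (h : C2On f f1 f2 l r)
    (hc : ∀ x ∈ Icc l r, 0 ≤ f2 x) : ConvexOn ℝ (Icc l r) f :=
  convexOn_of_hasDerivWithinAt2_nonneg (convex_Icc l r) h.cw
    (fun x hx => (h.d1 x (interior_subset hx)).hasDerivWithinAt)
    (fun x hx => (h.d2 x (interior_subset hx)).hasDerivWithinAt)
    (fun x hx => hc x (interior_subset hx))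

theorem mono_of_first {f f1 : ℝ → ℝ} {l r : ℝ} (h : ∀ x ∈ Icc l r, HasDerivAt f (f1 x) x)
    (hc : ∀ x ∈ Icc l r, 0 ≤ f1 x) : MonotoneOn f (Icc l r) := by
  refine monotoneOn_of_deriv_nonneg (convex_Icc l r) (fun x hx => (h x hx).continuousAt.continuousWithinAt)
    (fun x hx => (h x (interior_subset hx)).differentiableAt.differentiableWithinAt) fun x hx => ?_
  rw [(h x (interior_subset hx)).deriv]
  exact hc x (interior_subset hx)

namespace Sys
variable (S : Sys)

def Gc (n t : ℝ) : Prop :=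
  (∀ x ∈ Icc S.L S.R, S.u t x ≤ n) ∧
  ∀ e ∈ ({1, -1} : Set ℝ), (∀ x ∈ Icc S.L S.R, ∀ y ∈ Icc S.L S.R, x ≤ y → n * x + e * S.u t x ≤ n * y + e * S.u t y) ∧
    (∀ x ∈ Icc S.L S.R, ∀ y ∈ Icc S.L S.R, ∀ a b : ℝ, 0 ≤ a → 0 ≤ b → a + b = 1 →
      n * (a * x + b * y)^2 + e * S.u t (a * x + b * y) ≤ a * (n * x^2 + e * S.u t x) + b * (n * y^2 + e * S.u t y))

theorem c2_e {t : ℝ} (ht : t ∈ Ioo S.T1 S.T2) (n e : ℝ) :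
    C2On (fun x => n * x^2 + e * S.u t x) (fun x => 2 * n * x + e * S.ux t x) (fun x => 2 * n + e * S.uxx t x) S.L S.R := by
  refine ((c2_quad n 0 S.L S.R).add ((S.c2 t ht).const_mul e)).congr (fun x => ?_) (fun x => ?_) (fun x => ?_)
  · simp
  · simp
  · simp

theorem d1_e {t : ℝ} (ht : t ∈ Ioo S.T1 S.T2) (n e : ℝ) : ∀ x ∈ Icc S.L S.R,
    HasDerivAt (fun x => n * x + e * S.u t x) (n + e * S.ux t x) x := by
  intro x hx
  refine (((hasDerivAt_id x).const_mul n).add (((S.c2 t ht).d1 x hx).const_mul e)).congr_deriv ?_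
  simp

theorem Gc_of_SB {n t : ℝ} (ht : t ∈ Ioo S.T1 S.T2) (hn : 0 ≤ n) (h : S.SB n t) : S.Gc n t := by
  refine ⟨fun x hx => (h x hx).1, fun e he => ⟨?_, ?_⟩⟩
  · refine mono_of_first (S.d1_e ht n e) fun x hx => ?_
    have := abs_le.1 (h x hx).2.1
    rcases he with rfl | rfl <;> linarith [this.1, this.2]
  · have := convex_of_second (S.c2_e ht n e) fun x hx => by
      have := abs_le.1 (h x hx).2.2
      rcases he with rfl | rfl <;> linarith [this.1, this.2]
    intro x hx y hy a b ha hb hab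
    simpa using this.2 hx hy ha hb hab

theorem SB_of_Gc {n t : ℝ} (ht : t ∈ Ioo S.T1 S.T2) (hn : 0 ≤ n) (h : S.Gc n t) : S.SB (2 * n) t := by
  have k1 : ∀ e ∈ ({1, -1} : Set ℝ), ∀ x ∈ Icc S.L S.R, 0 ≤ n + e * S.ux t x := fun e he x hx =>
    nonneg_of_mono (f := fun x => n * x + e * S.u t x) (f1 := fun x => n + e * S.ux t x) S.hLR
      (fun x hx y hy hxy => (h.2 e he).1 x hx y hy hxy) hx (S.d1_e ht n e x hx)
  have k2 : ∀ e ∈ ({1, -1} : Set ℝ), ∀ x ∈ Icc S.L S.R, 0 ≤ 2 * n + e * S.uxx t x := fun e he x hx =>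
    convex_second S.hLR (S.c2_e ht n e) ⟨convex_Icc _ _, fun x hx y hy a b ha hb hab => by
      simpa using (h.2 e he).2 x hx y hy a b ha hb hab⟩ hx
  intro x hx
  have a1 := k1 1 (by simp) x hx
  have a2 := k1 (-1) (by simp) x hx
  have a3 := k2 1 (by simp) x hx
  have a4 := k2 (-1) (by simp) x hx
  refine ⟨by linarith [h.1 x hx], abs_le.2 ⟨by linarith, by linarith⟩, abs_le.2 ⟨by linarith, by linarith⟩⟩

theorem all_good : ∀ t ∈ Ioo S.T1 S.T2, S.Good t := by
  by_contra hcon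
  push Not at hcon
  obtain ⟨t1, ht1, hng⟩ := hcon
  set Z : Set ℝ := Ioo S.T1 S.T2 ∩ {t | S.Good t}ᶜ with hZ
  have hopen : IsOpen {s | S.Good s} := isOpen_iff_mem_nhds.2 fun s hs => Good.nhds hs
  have hlc : IsLocallyClosed Z := isOpen_Ioo.isLocallyClosed.inter hopen.isClosed_compl.isLocallyClosed
  haveI : LocallyCompactSpace Z := hlc.locallyCompactSpace
  haveI : Nonempty Z := ⟨⟨t1, ht1, hng⟩⟩
  have hu : ∀ x ∈ Icc S.L S.R, Continuous (fun t : Z => S.u t x) := by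
    intro x hx
    rw [continuous_iff_continuousAt]
    intro t
    exact (S.cont_t t.2.1 hx).comp continuous_subtype_val.continuousAt
  set F : ℕ → Set Z := fun n => {t | S.Gc n t} with hF
  have hclosed : ∀ n, IsClosed (F n) := by
    intro n
    have : F n = {t : Z | ∀ x ∈ Icc S.L S.R, S.u t x ≤ n} ∩
      {t : Z | ∀ e ∈ ({1, -1} : Set ℝ), (∀ x ∈ Icc S.L S.R, ∀ y ∈ Icc S.L S.R, x ≤ y → n * x + e * S.u t x ≤ n * y + e * S.u t y) ∧
    (∀ x ∈ Icc S.L S.R, ∀ y ∈ Icc S.L S.R, ∀ a b : ℝ, 0 ≤ a → 0 ≤ b → a + b = 1 →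
      n * (a * x + b * y)^2 + e * S.u t (a * x + b * y) ≤ a * (n * x^2 + e * S.u t x) + b * (n * y^2 + e * S.u t y))} := rfl
    rw [this]
    refine IsClosed.inter ?_ ?_
    · simp only [setOf_forall]
      exact isClosed_iInter fun x => isClosed_iInter fun hx => isClosed_le (hu x hx) continuous_const
    · simp only [setOf_forall, setOf_and]
      refine isClosed_iInter fun e => isClosed_iInter fun he => IsClosed.inter ?_ ?_
      · refine isClosed_iInter fun x => isClosed_iInter fun hx => isClosed_iInter fun y => isClosed_iInter fun hy =>
          isClosed_iInter fun _ => ?_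
        have h1 := hu x hx
        have h2 := hu y hy
        exact isClosed_le (by fun_prop) (by fun_prop)
      · refine isClosed_iInter fun x => isClosed_iInter fun hx => isClosed_iInter fun y => isClosed_iInter fun hy =>
          isClosed_iInter fun a => isClosed_iInter fun b => isClosed_iInter fun ha => isClosed_iInter fun hb =>
          isClosed_iInter fun hab => ?_
        have h1 := hu x hx
        have h2 := hu y hy
        have h3 := hu (a * x + b * y) (by simpa using (convex_Icc S.L S.R) hx hy ha hb hab)
        exact isClosed_le (by fun_prop) (by fun_prop)
  have hcov : ⋃ n, F n = univ := by
    rw [eq_univ_iff_forall]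
    intro t
    obtain ⟨n, hn, hSB⟩ := S.SB_exists t.2.1
    obtain ⟨k, hk⟩ := exists_nat_ge n
    exact mem_iUnion.2 ⟨k, S.Gc_of_SB t.2.1 k.cast_nonneg (hSB.mono hk)⟩
  obtain ⟨n, ⟨t0, ht0⟩⟩ := nonempty_interior_of_iUnion_of_closed hclosed hcov
  rw [mem_interior_iff_mem_nhds, mem_nhds_subtype] at ht0
  obtain ⟨U, hU, hUF⟩ := ht0
  have hU2 : U ∩ Ioo S.T1 S.T2 ∈ 𝓝 (t0 : ℝ) := inter_mem hU (Ioo_mem_nhds t0.2.1.1 t0.2.1.2)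
  obtain ⟨α, β, hαβ, hsub⟩ := mem_nhds_iff_exists_Ioo_subset.1 hU2
  have hT : ∀ t ∈ Ioo α β, t ∈ Ioo S.T1 S.T2 := fun t ht => (hsub ht).2
  have hne : α < β := hαβ.1.trans hαβ.2
  have h1 : S.T1 ≤ α := by
    by_contra h
    push Not at h
    have := (hT ((α + min S.T1 β) / 2) ⟨by have := lt_min h hne; linarith, by have := min_le_right S.T1 β; linarith⟩).1
    have := min_le_left S.T1 β
    linarith
  have h2 : β ≤ S.T2 := by
    by_contra h
    push Not at h
    have := (hT ((β + max S.T2 α) / 2) ⟨by have := le_max_right S.T2 α; linarith, by have := max_lt h hne; linarith⟩).2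
    have := le_max_left S.T2 α
    linarith
  refine t0.2.2 (S.crossing (n := 2 * n) h1 h2 (by positivity) (fun t ht => ?_) t0 hαβ)
  by_cases hg : S.Good t
  · exact Or.inl hg
  · right
    exact S.SB_of_Gc (hT t ht) n.cast_nonneg (hUF (show (⟨t, hT t ht, hg⟩ : Z) ∈ Subtype.val ⁻¹' U from (hsub ht).1))
end Sys

structure App where
  (VF VE gL gin a σ : ℝ)
  (p : ℝ → ℝ → ℝ)
  hVF : 0 < VF
  hVE : VF < VE
  hgL : 0 < gL
  hgin : 0 < gin
  ha : 0 < a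
  hσ : 0 < σ
  hp : StatSol VF VE gL gin a σ p
  hint1 : ∫⁻ x in (Ioo (0:ℝ) VF) ×ˢ (Ioi (0:ℝ)),
        ENNReal.ofReal ((Jflux VE gL x.1 x.2) ^ 2 * p x.1 x.2) < ⊤
  hint2 : ∫⁻ x in (Ioo (0:ℝ) VF) ×ˢ (Ioi (0:ℝ)),
        ENNReal.ofReal ((x.2 + gL) * |Jflux VE gL x.1 x.2| * p x.1 x.2) < ⊤
  hint3 : ∫⁻ x in (Ioo (0:ℝ) VF) ×ˢ (Ioi (0:ℝ)),
        ENNReal.ofReal (|x.2 - gin| * p x.1 x.2 + a * |deriv (fun g => p x.1 g) x.2|) < ⊤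

namespace App
variable (P : App)

def J (v g : ℝ) : ℝ := Jflux P.VE P.gL v g
def pg (v g : ℝ) : ℝ := deriv (P.p v) g
def pgg (v g : ℝ) : ℝ := deriv (deriv (P.p v)) g
def pv (v g : ℝ) : ℝ := deriv (fun v' => P.p v' g) v

theorem J_eq (v g : ℝ) : P.J v g = g * (P.VE - v) - P.gL * v := by
  unfold J Jflux; ring

theorem p_nonneg {v g : ℝ} (hv : v ∈ Ioo 0 P.VF) (hg : 0 ≤ g) : 0 ≤ P.p v g :=
  P.hp.nonneg v hv g hg

theorem slice {v L R : ℝ} (hv : v ∈ Ioo 0 P.VF) (hL : 0 < L) :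
    C2On (P.p v) (P.pg v) (P.pgg v) L R := by
  have h := (P.hp.smooth_g v hv).mono (Ioi_subset_Ici_self)
  have h2 : ContDiffOn ℝ (1 + 1) (P.p v) (Ioi 0) := by
    have : (1 + 1 : WithTop ℕ∞) = 2 := by norm_num
    rw [this]; exact h
  rw [contDiffOn_succ_iff_deriv_of_isOpen isOpen_Ioi] at h2
  have h3 : ContDiffOn ℝ (0 + 1) (deriv (P.p v)) (Ioi 0) := by
    simpa using h2.2.2
  rw [contDiffOn_succ_iff_deriv_of_isOpen isOpen_Ioi] at h3
  have hm : ∀ x ∈ Icc L R, x ∈ Ioi (0:ℝ) := fun x hx => hL.trans_le hx.1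
  refine ⟨fun x hx => ?_, fun x hx => ?_, ?_⟩
  · exact ((h2.1 x (hm x hx)).differentiableAt (isOpen_Ioi.mem_nhds (hm x hx))).hasDerivAt
  · exact ((h3.1 x (hm x hx)).differentiableAt (isOpen_Ioi.mem_nhds (hm x hx))).hasDerivAt
  · exact (h3.2.2.continuousOn).mono hm

theorem p_cont {v : ℝ} (hv : v ∈ Ioo 0 P.VF) : ContinuousOn (P.p v) (Ici 0) :=
  (P.hp.smooth_g v hv).continuousOn

theorem pg_cont {v : ℝ} (hv : v ∈ Ioo 0 P.VF) : ContinuousOn (P.pg v) (Ioi 0) := by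
  intro x hx
  have hx : 0 < x := hx
  exact ((P.slice (L := x / 2) (R := x) hv (by linarith)).d2 x ⟨by linarith, le_rfl⟩).continuousAt.continuousWithinAt

theorem pde' {v g : ℝ} (hv : v ∈ Ioo 0 P.VF) (hg : 0 < g) :
    -(P.gL + g) * P.p v g + P.J v g * P.pv v g
      = P.a / P.σ * P.pgg v g + (-P.gin / P.σ + 1 / P.σ * g) * P.pg v g + 1 / P.σ * P.p v g := by
  have h := P.hp.pde v hv g hg
  have e1 : HasDerivAt (fun v' => Jflux P.VE P.gL v' g * P.p v' g)
      ((-P.gL - g) * P.p v g + P.J v g * P.pv v g) v := by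
    have d1 : HasDerivAt (fun v' => Jflux P.VE P.gL v' g) (-P.gL - g) v := by
      unfold Jflux
      have := ((hasDerivAt_id v).const_mul (-P.gL)).add (((hasDerivAt_id v).const_sub P.VE).const_mul g)
      refine this.congr_deriv ?_
      ring
    exact d1.mul (P.hp.diff_v v hv g hg).hasDerivAt
  have e2 : HasDerivAt (fun g' => ((P.gin - g') / P.σ) * P.p v g')
      ((-1 / P.σ) * P.p v g + (P.gin - g) / P.σ * P.pg v g) g := by
    have d1 : HasDerivAt (fun g' => (P.gin - g') / P.σ) (-1 / P.σ) g :=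
      ((hasDerivAt_id g).const_sub P.gin).div_const P.σ
    exact d1.mul ((P.slice (L := g) (R := g) hv hg).d1 g ⟨le_rfl, le_rfl⟩)
  rw [e1.deriv, e2.deriv] at h
  have h' : ((-P.gL - g) * P.p v g + P.J v g * P.pv v g) + ((-1 / P.σ) * P.p v g + (P.gin - g) / P.σ * P.pg v g) - P.a / P.σ * P.pgg v g = 0 := h
  have hs := P.hσ.ne'
  field_simp at h' ⊢
  linarith

def CC (R : ℝ) : ℝ := R * P.VE + (P.VF + 1) * (P.gL + R) + (R + P.gin + 1 + P.a) / P.σ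

/-- signed flux in the time variable `t = s v` -/
def js (s t x : ℝ) : ℝ := s * x * P.VE + t * (-(P.gL + x))

theorem js_eq {s : ℝ} (hs : s * s = 1) (v x : ℝ) : P.js s (s * v) x = s * P.J v x := by
  rw [J_eq]; unfold js
  ring

theorem p_bdd {x : ℝ} (hx : 0 ≤ x) : ∃ B, ∀ v ∈ Ioo 0 P.VF, P.p v x ≤ B := by
  obtain ⟨C, hC⟩ := (isCompact_Icc.image_of_continuousOn (P.hp.cont_v x hx)).bddAbove
  exact ⟨C, fun v hv => hC ⟨v, Ioo_subset_Icc_self hv, rfl⟩⟩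

/-- local system -/
def sys (s : ℝ) (hs : s * s = 1) (c d L R jm : ℝ) (hcd : c < d) (hL : 0 < L) (hLR : L < R)
    (hjm : 0 < jm) (hw : ∀ t ∈ Ioo c d, s * t ∈ Ioo 0 P.VF)
    (hj : ∀ t ∈ Ioo c d, ∀ x ∈ Icc L R, jm ≤ P.js s t x)
    (hsm : 40 * P.CC R * (d - c) ≤ jm) : Sys where
  A := P.a / P.σ
  b0 := -P.gin / P.σ
  b1 := 1 / P.σ
  jm := jm
  Cc := P.CC R
  T1 := c
  T2 := d
  L := L
  R := R
  j0 := fun x => s * x * P.VE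
  j1 := fun x => -(P.gL + x)
  u := fun t x => P.p (s * t) x
  ut := fun t x => s * P.pv (s * t) x
  ux := fun t x => P.pg (s * t) x
  uxx := fun t x => P.pgg (s * t) x
  hA := div_pos P.ha P.hσ
  hjm := hjm
  hT := hcd
  hLR := hLR
  cj0 := by fun_prop
  cj1 := by fun_prop
  u_nonneg := fun t ht x hx => P.p_nonneg (hw t ht) (hL.le.trans hx.1)
  c2 := fun t ht => P.slice (hw t ht) hL
  dt := fun t ht x hx => by
    have h1 := (P.hp.diff_v (s * t) (hw t ht) x (hL.trans_le hx.1)).hasDerivAt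
    have h2 : HasDerivAt (fun t => s * t) s t := by simpa using (hasDerivAt_id t).const_mul s
    refine (HasDerivAt.comp t h1 h2).congr_deriv ?_
    unfold pv; ring
  pde := fun t ht x hx => by
    have h := P.pde' (hw t ht) (hL.trans_le hx.1)
    have e := P.js_eq hs (s * t) x
    rw [← mul_assoc, hs, one_mul] at e
    have : s * x * P.VE + t * -(P.gL + x) = s * P.J (s * t) x := e
    rw [this, ← h]
    linear_combination (P.J (s*t) x * P.pv (s*t) x) * hs
  j_lb := hj
  j_ub := fun t ht x hx => by
    have h1 := hw t ht
    have hx0 : 0 < x := hL.trans_le hx.1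
    have hR : 0 < R := hL.trans hLR
    have hVE : 0 < P.VE := P.hVF.trans P.hVE
    have hs2 : |s| = 1 := by
      have : |s| * |s| = 1 := by rw [← abs_mul, hs, abs_one]
      nlinarith [abs_nonneg s]
    have hst : |t| ≤ P.VF := by
      have : |s * t| ≤ P.VF := by rw [abs_of_pos h1.1]; exact h1.2.le
      rwa [abs_mul, hs2, one_mul] at this
    have a1 : s * x * P.VE ≤ R * P.VE := by
      have : s ≤ 1 := (le_abs_self s).trans hs2.le
      have : s * x ≤ R := by nlinarith [hx.2]
      exact mul_le_mul_of_nonneg_right this hVE.le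
    have a2 : t * -(P.gL + x) ≤ P.VF * (P.gL + R) := by
      have : -t ≤ P.VF := (neg_le_abs t).trans hst
      have := P.hgL
      nlinarith [hx.2, P.hVF]
    have a3 : 0 ≤ (R + P.gin + 1 + P.a) / P.σ :=
      div_nonneg (by linarith [P.hgin, P.ha]) P.hσ.le
    unfold CC
    nlinarith [P.hgL]
  hj1 := fun x hx => by
    have hx0 : 0 < x := hL.trans_le hx.1
    have hR : 0 < R := hL.trans hLR
    have hVE : 0 < P.VE := P.hVF.trans P.hVE
    rw [abs_neg, abs_of_pos (by linarith [P.hgL])]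
    have a3 : 0 ≤ (R + P.gin + 1 + P.a) / P.σ :=
      div_nonneg (by linarith [P.hgin, P.ha]) P.hσ.le
    have a4 : 0 ≤ R * P.VE := by positivity
    have a5 : 0 ≤ P.VF * (P.gL + R) := mul_nonneg P.hVF.le (by linarith [P.hgL])
    unfold CC
    nlinarith [P.hgL, hx.2]
  hb := fun x hx => by
    have hx0 : 0 < x := hL.trans_le hx.1
    have hR : 0 < R := hL.trans hLR
    have hVE : 0 < P.VE := P.hVF.trans P.hVE
    have e : -P.gin / P.σ + 1 / P.σ * x = (x - P.gin) / P.σ := by ring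
    rw [e, abs_div, abs_of_pos P.hσ]
    have a3 : |x - P.gin| / P.σ ≤ (R + P.gin + 1 + P.a) / P.σ := by
      apply div_le_div_of_nonneg_right _ P.hσ.le
      rw [abs_le]; constructor <;> linarith [hx.2, P.hgin, P.ha]
    have a4 : 0 ≤ R * P.VE := by positivity
    have a5 : 0 ≤ (P.VF + 1) * (P.gL + R) := mul_nonneg (by linarith [P.hVF]) (by linarith [P.hgL])
    unfold CC
    linarith
  hb1 := by
    have hR : 0 < R := hL.trans hLR
    have hVE : 0 < P.VE := P.hVF.trans P.hVE
    rw [abs_of_pos (div_pos one_pos P.hσ)]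
    have a3 : 1 / P.σ ≤ (R + P.gin + 1 + P.a) / P.σ := by
      apply div_le_div_of_nonneg_right _ P.hσ.le
      linarith [P.hgin, P.ha]
    have a4 : 0 ≤ R * P.VE := by positivity
    have a5 : 0 ≤ (P.VF + 1) * (P.gL + R) := mul_nonneg (by linarith [P.hVF]) (by linarith [P.hgL])
    unfold CC
    linarith
  hAC := by
    have hR : 0 < R := hL.trans hLR
    have hVE : 0 < P.VE := P.hVF.trans P.hVE
    have a3 : P.a / P.σ ≤ (R + P.gin + 1 + P.a) / P.σ := by
      apply div_le_div_of_nonneg_right _ P.hσ.le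
      linarith [P.hgin, P.ha]
    have a4 : 0 ≤ R * P.VE := by positivity
    have a5 : 0 ≤ (P.VF + 1) * (P.gL + R) := mul_nonneg (by linarith [P.hVF]) (by linarith [P.hgL])
    unfold CC
    linarith
  lat := fun x hx => by
    obtain ⟨B, hB⟩ := P.p_bdd (hL.le.trans hx.1)
    exact ⟨B, fun t ht => hB _ (hw t ht)⟩
  small := hsm

theorem CC_pos {R : ℝ} (hR : 0 < R) : 0 < P.CC R := by
  have hVE : 0 < P.VE := P.hVF.trans P.hVE
  have := P.hVF; have := P.hgL; have := P.hgin; have := P.ha; have := P.hσ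
  unfold CC; positivity

end App

namespace App
variable (P : App)

def Rs (v x : ℝ) : ℝ := P.a / P.σ * P.pgg v x + (-P.gin / P.σ + 1 / P.σ * x) * P.pg v x + 1 / P.σ * P.p v x

theorem abs_s {s : ℝ} (hs : s * s = 1) : |s| = 1 := by
  have : |s| * |s| = 1 := by rw [← abs_mul, hs, abs_one]
  nlinarith [abs_nonneg s]

structure SysFor (s τ l r : ℝ) (S : Sys) : Prop where
  good : S.Good τ
  hl : S.L < l
  hr : r < S.R
  jeq : S.j = P.js s
  j1eq : S.j1 = fun x => -(P.gL + x)
  ueq : S.u = fun t x => P.p (s * t) x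
  Rreq : S.Rr = fun t x => P.Rs (s * t) x
  Aeq : S.A = P.a / P.σ
  beq : S.b = fun x => -P.gin / P.σ + 1 / P.σ * x
  b1eq : S.b1 = 1 / P.σ

theorem exists_sys {s : ℝ} (hs : s * s = 1) {τ : ℝ} (hτ : s * τ ∈ Ioo 0 P.VF) {l r κ : ℝ} (hl : 0 < l)
    (hlr : l ≤ r) (hκ : 0 < κ) (hj : ∀ x ∈ Icc l r, κ ≤ P.js s τ x) :
    ∃ S : Sys, P.SysFor s τ l r S := by
  have hVE : 0 < P.VE := P.hVF.trans P.hVE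
  have hgL := P.hgL
  have hs1 := abs_s hs
  have hτ1 : |τ| ≤ P.VF := by
    have : |s * τ| ≤ P.VF := by rw [abs_of_pos hτ.1]; exact hτ.2.le
    rwa [abs_mul, hs1, one_mul] at this
  -- space enlargement
  set K := P.VE + P.VF with hK
  have hK0 : 0 < K := by linarith [P.hVF]
  set d := min (min (l/2) 1) (κ / (4 * K)) with hd
  have hd0 : 0 < d := lt_min (lt_min (by linarith) one_pos) (by positivity)
  have hd1 : d ≤ l / 2 := (min_le_left _ _).trans (min_le_left _ _)
  have hd2 : d ≤ 1 := (min_le_left _ _).trans (min_le_right _ _)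
  have hd3 : d * K ≤ κ / 4 := by
    have : d ≤ κ / (4 * K) := min_le_right _ _
    calc d * K ≤ κ / (4 * K) * K := mul_le_mul_of_nonneg_right this hK0.le
      _ = κ / 4 := by field_simp
  have hj2 : ∀ x ∈ Icc (l - d) (r + d), 3 * κ / 4 ≤ P.js s τ x := by
    intro x hx
    set y := max l (min x r) with hy
    have hym : y ∈ Icc l r := ⟨le_max_left _ _, max_le hlr (min_le_right _ _)⟩
    have hxy : |x - y| ≤ d := by
      rw [abs_le, hy]
      rcases le_total x r with h | h <;> rcases le_total l x with h' | h'
      · rw [min_eq_left h, max_eq_right h']; constructor <;> linarith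
      · rw [min_eq_left h, max_eq_left h']; constructor <;> linarith [hx.1]
      · rw [min_eq_right h, max_eq_right hlr]; constructor <;> linarith [hx.2]
      · rw [min_eq_right h, max_eq_right hlr]; constructor <;> linarith [hx.2]
    have h1 := hj y hym
    have h2 : P.js s τ y - P.js s τ x = (y - x) * (s * P.VE - τ) := by unfold js; ring
    have h3 : |s * P.VE - τ| ≤ K := by
      refine (abs_sub _ _).trans ?_
      rw [abs_mul, hs1, one_mul, abs_of_pos hVE]; linarith
    have h4 : (y - x) * (s * P.VE - τ) ≤ d * K := by
      refine (le_abs_self _).trans ?_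
      rw [abs_mul, abs_sub_comm]
      exact mul_le_mul hxy h3 (abs_nonneg _) hd0.le
    linarith
  -- time window
  have hr0 : 0 < r := hl.trans_le hlr
  set R := r + d with hR
  have hR0 : 0 < R := by positivity
  have hCC := P.CC_pos hR0
  set M := P.gL + R with hM
  have hM0 : 0 < M := by positivity
  set w := min (min (s * τ) (P.VF - s * τ)) (min (κ / (4 * M)) (κ / (160 * P.CC R))) with hw
  have hw0 : 0 < w := lt_min (lt_min hτ.1 (by linarith [hτ.2])) (lt_min (by positivity) (by positivity))
  have hw1 : w ≤ s * τ := (min_le_left _ _).trans (min_le_left _ _)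
  have hw2 : w ≤ P.VF - s * τ := (min_le_left _ _).trans (min_le_right _ _)
  have hw3 : w * M ≤ κ / 4 := by
    have : w ≤ κ / (4 * M) := (min_le_right _ _).trans (min_le_left _ _)
    calc w * M ≤ κ / (4 * M) * M := mul_le_mul_of_nonneg_right this hM0.le
      _ = κ / 4 := by field_simp
  have hw4 : 40 * P.CC R * ((τ + w) - (τ - w)) ≤ κ / 2 := by
    have : w ≤ κ / (160 * P.CC R) := (min_le_right _ _).trans (min_le_right _ _)
    calc 40 * P.CC R * ((τ + w) - (τ - w)) = 80 * P.CC R * w := by ring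
      _ ≤ 80 * P.CC R * (κ / (160 * P.CC R)) := mul_le_mul_of_nonneg_left this (by positivity)
      _ = κ / 2 := by field_simp; norm_num
  have hmem : ∀ t ∈ Ioo (τ - w) (τ + w), |t - τ| < w := fun t ht => by
    rw [abs_lt]; constructor <;> linarith [ht.1, ht.2]
  have hwin : ∀ t ∈ Ioo (τ - w) (τ + w), s * t ∈ Ioo 0 P.VF := by
    intro t ht
    have h1 : |s * t - s * τ| < w := by
      rw [← mul_sub, abs_mul, hs1, one_mul]; exact hmem t ht
    rw [abs_lt] at h1
    constructor <;> linarith [h1.1, h1.2]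
  have hjj : ∀ t ∈ Ioo (τ - w) (τ + w), ∀ x ∈ Icc (l - d) R, κ / 2 ≤ P.js s t x := by
    intro t ht x hx
    have h1 := hj2 x hx
    have h2 : P.js s τ x - P.js s t x = (t - τ) * (P.gL + x) := by unfold js; ring
    have h3 : (t - τ) * (P.gL + x) ≤ w * M := by
      refine (le_abs_self _).trans ?_
      rw [abs_mul]
      refine mul_le_mul (hmem t ht).le ?_ (abs_nonneg _) hw0.le
      rw [abs_of_pos (by linarith [hx.1])]
      linarith [hx.2]
    linarith
  set S := P.sys s hs (τ - w) (τ + w) (l - d) R (κ / 2) (by linarith) (by linarith) (by linarith)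
    (by linarith) hwin hjj hw4 with hS
  refine ⟨S, S.all_good τ ⟨?_, ?_⟩, ?_, ?_, rfl, rfl, rfl, rfl, rfl, rfl, rfl⟩
  · show τ - w < τ; linarith
  · show τ < τ + w; linarith
  · show l - d < l; linarith
  · show r < R; linarith

theorem localize {s : ℝ} (hs : s * s = 1) {τ : ℝ} (hτ : s * τ ∈ Ioo 0 P.VF) {ρ G κ : ℝ} (hρ : 0 < ρ)
    (hρG : ρ < G) (hκ : 0 < κ) :
    (∀ x ∈ Icc ρ G, P.js s τ x ≤ κ) ∨
    ∃ l r, ρ ≤ l ∧ l < r ∧ r ≤ G ∧ (l = ρ ∨ P.js s τ l = κ) ∧ (r = G ∨ P.js s τ r = κ) ∧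
      (∀ x ∈ Icc ρ G, (x < l ∨ r < x) → P.js s τ x ≤ κ) ∧ ∃ S : Sys, P.SysFor s τ l r S := by
  have hs1 := abs_s hs
  set α := s * P.VE - τ with hα
  set β := - τ * P.gL with hβ
  have hjs : ∀ x, P.js s τ x = α * x + β := fun x => by unfold js; ring
  have hα0 : s * α > 0 := by
    have : s * α = P.VE - s * τ := by rw [hα]; linear_combination P.VE * hs
    rw [this]; linarith [hτ.2, P.hVE]
  have hα1 : α ≠ 0 := fun h => by rw [h] at hα0; simp at hα0
  set x0 := (κ - β) / α with hx0
  have hx0' : α * x0 + β = κ := by rw [hx0]; field_simp; ring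
  rcases lt_or_gt_of_ne hα1 with hn | hpz
  · -- decreasing
    by_cases hc : x0 ≤ ρ
    · left
      intro x hx
      rw [hjs]; nlinarith [hx.1]
    push Not at hc
    right
    have hmin : ∀ x ∈ Icc ρ (min G x0), κ ≤ P.js s τ x := by
      intro x hx
      have := hx.2.trans (min_le_right _ _)
      rw [hjs]; nlinarith
    refine ⟨ρ, min G x0, le_rfl, lt_min hρG hc, min_le_left _ _, Or.inl rfl, ?_, ?_,
      P.exists_sys hs hτ hρ (le_min hρG.le hc.le) hκ hmin⟩
    · rcases le_total G x0 with h | h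
      · left; exact min_eq_left h
      · right; rw [min_eq_right h, hjs, hx0']
    · intro x hx h
      rcases h with h | h
      · exact absurd hx.1 (not_le.2 h)
      · rcases min_lt_iff.1 h with h | h
        · exact absurd hx.2 (not_le.2 h)
        · rw [hjs]; nlinarith
  · by_cases hc : G ≤ x0
    · left
      intro x hx
      rw [hjs]; nlinarith [hx.2]
    push Not at hc
    right
    have hmin : ∀ x ∈ Icc (max ρ x0) G, κ ≤ P.js s τ x := by
      intro x hx
      have := (le_max_right _ _).trans hx.1
      rw [hjs]; nlinarith
    refine ⟨max ρ x0, G, le_max_left _ _, max_lt hρG hc, le_rfl, ?_, Or.inl rfl, ?_,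
      P.exists_sys hs hτ (hρ.trans_le (le_max_left _ _)) (max_le hρG.le hc.le) hκ hmin⟩
    · rcases le_total ρ x0 with h | h
      · right; rw [max_eq_right h, hjs, hx0']
      · left; exact max_eq_left h
    · intro x hx h
      rcases h with h | h
      · rcases lt_max_iff.1 h with h | h
        · exact absurd hx.1 (not_le.2 h)
        · rw [hjs]; nlinarith
      · exact absurd hx.2 (not_le.2 h)

end App

/-! threshold function -/
def th (ε y : ℝ) : ℝ := (max (y-ε) 0)^3/(max (y-ε) 0+ε)^2
def th1 (ε y : ℝ) : ℝ := (max (y-ε) 0)^2*(max (y-ε) 0+3*ε)/(max (y-ε) 0+ε)^3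
def th2 (ε y : ℝ) : ℝ := 6*ε^2*(max (y-ε) 0)/(max (y-ε) 0+ε)^4

theorem th_d1 {ε : ℝ} (hε : 0 < ε) (y : ℝ) : HasDerivAt (th ε) (th1 ε y) y := by
  have key := hasDerivAt_comp_max (F := fun m => m^3/(m+ε)^2)
      (F' := fun m => m^2*(m+3*ε)/(m+ε)^3) (fun m hm => by
    have hm' : (m + ε) ≠ 0 := by positivity
    have h1 : HasDerivAt (fun m : ℝ => m + ε) 1 m := (hasDerivAt_id m).add_const ε
    refine HasDerivAt.congr_deriv ((hasDerivAt_pow 3 m).div (h1.pow 2) (pow_ne_zero _ hm')) ?_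
    simp only [Pi.pow_apply, Pi.mul_apply, Nat.cast_ofNat]
    field_simp
    ring) (by norm_num) (by norm_num) (y - ε)
  have h2 : HasDerivAt (fun y : ℝ => y - ε) 1 y := (hasDerivAt_id y).sub_const ε
  exact (HasDerivAt.comp y key h2).congr_deriv (by rw [mul_one])

theorem th_d2 {ε : ℝ} (hε : 0 < ε) (y : ℝ) : HasDerivAt (th1 ε) (th2 ε y) y := by
  have key := hasDerivAt_comp_max (F := fun m => m^2*(m+3*ε)/(m+ε)^3)
      (F' := fun m => 6*ε^2*m/(m+ε)^4) (fun m hm => by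
    have hm' : (m + ε) ≠ 0 := by positivity
    have h1 : HasDerivAt (fun m : ℝ => m + ε) 1 m := (hasDerivAt_id m).add_const ε
    have h3 : HasDerivAt (fun m : ℝ => m + 3 * ε) 1 m := (hasDerivAt_id m).add_const (3 * ε)
    refine HasDerivAt.congr_deriv (((hasDerivAt_pow 2 m).mul h3).div (h1.pow 3) (pow_ne_zero _ hm')) ?_
    simp only [Pi.pow_apply, Pi.mul_apply, Nat.cast_ofNat]
    field_simp
    ring) (by norm_num) (by norm_num) (y - ε)
  have h2 : HasDerivAt (fun y : ℝ => y - ε) 1 y := (hasDerivAt_id y).sub_const ε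
  exact (HasDerivAt.comp y key h2).congr_deriv (by rw [mul_one])

theorem th2_cont {ε : ℝ} (hε : 0 < ε) : Continuous (th2 ε) := by
  have : Continuous (fun y : ℝ => max (y-ε) 0) := by fun_prop
  refine Continuous.div (by fun_prop) (by fun_prop) ?_
  intro y
  have : 0 ≤ max (y-ε) 0 := le_max_right _ _
  positivity

theorem th_nonneg {ε : ℝ} (hε : 0 < ε) (y : ℝ) : 0 ≤ th ε y := by
  have : 0 ≤ max (y-ε) 0 := le_max_right _ _
  unfold th; positivity
theorem th1_nonneg {ε : ℝ} (hε : 0 < ε) (y : ℝ) : 0 ≤ th1 ε y := by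
  have : 0 ≤ max (y-ε) 0 := le_max_right _ _
  unfold th1; positivity
theorem th1_le {ε : ℝ} (hε : 0 < ε) (y : ℝ) : th1 ε y ≤ 1 := by
  have : 0 ≤ max (y-ε) 0 := le_max_right _ _
  unfold th1
  rw [div_le_one (by positivity)]
  have h1 : 0 ≤ max (y-ε) 0 * ε^2 := by positivity
  have h2 : 0 ≤ ε^3 := by positivity
  nlinarith
theorem th_zero {ε y : ℝ} (h : y ≤ ε) : th ε y = 0 := by
  unfold th; rw [max_eq_right (by linarith)]; simp
theorem th1_zero {ε y : ℝ} (h : y ≤ ε) : th1 ε y = 0 := by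
  unfold th1; rw [max_eq_right (by linarith)]; simp
theorem th_le {ε : ℝ} (hε : 0 < ε) (y : ℝ) : th ε y ≤ max y 0 := by
  rcases le_total y ε with h | h
  · rw [th_zero h]; exact le_max_right _ _
  · unfold th; rw [max_eq_left (by linarith), max_eq_left (by linarith)]
    have : y - ε + ε = y := by ring
    rw [this]
    have hy : 0 < y := by linarith
    rw [div_le_iff₀ (by positivity)]
    have : (y-ε)^3 ≤ y^3 := pow_le_pow_left₀ (by linarith) (by linarith) 3
    linarith [this, (by ring : y * y^2 = y^3)]
theorem th_le_abs {ε : ℝ} (hε : 0 < ε) (y : ℝ) : th ε y ≤ |y| :=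
  (th_le hε y).trans (max_le (le_abs_self _) (abs_nonneg _))
theorem th_cont {ε : ℝ} (hε : 0 < ε) : Continuous (th ε) :=
  continuous_iff_continuousAt.2 fun y => (th_d1 hε y).continuousAt
theorem th1_cont {ε : ℝ} (hε : 0 < ε) : Continuous (th1 ε) :=
  continuous_iff_continuousAt.2 fun y => (th_d2 hε y).continuousAt
theorem th_lip {ε : ℝ} (hε : 0 < ε) (x y : ℝ) : |th ε x - th ε y| ≤ |x - y| := by
  have := Convex.norm_image_sub_le_of_norm_hasDerivWithin_le (s := univ) (C := 1) (f := th ε)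
    (f' := th1 ε) (x := y) (y := x) (fun z _ => (th_d1 hε z).hasDerivWithinAt) (fun z _ => by
      rw [Real.norm_eq_abs, abs_of_nonneg (th1_nonneg hε z)]; exact th1_le hε z) convex_univ
      (mem_univ _) (mem_univ _)
  simpa using this
theorem th_tendsto {e : ℕ → ℝ} (he : ∀ n, 0 < e n) (hl : Tendsto e atTop (𝓝 0)) (y : ℝ) :
    Tendsto (fun n => th (e n) y) atTop (𝓝 (max y 0)) := by
  rcases le_or_gt y 0 with h | h
  · rw [max_eq_right h]
    refine tendsto_const_nhds.congr fun n => ?_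
    rw [th_zero (h.trans (he n).le)]
  · have h1 : Tendsto (fun n => max (y - e n) 0) atTop (𝓝 (max (y - 0) 0)) :=
      (tendsto_const_nhds.sub hl).max tendsto_const_nhds
    have h2 := (h1.pow 3).div ((h1.add hl).pow 2) (by
      rw [sub_zero, max_eq_left h.le]; positivity)
    rw [sub_zero, max_eq_left h.le] at h2
    rw [max_eq_left h.le]
    have h3 : y^3/(y+0)^2 = y := by field_simp; ring
    rw [h3] at h2
    exact h2

theorem int_restrict {f : ℝ → ℝ} {ρ l r G : ℝ} (h1 : ρ ≤ l) (h2 : l ≤ r) (h3 : r ≤ G)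
    (hf : ∀ x ∈ Icc ρ G, (x < l ∨ r < x) → f x = 0) : ∫ x in ρ..G, f x = ∫ x in l..r, f x := by
  rw [intervalIntegral.integral_of_le (h1.trans (h2.trans h3)), intervalIntegral.integral_of_le h2,
    ← integral_Icc_eq_integral_Ioc, ← integral_Icc_eq_integral_Ioc]
  refine setIntegral_eq_of_subset_of_forall_diff_eq_zero measurableSet_Icc (Icc_subset_Icc h1 h3) ?_
  intro x hx
  refine hf x hx.1 ?_
  by_contra h
  push Not at h
  exact hx.2 ⟨h.1, h.2⟩

namespace App
variable (P : App)

def Wt (s ε : ℝ) (ζ : ℝ → ℝ) (t x : ℝ) : ℝ := th ε (P.js s t x) * ζ x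

def Yf (s ε : ℝ) (ζ : ℝ → ℝ) (E : KEta) (e k ρ G t : ℝ) : ℝ :=
  ∫ x in ρ..G, P.Wt s ε ζ t x * P.js s t x * E.f (e * (P.p (s * t) x - k))

def Sl0 (s ε : ℝ) (ζ : ℝ → ℝ) (E : KEta) (e k ρ G t : ℝ) : ℝ :=
  ∫ x in ρ..G, ((th1 ε (P.js s t x) * (-(P.gL + x)) * ζ x * P.js s t x + P.Wt s ε ζ t x * (-(P.gL + x))) *
      E.f (e * (P.p (s * t) x - k))
    + e * (P.Wt s ε ζ t x * E.f1 (e * (P.p (s * t) x - k)) *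
        (P.Rs (s * t) x - (-(P.gL + x)) * P.p (s * t) x)))

theorem js_dt (s t x : ℝ) : HasDerivAt (fun t => P.js s t x) (-(P.gL + x)) t := by
  unfold js
  simpa using ((hasDerivAt_id t).mul_const (-(P.gL + x))).const_add (s * x * P.VE)
theorem js_dx (s t x : ℝ) : HasDerivAt (fun x => P.js s t x) (s * P.VE - t) x := by
  have : (fun x => P.js s t x) = fun x => x * (s * P.VE - t) + (- t * P.gL) := by
    funext x; unfold js; ring
  rw [this]
  simpa using ((hasDerivAt_id x).mul_const (s * P.VE - t)).add_const (-t * P.gL)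

theorem js_c2 (s t l r : ℝ) : C2On (P.js s t) (fun _ => s * P.VE - t) (fun _ => 0) l r :=
  ⟨fun x _ => P.js_dx s t x, fun x _ => hasDerivAt_const _ _, continuousOn_const⟩

theorem js_near (s τ : ℝ) {ε G : ℝ} (hε : 0 < ε) (hG : 0 < G) :
    ∀ᶠ t in 𝓝 τ, ∀ x ∈ Icc 0 G, P.js s τ x ≤ ε / 2 → P.js s t x ≤ ε := by
  have hM : 0 < P.gL + G := by linarith [P.hgL]
  have : ∀ᶠ t in 𝓝 τ, |t - τ| < ε / (2 * (P.gL + G)) := by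
    have := Metric.ball_mem_nhds τ (ε := ε / (2 * (P.gL + G))) (by positivity)
    filter_upwards [this] with t ht
    simpa [Real.dist_eq] using ht
  filter_upwards [this] with t ht x hx hj
  have h2 : P.js s t x - P.js s τ x = - (t - τ) * (P.gL + x) := by unfold js; ring
  have h3 : - (t - τ) * (P.gL + x) ≤ ε / (2 * (P.gL + G)) * (P.gL + G) := by
    refine (le_abs_self _).trans ?_
    rw [abs_mul, abs_neg]
    refine mul_le_mul ht.le ?_ (abs_nonneg _) (by positivity)
    rw [abs_of_pos (by linarith [hx.1, P.hgL])]
    linarith [hx.2]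
  have h4 : ε / (2 * (P.gL + G)) * (P.gL + G) = ε / 2 := by field_simp
  linarith

theorem Wt_c2 (s : ℝ) {ε : ℝ} (hε : 0 < ε) {ζ ζ1 ζ2 : ℝ → ℝ} {ρ G : ℝ} (hζ : C2On ζ ζ1 ζ2 ρ G) (t : ℝ) :
    C2On (P.Wt s ε ζ t)
      (fun x => th1 ε (P.js s t x) * (s * P.VE - t) * ζ x + th ε (P.js s t x) * ζ1 x)
      (fun x => (th2 ε (P.js s t x) * (s * P.VE - t)^2 + th1 ε (P.js s t x) * 0) * ζ x
        + 2 * (th1 ε (P.js s t x) * (s * P.VE - t) * ζ1 x) + th ε (P.js s t x) * ζ2 x) ρ G := by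
  have h := (P.js_c2 s t ρ G).comp (F := th ε) (F1 := th1 ε) (F2 := th2 ε) (fun x _ => th_d1 hε _)
    (fun x _ => th_d2 hε _) ((th2_cont hε).comp_continuousOn (P.js_c2 s t ρ G).cw)
  exact h.mul hζ

set_option maxHeartbeats 1000000 in
theorem stepY {s : ℝ} (hs : s * s = 1) {τ : ℝ} (hτ : s * τ ∈ Ioo 0 P.VF) {ε ρ G : ℝ} (hε : 0 < ε) (hρ : 0 < ρ)
    (hρG : ρ < G) {ζ ζ1 ζ2 : ℝ → ℝ} (hζ : C2On ζ ζ1 ζ2 ρ G) (hζ0 : ∀ x ∈ Icc ρ G, 0 ≤ ζ x)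
    (hb1 : P.Wt s ε ζ τ ρ = 0) (hb2 : P.Wt s ε ζ τ G = 0) (E : KEta) (e k : ℝ) :
    ContinuousAt (P.Yf s ε ζ E e k ρ G) τ ∧
    ∀ ε' > 0, ∀ᶠ h in 𝓝[>] (0:ℝ), P.Yf s ε ζ E e k ρ G τ - P.Yf s ε ζ E e k ρ G (τ - h)
      ≤ (P.Sl0 s ε ζ E e k ρ G τ + ε') * h := by
  have hG : 0 < G := hρ.trans hρG
  have hnear := P.js_near s τ hε hG
  have hsub : ∀ x ∈ Icc ρ G, x ∈ Icc 0 G := fun x hx => ⟨hρ.le.trans hx.1, hx.2⟩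
  rcases P.localize hs hτ hρ hρG (half_pos hε) with hc | ⟨l, r, h1, h2, h3, hll, hrr, hout, S, hS⟩
  · have hY : P.Yf s ε ζ E e k ρ G =ᶠ[𝓝 τ] fun _ => 0 := by
      filter_upwards [hnear] with t ht
      unfold Yf
      rw [show (0:ℝ) = ∫ x in ρ..G, (0:ℝ) by simp]
      refine intervalIntegral.integral_congr fun x hx => ?_
      rw [uIcc_of_le hρG.le] at hx
      simp [Wt, th_zero (ht x (hsub x hx) (hc x hx))]
    have hsl : P.Sl0 s ε ζ E e k ρ G τ = 0 := by
      unfold Sl0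
      rw [show (0:ℝ) = ∫ x in ρ..G, (0:ℝ) by simp]
      refine intervalIntegral.integral_congr fun x hx => ?_
      rw [uIcc_of_le hρG.le] at hx
      have := hc x hx
      simp [Wt, th_zero (show P.js s τ x ≤ ε by linarith), th1_zero (show P.js s τ x ≤ ε by linarith)]
    refine ⟨continuousAt_const.congr hY.symm, fun ε' hε' => ?_⟩
    filter_upwards [(tendsto_sub_right_nhds τ).eventually hY, self_mem_nhdsWithin] with h hh h0
    have h0 : 0 < h := h0
    rw [hh, hY.self_of_nhds, hsl]
    nlinarith
  · have hlr := h2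
    have hζ' := hζ.mono h1 h3
    have hW := P.Wt_c2 s hε hζ' τ
    have hlrs : ∀ x ∈ Icc l r, x ∈ Icc ρ G := fun x hx => ⟨h1.trans hx.1, hx.2.trans h3⟩
    have hYeq : P.Yf s ε ζ E e k ρ G =ᶠ[𝓝 τ] fun t =>
        ∫ x in l..r, P.Wt s ε ζ t x * S.j t x * E.f (e * (S.u t x - (k + t * 0))) := by
      filter_upwards [hnear] with t ht
      unfold Yf
      rw [int_restrict h1 h2.le h3]
      · rw [hS.jeq, hS.ueq]; simp only [mul_zero, add_zero]
      · intro x hx ho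
        simp [Wt, th_zero (ht x (hsub x hx) (hout x hx ho))]
    have hsl : P.Sl0 s ε ζ E e k ρ G τ = ∫ x in l..r, ((th1 ε (P.js s τ x) * (-(P.gL + x)) * ζ x * S.j τ x + P.Wt s ε ζ τ x * S.j1 x) *
            E.f (e * (S.u τ x - (k + τ * 0)))
          + e * (P.Wt s ε ζ τ x * E.f1 (e * (S.u τ x - (k + τ * 0))) *
              (S.Rr τ x - S.j1 x * S.u τ x - S.j τ x * 0))) := by
      unfold Sl0
      rw [int_restrict h1 h2.le h3]
      · rw [hS.jeq, hS.ueq, hS.j1eq, hS.Rreq]; simp only [mul_zero, add_zero, sub_zero]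
      · intro x hx ho
        have := hout x hx ho
        simp [Wt, th_zero (show P.js s τ x ≤ ε by linarith), th1_zero (show P.js s τ x ≤ ε by linarith)]
    have hWcont : ∀ t, ContinuousOn (P.Wt s ε ζ t) (Icc l r) := fun t => (P.Wt_c2 s hε hζ' t).cw
    have hWdt : ∀ x, HasDerivAt (fun t => P.Wt s ε ζ t x) (th1 ε (P.js s τ x) * (-(P.gL + x)) * ζ x) τ := by
      intro x
      exact ((HasDerivAt.comp τ (th_d1 hε (P.js s τ x)) (P.js_dt s τ x))).mul_const (ζ x)
    obtain ⟨Z, hZ0, hZ⟩ := contOn_bdd hζ'.cw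
    have hL : ∀ t, ∀ x ∈ Icc l r, |P.Wt s ε ζ τ x - P.Wt s ε ζ t x| ≤ ((P.gL + G) * Z) * |τ - t| := by
      intro t x hx
      have hx0 : 0 ≤ x := (hsub x (hlrs x hx)).1
      have e1 : P.Wt s ε ζ τ x - P.Wt s ε ζ t x = (th ε (P.js s τ x) - th ε (P.js s t x)) * ζ x := by
        unfold Wt; ring
      rw [e1, abs_mul]
      have e2 : |th ε (P.js s τ x) - th ε (P.js s t x)| ≤ (P.gL + G) * |τ - t| := by
        refine (th_lip hε _ _).trans ?_
        have : P.js s τ x - P.js s t x = (-(P.gL + x)) * (τ - t) := by unfold js; ring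
        rw [this, abs_mul, abs_neg, abs_of_pos (by linarith [P.hgL])]
        refine mul_le_mul_of_nonneg_right ?_ (abs_nonneg _)
        linarith [(hlrs x hx).2]
      calc _ ≤ ((P.gL + G) * |τ - t|) * Z :=
            mul_le_mul e2 (hZ x hx) (abs_nonneg _) (mul_nonneg (by linarith [P.hgL]) (abs_nonneg _))
        _ = _ := by ring
    have hbl : P.Wt s ε ζ τ l = 0 := by
      rcases hll with h | h
      · rw [h]; exact hb1
      · unfold Wt; rw [h, th_zero (by linarith), zero_mul]
    have hbr : P.Wt s ε ζ τ r = 0 := by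
      rcases hrr with h | h
      · rw [h]; exact hb2
      · unfold Wt; rw [h, th_zero (by linarith), zero_mul]
    have hl0 := hS.hl
    have hr0 := hS.hr
    constructor
    · refine ContinuousAt.congr ?_ hYeq.symm
      refine S.Y_cont E hS.good hl0 hlr hr0 (Eventually.of_forall hWcont)
        (fun x _ => (hWdt x).continuousAt) ?_ (F0 := fun _ => k) continuousOn_const 0 e
      obtain ⟨B, hB0, hB⟩ := contOn_bdd (hWcont τ)
      refine ⟨B + ((P.gL + G) * Z) * 1, ?_⟩
      have : ∀ᶠ t in 𝓝 τ, |τ - t| < 1 := by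
        filter_upwards [Metric.ball_mem_nhds τ one_pos] with t ht
        rw [abs_sub_comm]; simpa [Real.dist_eq] using ht
      filter_upwards [this] with t ht x hx
      have a1 := hL t x hx
      have a2 := hB x hx
      have a3 : ((P.gL + G) * Z) * |τ - t| ≤ ((P.gL + G) * Z) * 1 :=
        mul_le_mul_of_nonneg_left ht.le (mul_nonneg (by linarith [P.hgL]) hZ0)
      have a4 : |P.Wt s ε ζ t x| ≤ |P.Wt s ε ζ τ x| + |P.Wt s ε ζ τ x - P.Wt s ε ζ t x| := by
        have := abs_sub (P.Wt s ε ζ τ x) (P.Wt s ε ζ τ x - P.Wt s ε ζ t x)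
        simpa using this
      linarith
    · intro ε' hε'
      have key := S.kato_slope E hS.good hl0 hlr hr0 (ψ := P.Wt s ε ζ) hW
        (fun x hx => mul_nonneg (th_nonneg hε _) (hζ0 x (hlrs x hx))) (Eventually.of_forall hWcont)
        (fun x _ => hWdt x) ⟨_, Eventually.of_forall hL⟩ (C2On.const k l r) 0 e
        (by rw [hbl, zero_mul]) (by rw [hbr, zero_mul]) ε' hε'
      filter_upwards [key, (tendsto_sub_right_nhds τ).eventually hYeq] with h hk hh
      rw [hh, hYeq.self_of_nhds, hsl]
      exact hk

end App

theorem slope_via {I F F' h : ℝ → ℝ} {ρ G C : ℝ} (hρG : ρ ≤ G) (hI : ContinuousOn I (Icc ρ G))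
    (hF : ∀ x ∈ Icc ρ G, HasDerivAt F (F' x) x) (hF' : ContinuousOn F' (Icc ρ G))
    (hh : ContinuousOn h (Icc ρ G)) (hle : ∀ x ∈ Icc ρ G, I x - F' x ≤ C * h x) :
    ∫ x in ρ..G, I x ≤ C * (∫ x in ρ..G, h x) + (F G - F ρ) := by
  have i1 := ii_of_contOn hρG hI
  have i2 := ii_of_contOn hρG hF'
  have i3 := ii_of_contOn hρG hh
  have e := intervalIntegral.integral_eq_sub_of_hasDerivAt (a := ρ) (b := G) (f := F) (f' := F')
    (fun x hx => hF x (by rwa [uIcc_of_le hρG] at hx)) i2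
  have h1 := intervalIntegral.integral_mono_on hρG (i1.sub i2) (i3.const_mul C) hle
  rw [intervalIntegral.integral_sub i1 i2, intervalIntegral.integral_const_mul, e] at h1
  linarith

namespace App
variable (P : App)

def hd (v x : ℝ) : ℝ := (x + P.gL) * |P.J v x| * P.p v x + (|x - P.gin| * P.p v x + P.a * |P.pg v x|)

theorem J_cont (v : ℝ) : Continuous (P.J v) := by unfold J Jflux; fun_prop

theorem js_abs {s : ℝ} (hs : s * s = 1) (t x : ℝ) : |P.js s t x| = |P.J (s * t) x| := by
  have e := P.js_eq hs (s * t) x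
  rw [← mul_assoc, hs, one_mul] at e
  rw [e, abs_mul, abs_s hs, one_mul]

theorem hd_cont {v ρ G : ℝ} (hv : v ∈ Ioo 0 P.VF) (hρ : 0 < ρ) : ContinuousOn (P.hd v) (Icc ρ G) := by
  have h := P.slice (R := G) hv hρ
  have hJ := (P.J_cont v).continuousOn (s := Icc ρ G)
  have c1 := h.cw
  have c2 := h.cw1
  have c3 : ContinuousOn (fun x => |P.J v x|) (Icc ρ G) := hJ.abs
  have c4 : ContinuousOn (fun x => |P.pg v x|) (Icc ρ G) := c2.abs
  unfold hd
  fun_prop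

theorem Rs_cont {v ρ G : ℝ} (hv : v ∈ Ioo 0 P.VF) (hρ : 0 < ρ) : ContinuousOn (P.Rs v) (Icc ρ G) := by
  have h := P.slice (R := G) hv hρ
  have c1 := h.cw
  have c2 := h.cw1
  have c3 := h.c
  unfold Rs
  fun_prop

theorem sve_abs {s : ℝ} (hs : s * s = 1) {t : ℝ} (ht : s * t ∈ Ioo 0 P.VF) : |s * P.VE - t| ≤ P.VE := by
  have : |s * P.VE - t| = |s * (s * P.VE - t)| := by rw [abs_mul, abs_s hs, one_mul]
  rw [this]
  have e : s * (s * P.VE - t) = P.VE - s * t := by linear_combination P.VE * hs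
  rw [e, abs_of_pos (by linarith [ht.2, P.hVE])]
  linarith [ht.1]

set_option maxHeartbeats 1000000 in
theorem slopeE1 {s : ℝ} (hs : s * s = 1) {τ : ℝ} (hτ : s * τ ∈ Ioo 0 P.VF) {ε ρ G : ℝ} (hε : 0 < ε) (hρ : 0 < ρ)
    (hρG : ρ < G) {ζ ζ1 ζ2 : ℝ → ℝ} (hζ : C2On ζ ζ1 ζ2 ρ G) {c1 : ℝ} (hζ0 : ∀ x ∈ Icc ρ G, 0 ≤ ζ x ∧ ζ x ≤ c1)
    (hζ1 : ∀ x ∈ Icc ρ G, |P.J (s * τ) x| * |ζ1 x| ≤ c1)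
    (hb1 : P.Wt s ε ζ τ ρ = 0) (hb2 : P.Wt s ε ζ τ G = 0) {e : ℝ} (he : e * e = 1) :
    P.Sl0 s ε ζ idK e 0 ρ G τ ≤ (c1 * (1 + (P.VE + 1) / P.σ)) * ∫ x in ρ..G, P.hd (s * τ) x := by
  have hw := P.slice (R := G) hτ hρ
  have hW := P.Wt_c2 s hε hζ τ
  set u := P.p (s * τ) with hu
  set u1 := P.pg (s * τ) with hu1
  set u2 := P.pgg (s * τ) with hu2
  set W := P.Wt s ε ζ τ with hWd
  set W1 : ℝ → ℝ := fun x => th1 ε (P.js s τ x) * (s * P.VE - τ) * ζ x + th ε (P.js s τ x) * ζ1 x with hW1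
  have cj := (P.js_c2 s τ ρ G).cw
  have cw := hw.cw; have cw1 := hw.cw1; have cw2 := hw.c
  have cW := hW.cw; have cW1 := hW.cw1
  have cζ := hζ.cw; have cζ1 := hζ.cw1
  have cth1 : ContinuousOn (fun x => th1 ε (P.js s τ x)) (Icc ρ G) := (th1_cont hε).comp_continuousOn cj
  have cI : ContinuousOn (fun x => ((th1 ε (P.js s τ x) * (-(P.gL + x)) * ζ x * P.js s τ x + W x * (-(P.gL + x))) *
      (e * (u x - 0))
    + e * (W x * 1 * (P.Rs (s * τ) x - (-(P.gL + x)) * u x)))) (Icc ρ G) := by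
    have cR : ContinuousOn (P.Rs (s * τ)) (Icc ρ G) := P.Rs_cont hτ hρ
    fun_prop
  have key := slope_via (C := c1 * (1 + (P.VE + 1) / P.σ)) (h := P.hd (s * τ)) hρG.le cI
    (F := fun x => e * (W x * (P.a / P.σ * u1 x + (-P.gin / P.σ + 1 / P.σ * x) * u x)))
    (F' := fun x => e * (W1 x * (P.a / P.σ * u1 x + (-P.gin / P.σ + 1 / P.σ * x) * u x)
      + W x * (P.a / P.σ * u2 x + ((1 / P.σ) * u x + (-P.gin / P.σ + 1 / P.σ * x) * u1 x))))
    ?_ ?_ (P.hd_cont hτ hρ) ?_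
  · rw [hb1, hb2] at key
    simp only [zero_mul, mul_zero, sub_zero, add_zero] at key
    refine Eq.trans_le ?_ key
    unfold Sl0
    simp [idK]
    rfl
  · intro x hx
    have db : HasDerivAt (fun x => -P.gin / P.σ + 1 / P.σ * x) (1 / P.σ) x := by
      simpa using ((hasDerivAt_id x).const_mul (1 / P.σ)).const_add (-P.gin / P.σ)
    exact ((hW.d1 x hx).mul (((hw.d2 x hx).const_mul (P.a / P.σ)).add (db.mul (hw.d1 x hx)))).const_mul e
  · fun_prop
  · intro x hx
    have hx0 : 0 < x := hρ.trans_le hx.1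
    have hgL := P.hgL
    have hσ := P.hσ
    have hVE : 0 < P.VE := P.hVF.trans P.hVE
    have hu0 : 0 ≤ u x := P.p_nonneg hτ hx0.le
    have hz := hζ0 x hx
    have hc1 : 0 ≤ c1 := hz.1.trans hz.2
    have e1 : (((th1 ε (P.js s τ x) * (-(P.gL + x)) * ζ x * P.js s τ x + W x * (-(P.gL + x))) *
      (e * (u x - 0)) + e * (W x * 1 * (P.Rs (s * τ) x - (-(P.gL + x)) * u x))))
      - e * (W1 x * (P.a / P.σ * u1 x + (-P.gin / P.σ + 1 / P.σ * x) * u x)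
      + W x * (P.a / P.σ * u2 x + ((1 / P.σ) * u x + (-P.gin / P.σ + 1 / P.σ * x) * u1 x)))
      = e * (-(th1 ε (P.js s τ x) * ζ x * ((x + P.gL) * P.js s τ x * u x))
        - W1 x * ((P.a * u1 x + (x - P.gin) * u x) / P.σ)) := by
      simp only [Rs]
      ring
    rw [e1]
    refine (le_abs_self _).trans ?_
    rw [abs_mul, abs_s he, one_mul]
    refine (abs_sub _ _).trans ?_
    have b1 : |-(th1 ε (P.js s τ x) * ζ x * ((x + P.gL) * P.js s τ x * u x))|
        ≤ c1 * ((x + P.gL) * |P.J (s * τ) x| * u x) := by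
      rw [abs_neg, abs_mul, abs_mul, abs_mul, abs_mul, P.js_abs hs, abs_of_nonneg (th1_nonneg hε _), abs_of_nonneg hz.1,
        abs_of_nonneg hu0, abs_of_pos (show 0 < x + P.gL by linarith)]
      refine mul_le_mul_of_nonneg_right ?_ (by positivity)
      have := mul_le_mul (th1_le hε (P.js s τ x)) hz.2 hz.1 zero_le_one
      linarith
    have b2 : |W1 x| ≤ c1 * (P.VE + 1) := by
      rw [hW1]
      refine (abs_add_le _ _).trans ?_
      rw [abs_mul, abs_mul, abs_mul, abs_of_nonneg (th1_nonneg hε _), abs_of_nonneg (th_nonneg hε _), abs_of_nonneg hz.1]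
      have t1 : th1 ε (P.js s τ x) * |s * P.VE - τ| ≤ 1 * P.VE :=
        mul_le_mul (th1_le hε _) (P.sve_abs hs hτ) (abs_nonneg _) zero_le_one
      have t2 : th1 ε (P.js s τ x) * |s * P.VE - τ| * ζ x ≤ (1 * P.VE) * c1 :=
        mul_le_mul t1 hz.2 hz.1 (by positivity)
      have t3 : th ε (P.js s τ x) * |ζ1 x| ≤ c1 := by
        refine le_trans ?_ (hζ1 x hx)
        rw [← P.js_abs hs]
        exact mul_le_mul_of_nonneg_right (th_le_abs hε _) (abs_nonneg _)
      linarith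
    have b3 : |(P.a * u1 x + (x - P.gin) * u x) / P.σ| ≤ (|x - P.gin| * u x + P.a * |u1 x|) / P.σ := by
      rw [abs_div, abs_of_pos hσ]
      refine div_le_div_of_nonneg_right ?_ hσ.le
      refine (abs_add_le _ _).trans ?_
      rw [abs_mul, abs_mul, abs_of_pos P.ha, abs_of_nonneg hu0, add_comm]
    have b4 : |W1 x * ((P.a * u1 x + (x - P.gin) * u x) / P.σ)| ≤
        c1 * ((P.VE + 1) / P.σ) * (|x - P.gin| * u x + P.a * |u1 x|) := by
      rw [abs_mul]
      refine (mul_le_mul b2 b3 (abs_nonneg _) (by positivity)).trans (le_of_eq ?_)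
      ring
    have q1 : 0 ≤ (x + P.gL) * |P.J (s * τ) x| * u x := by positivity
    have q2 : 0 ≤ |x - P.gin| * u x + P.a * |u1 x| := by have := P.ha; positivity
    have q3 : 0 ≤ (P.VE + 1) / P.σ := by positivity
    have e2 : P.hd (s * τ) x = (x + P.gL) * |P.J (s * τ) x| * u x + (|x - P.gin| * u x + P.a * |u1 x|) := rfl
    rw [e2]
    have q4 : 0 ≤ c1 * ((P.VE + 1) / P.σ) * ((x + P.gL) * |P.J (s * τ) x| * u x) := by positivity
    have q5 : 0 ≤ c1 * (|x - P.gin| * u x + P.a * |u1 x|) := by positivity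
    have q6 : ∀ X Z D : ℝ, c1 * (1 + D) * (X + Z) = c1 * X + c1 * D * Z + c1 * D * X + c1 * Z := fun X Z D => by ring
    rw [q6]
    linarith

set_option maxHeartbeats 1000000 in
theorem slopeE2 {τ : ℝ} (hτ : -1 * τ ∈ Ioo 0 P.VF) {ε ρ G : ℝ} (hε : 0 < ε) (hρ : 0 < ρ)
    (hρG : ρ < G) {ζ ζ1 ζ2 : ℝ → ℝ} (hζ : C2On ζ ζ1 ζ2 ρ G) (hζ0 : ∀ x ∈ Icc ρ G, 0 ≤ ζ x ∧ ζ x ≤ 1)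
    (hζ1 : ∀ x ∈ Icc ρ G, 0 ≤ ζ1 x) (hζ2 : ∀ x ∈ Icc ρ G, ζ2 x ≤ 0)
    (hb1 : ζ ρ = 0) (hb2 : P.js (-1) τ G ≤ 0) {k : ℝ} (hk : 0 ≤ k) :
    P.Sl0 (-1) ε ζ etaK 1 k ρ G τ ≤
      (((P.VE * G + P.gL * P.VF) * (G + P.gin) + P.VE * P.a) / (P.a * P.σ) + (1 / (P.σ * P.gL) + 1)) *
        (∫ x in ρ..G, P.hd (-1 * τ) x)
      + P.a / P.σ * (P.gL * P.VF) * ζ1 ρ * etaK.f (P.p (-1 * τ) ρ - k) := by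
  have hs : (-1:ℝ) * -1 = 1 := by norm_num
  have hw := P.slice (R := G) hτ hρ
  have hW := P.Wt_c2 (-1) hε hζ τ
  have hgL := P.hgL
  have hσ := P.hσ
  have ha := P.ha
  have hgin := P.hgin
  have hVF := P.hVF
  have hVE : 0 < P.VE := P.hVF.trans P.hVE
  have hG : 0 < G := hρ.trans hρG
  set j := P.js (-1) τ with hjd
  set u := P.p (-1 * τ) with hu
  set u1 := P.pg (-1 * τ) with hu1
  set u2 := P.pgg (-1 * τ) with hu2
  set W := P.Wt (-1) ε ζ τ with hWd
  set j' := (-1) * P.VE - τ with hj'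
  have hj'0 : j' ≤ 0 := by rw [hj']; linarith [hτ.2, P.hVE]
  have hj'1 : |j'| ≤ P.VE := P.sve_abs hs hτ
  set W1 : ℝ → ℝ := fun x => th1 ε (j x) * j' * ζ x + th ε (j x) * ζ1 x with hW1
  have cj := (P.js_c2 (-1) τ ρ G).cw
  have cw := hw.cw; have cw1 := hw.cw1; have cw2 := hw.c
  have cW := hW.cw; have cW1 := hW.cw1
  have cζ := hζ.cw; have cζ1 := hζ.cw1; have cζ2 := hζ.c
  have cth : ContinuousOn (fun x => th ε (j x)) (Icc ρ G) := (th_cont hε).comp_continuousOn cj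
  have cth1 : ContinuousOn (fun x => th1 ε (j x)) (Icc ρ G) := (th1_cont hε).comp_continuousOn cj
  have cuk : ContinuousOn (fun x => 1 * (u x - k)) (Icc ρ G) := by fun_prop
  have ce : ContinuousOn (fun x => etaK.f (1 * (u x - k))) (Icc ρ G) := etaK.cf.comp_continuousOn cuk
  have ce1 : ContinuousOn (fun x => etaK.f1 (1 * (u x - k))) (Icc ρ G) := etaK.cf1.comp_continuousOn cuk
  have ce2 : ContinuousOn (fun x => etaK.f2 (1 * (u x - k))) (Icc ρ G) := etaK.cf2.comp_continuousOn cuk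
  have cR : ContinuousOn (P.Rs (-1 * τ)) (Icc ρ G) := P.Rs_cont hτ hρ
  have cI : ContinuousOn (fun x => ((th1 ε (j x) * (-(P.gL + x)) * ζ x * j x + W x * (-(P.gL + x))) *
      etaK.f (1 * (u x - k))
    + 1 * (W x * etaK.f1 (1 * (u x - k)) * (P.Rs (-1 * τ) x - (-(P.gL + x)) * u x)))) (Icc ρ G) := by
    fun_prop
  have key := slope_via (C := (((P.VE * G + P.gL * P.VF) * (G + P.gin) + P.VE * P.a) / (P.a * P.σ) + (1 / (P.σ * P.gL) + 1)))
    (h := P.hd (-1 * τ)) hρG.le cI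
    (F := fun x => P.a / P.σ * (W x * (etaK.f1 (1 * (u x - k)) * u1 x) - th ε (j x) * (ζ1 x * etaK.f (1 * (u x - k)))))
    (F' := fun x => P.a / P.σ * (W1 x * (etaK.f1 (1 * (u x - k)) * u1 x)
      + W x * ((etaK.f2 (1 * (u x - k)) * (1 * u1 x)) * u1 x + etaK.f1 (1 * (u x - k)) * u2 x)
      - ((th1 ε (j x) * j') * (ζ1 x * etaK.f (1 * (u x - k))) + th ε (j x) * (ζ2 x * etaK.f (1 * (u x - k))
        + ζ1 x * (etaK.f1 (1 * (u x - k)) * (1 * u1 x))))))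
    ?_ ?_ (P.hd_cont hτ hρ) ?_
  · have hW0 : W ρ = 0 := by
      rw [hWd]; unfold Wt; rw [hb1, mul_zero]
    have hW2 : W G = 0 := by
      rw [hWd]; unfold Wt; rw [th_zero (hb2.trans hε.le), zero_mul]
    have hT : th ε (j G) = 0 := th_zero (hb2.trans hε.le)
    rw [hW0, hW2, hT] at key
    refine le_trans key ?_
    have hj1 : j ρ ≤ P.gL * P.VF := by
      have e : j ρ = P.gL * (-1 * τ) - ρ * (P.VE - -1 * τ) := by rw [hjd]; unfold js; ring
      have a1 : 0 ≤ ρ * (P.VE - -1 * τ) := mul_nonneg hρ.le (by linarith [hτ.2, P.hVE])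
      have a4 : P.gL * (-1 * τ) ≤ P.gL * P.VF := mul_le_mul_of_nonneg_left hτ.2.le hgL.le
      linarith
    have h1 : th ε (j ρ) ≤ P.gL * P.VF :=
      (th_le hε _).trans (max_le hj1 (by positivity))
    have h2 : 0 ≤ ζ1 ρ * etaK.f (1 * (u ρ - k)) := mul_nonneg (hζ1 ρ ⟨le_rfl, hρG.le⟩) (etaK_nonneg _)
    have h3 := mul_le_mul_of_nonneg_right h1 h2
    have h4 : 0 < P.a / P.σ := by positivity
    have h5 := mul_le_mul_of_nonneg_left h3 h4.le
    simp only [one_mul, zero_mul, mul_zero, zero_sub, sub_zero, mul_neg, neg_neg] at h5 ⊢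
    linarith
  · intro x hx
    have dw : HasDerivAt (fun x => 1 * (u x - k)) (1 * u1 x) x := ((hw.d1 x hx).sub_const k).const_mul 1
    have d1 := HasDerivAt.comp x (etaK.d1 (1 * (u x - k))) dw
    have d2 := HasDerivAt.comp x (etaK.d2 (1 * (u x - k))) dw
    have d3 := HasDerivAt.comp x (th_d1 hε (j x)) (P.js_dx (-1) τ x)
    exact (((hW.d1 x hx).mul (d2.mul (hw.d2 x hx))).sub (d3.mul ((hζ.d2 x hx).mul d1))).const_mul (P.a / P.σ)
  · fun_prop
  · intro x hx
    have hx0 : 0 < x := hρ.trans_le hx.1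
    have hu0 : 0 ≤ u x := P.p_nonneg hτ hx0.le
    have hz := hζ0 x hx
    have hz1 := hζ1 x hx
    have hz2 := hζ2 x hx
    set f := etaK.f (1 * (u x - k)) with hf
    set f1 := etaK.f1 (1 * (u x - k)) with hf1
    set f2 := etaK.f2 (1 * (u x - k)) with hf2
    have f0 : 0 ≤ f := etaK_nonneg _
    have f10 : 0 ≤ f1 := etaK1_nonneg _
    have f11 : f1 ≤ 1 := etaK1_le _
    have f20 : 0 ≤ f2 := etaK.f2_nonneg _
    have t0 : 0 ≤ th ε (j x) := th_nonneg hε _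
    have t10 : 0 ≤ th1 ε (j x) := th1_nonneg hε _
    have t11 : th1 ε (j x) ≤ 1 := th1_le hε _
    have tj : 0 ≤ th1 ε (j x) * j x := by
      rcases le_total (j x) ε with h | h
      · rw [th1_zero h, zero_mul]
      · exact mul_nonneg t10 (by linarith)
    have hWx : W x = th ε (j x) * ζ x := rfl
    have W0 : 0 ≤ W x := mul_nonneg t0 hz.1
    have WJ : W x ≤ |P.J (-1 * τ) x| := by
      rw [← P.js_abs hs, hWx]
      calc th ε (j x) * ζ x ≤ th ε (j x) * 1 := mul_le_mul_of_nonneg_left hz.2 t0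
        _ ≤ _ := by rw [mul_one]; exact th_le_abs hε _
    have hJ : |P.J (-1 * τ) x| ≤ P.VE * G + P.gL * P.VF := by
      rw [J_eq, abs_le]
      have a1 : 0 ≤ x * (P.VE - -1 * τ) := mul_nonneg hx0.le (by linarith [hτ.2, P.hVE])
      have a2 : x * (P.VE - -1 * τ) ≤ G * P.VE := mul_le_mul hx.2 (by linarith [hτ.1]) (by linarith [hτ.2, P.hVE]) hG.le
      have a3 : 0 ≤ P.gL * (-1 * τ) := mul_nonneg hgL.le hτ.1.le
      have a4 : P.gL * (-1 * τ) ≤ P.gL * P.VF := mul_le_mul_of_nonneg_left hτ.2.le hgL.le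
      have a5 : 0 ≤ P.VE * G := by positivity
      have a6 : 0 ≤ P.gL * P.VF := by positivity
      constructor <;> linarith
    have hbx : |x - P.gin| ≤ G + P.gin := by
      rw [abs_le]; constructor <;> linarith [hx.2]
    set A := P.a / P.σ with hA
    have hA0 : 0 < A := by positivity
    -- identity
    have e1 : ((th1 ε (j x) * (-(P.gL + x)) * ζ x * j x + W x * (-(P.gL + x))) * f
        + 1 * (W x * f1 * (P.Rs (-1 * τ) x - (-(P.gL + x)) * u x)))
      - A * (W1 x * (f1 * u1 x) + W x * ((f2 * (1 * u1 x)) * u1 x + f1 * u2 x)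
        - ((th1 ε (j x) * j') * (ζ1 x * f) + th ε (j x) * (ζ2 x * f + ζ1 x * (f1 * (1 * u1 x)))))
      = -((th1 ε (j x) * j x) * ζ x * (P.gL + x) * f) - W x * (P.gL + x) * f - A * (W x * f2 * (u1 x)^2)
        + A * (th1 ε (j x) * ζ1 x * f) * j' + A * (th ε (j x) * f) * ζ2 x
        + W x * f1 * ((x - P.gin) / P.σ * u1 x) + W x * f1 * ((1 / P.σ + (P.gL + x)) * u x)
        - A * (th1 ε (j x) * j' * ζ x * f1 * u1 x) := by
      simp only [Rs, hW1, hWx, hA]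
      ring
    rw [e1]
    have n1 : 0 ≤ (th1 ε (j x) * j x) * ζ x * (P.gL + x) * f := by
      have := hz.1; positivity
    have n2 : 0 ≤ W x * (P.gL + x) * f := by positivity
    have n3 : 0 ≤ A * (W x * f2 * (u1 x)^2) := by positivity
    have n4 : A * (th1 ε (j x) * ζ1 x * f) * j' ≤ 0 := mul_nonpos_of_nonneg_of_nonpos (by positivity) hj'0
    have n5 : A * (th ε (j x) * f) * ζ2 x ≤ 0 := mul_nonpos_of_nonneg_of_nonpos (by positivity) hz2
    have Wf : W x * f1 ≤ |P.J (-1 * τ) x| := by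
      calc W x * f1 ≤ W x * 1 := mul_le_mul_of_nonneg_left f11 W0
        _ ≤ _ := by rw [mul_one]; exact WJ
    have m1 : W x * f1 * ((x - P.gin) / P.σ * u1 x) ≤
        ((P.VE * G + P.gL * P.VF) * (G + P.gin)) / (P.a * P.σ) * (P.a * |u1 x|) := by
      calc W x * f1 * ((x - P.gin) / P.σ * u1 x) ≤ W x * f1 * ((G + P.gin) / P.σ * |u1 x|) := by
            refine mul_le_mul_of_nonneg_left ?_ (by positivity)
            refine (le_abs_self _).trans ?_
            rw [abs_mul, abs_div, abs_of_pos hσ]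
            gcongr
        _ ≤ (P.VE * G + P.gL * P.VF) * ((G + P.gin) / P.σ * |u1 x|) :=
            mul_le_mul_of_nonneg_right (Wf.trans hJ) (by positivity)
        _ = _ := by field_simp
    have m2 : W x * f1 * ((1 / P.σ + (P.gL + x)) * u x) ≤
        (1 / (P.σ * P.gL) + 1) * ((x + P.gL) * |P.J (-1 * τ) x| * u x) := by
      calc W x * f1 * ((1 / P.σ + (P.gL + x)) * u x) ≤ |P.J (-1 * τ) x| * ((1 / P.σ + (P.gL + x)) * u x) :=
            mul_le_mul_of_nonneg_right Wf (by positivity)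
        _ ≤ |P.J (-1 * τ) x| * (((1 / (P.σ * P.gL) + 1) * (x + P.gL)) * u x) := by
            refine mul_le_mul_of_nonneg_left (mul_le_mul_of_nonneg_right ?_ hu0) (abs_nonneg _)
            have : 1 / P.σ = 1 / (P.σ * P.gL) * P.gL := by field_simp
            have h2 : 0 ≤ 1 / (P.σ * P.gL) * x := by positivity
            nlinarith
        _ = _ := by ring
    have m3 : - (A * (th1 ε (j x) * j' * ζ x * f1 * u1 x)) ≤ P.VE * P.a / (P.a * P.σ) * (P.a * |u1 x|) := by
      refine (neg_le_abs _).trans ?_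
      rw [abs_mul, abs_mul, abs_mul, abs_mul, abs_mul, abs_of_pos hA0, abs_of_nonneg t10, abs_of_nonneg hz.1,
        abs_of_nonneg f10]
      calc A * (th1 ε (j x) * |j'| * ζ x * f1 * |u1 x|) ≤ A * (1 * P.VE * 1 * 1 * |u1 x|) := by
            have := hz.1; have := hz.2
            gcongr
        _ = _ := by rw [hA]; field_simp
    have e2 : P.hd (-1 * τ) x = (x + P.gL) * |P.J (-1 * τ) x| * u x + (|x - P.gin| * u x + P.a * |u1 x|) := rfl
    rw [e2]
    set X := (x + P.gL) * |P.J (-1 * τ) x| * u x with hX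
    set Z := |x - P.gin| * u x with hZ
    set V := P.a * |u1 x| with hV
    have X0 : 0 ≤ X := by positivity
    have Z0 : 0 ≤ Z := by positivity
    have V0 : 0 ≤ V := by positivity
    have q1 : ((P.VE * G + P.gL * P.VF) * (G + P.gin) + P.VE * P.a) / (P.a * P.σ) = 
      ((P.VE * G + P.gL * P.VF) * (G + P.gin)) / (P.a * P.σ) + P.VE * P.a / (P.a * P.σ) := by ring
    rw [q1]
    set K1 := ((P.VE * G + P.gL * P.VF) * (G + P.gin)) / (P.a * P.σ) with hK1
    set K2 := P.VE * P.a / (P.a * P.σ) with hK2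
    set K3 := (1 / (P.σ * P.gL) + 1) with hK3
    have K10 : 0 ≤ K1 := by positivity
    have K20 : 0 ≤ K2 := by positivity
    have K30 : 0 ≤ K3 := by positivity
    have r1 : 0 ≤ K1 * X := by positivity
    have r2 : 0 ≤ K2 * X := by positivity
    have r3 : 0 ≤ K1 * Z := by positivity
    have r4 : 0 ≤ K2 * Z := by positivity
    have r5 : 0 ≤ K3 * Z := by positivity
    have r6 : 0 ≤ K3 * V := by positivity
    have r7 : (K1 + K2 + K3) * (X + (Z + V)) = K1 * X + K2 * X + K3 * X + (K1 * Z + K2 * Z + K3 * Z)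
        + (K1 * V + K2 * V + K3 * V) := by ring
    rw [r7]
    linarith

end App

namespace App
variable (P : App)

open Classical in
def qm (v g : ℝ) : ℝ := (Ioo 0 P.VF).indicator (fun v => P.p v (max g 0)) v

theorem qm_eq {v g : ℝ} (hv : v ∈ Ioo 0 P.VF) (hg : 0 ≤ g) : P.qm v g = P.p v g := by
  unfold qm; rw [indicator_of_mem hv, max_eq_left hg]

theorem qm_meas : Measurable (fun z : ℝ × ℝ => P.qm z.1 z.2) := by
  suffices h : Measurable (Function.uncurry fun (g v : ℝ) => P.qm v g) from h.comp measurable_swap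
  refine measurable_uncurry_of_continuous_of_measurable ?_ ?_
  · intro v
    by_cases hv : v ∈ Ioo 0 P.VF
    · have : (fun g => P.qm v g) = fun g => P.p v (max g 0) := by
        funext g; unfold qm; rw [indicator_of_mem hv]
      rw [this]
      exact (P.p_cont hv).comp_continuous (by fun_prop) (fun g => mem_Ici.2 (le_max_right _ _))
    · have : (fun g => P.qm v g) = fun g => 0 := by
        funext g; unfold qm; rw [indicator_of_notMem hv]
      rw [this]; exact continuous_const
  · intro g
    unfold qm
    have hc : ContinuousOn (fun v => P.p v (max g 0)) (Ioo 0 P.VF) :=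
      (P.hp.cont_v _ (mem_Ici.2 (le_max_right _ _))).mono Ioo_subset_Icc_self
    have h2 := ContinuousOn.measurable_piecewise hc
      (continuousOn_const (c := (0:ℝ)) (s := (Ioo 0 P.VF)ᶜ)) measurableSet_Ioo
    convert h2 using 1
    funext v; simp only [indicator, piecewise]

def Om : Set (ℝ × ℝ) := Ioo 0 P.VF ×ˢ Ioi (0:ℝ)
theorem Om_meas : MeasurableSet P.Om := measurableSet_Ioo.prod measurableSet_Ioi

theorem pg_meas : Measurable (P.Om.indicator (fun z : ℝ × ℝ => P.pg z.1 z.2)) := by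
  refine measurable_of_tendsto_metrizable (f := fun n : ℕ => P.Om.indicator (fun z : ℝ × ℝ =>
    ((n:ℝ)+1) * (P.qm z.1 (z.2 + 1/((n:ℝ)+1)) - P.qm z.1 z.2))) ?_ ?_
  · intro n
    refine Measurable.indicator ?_ P.Om_meas
    refine Measurable.const_mul (Measurable.sub ?_ P.qm_meas) _
    exact P.qm_meas.comp (by fun_prop : Measurable fun z : ℝ × ℝ => (z.1, z.2 + 1/((n:ℝ)+1)))
  · rw [tendsto_pi_nhds]
    rintro ⟨v, g⟩
    by_cases hz : (v, g) ∈ P.Om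
    · simp only [indicator_of_mem hz]
      have hv : v ∈ Ioo 0 P.VF := hz.1
      have hg : 0 < g := hz.2
      have hd := (P.slice (L := g) (R := g) hv hg).d1 g ⟨le_rfl, le_rfl⟩
      have h1 := hd.tendsto_slope_zero_right
      have h2 : Tendsto (fun n : ℕ => 1/((n:ℝ)+1)) atTop (𝓝[>] 0) :=
        tendsto_nhdsWithin_iff.2 ⟨tendsto_one_div_add_atTop_nhds_zero_nat,
          Eventually.of_forall fun n => by show (0:ℝ) < _; positivity⟩
      refine (h1.comp h2).congr fun n => ?_
      have hn : (0:ℝ) < 1/((n:ℝ)+1) := by positivity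
      rw [P.qm_eq hv hg.le, P.qm_eq hv (by linarith)]
      simp
    · simp only [indicator_of_notMem hz]
      exact tendsto_const_nhds

def μΩ : Measure (ℝ × ℝ) := (volume.restrict (Ioo 0 P.VF)).prod (volume.restrict (Ioi (0:ℝ)))

theorem μΩ_eq : (volume : Measure (ℝ × ℝ)).restrict (Ioo 0 P.VF ×ˢ Ioi (0:ℝ)) = P.μΩ := by
  unfold μΩ; rw [Measure.prod_restrict]; rfl

theorem ae_Om : ∀ᵐ z ∂P.μΩ, z ∈ P.Om := by
  rw [← P.μΩ_eq]; exact ae_restrict_mem P.Om_meas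

theorem p_aem : AEMeasurable (fun z : ℝ × ℝ => P.p z.1 z.2) P.μΩ := by
  refine ⟨_, P.qm_meas, ?_⟩
  filter_upwards [P.ae_Om] with z hz
  exact (P.qm_eq hz.1 (le_of_lt hz.2)).symm

theorem pg_aem : AEMeasurable (fun z : ℝ × ℝ => P.pg z.1 z.2) P.μΩ := by
  refine ⟨_, P.pg_meas, ?_⟩
  filter_upwards [P.ae_Om] with z hz
  rw [indicator_of_mem hz]

theorem J_meas : Measurable (fun z : ℝ × ℝ => P.J z.1 z.2) := by
  unfold J Jflux; fun_prop

def Hl (v : ℝ) : ℝ≥0∞ := ∫⁻ g in Ioi (0:ℝ), ENNReal.ofReal (P.hd v g)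
def Hr (v : ℝ) : ℝ := (P.Hl v).toReal

theorem hd_aem : AEMeasurable (fun z : ℝ × ℝ => ENNReal.ofReal (P.hd z.1 z.2)) P.μΩ := by
  have h1 := P.p_aem
  have h2 := P.pg_aem
  have h3 := P.J_meas.aemeasurable (μ := P.μΩ)
  have h4 : AEMeasurable (fun z : ℝ × ℝ => |P.J z.1 z.2|) P.μΩ := h3.abs
  have h5 : AEMeasurable (fun z : ℝ × ℝ => |P.pg z.1 z.2|) P.μΩ := h2.abs
  have h6 : AEMeasurable (fun z : ℝ × ℝ => |z.2 - P.gin|) P.μΩ :=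
    (by fun_prop : Measurable (fun z : ℝ × ℝ => |z.2 - P.gin|)).aemeasurable
  have h7 : AEMeasurable (fun z : ℝ × ℝ => z.2 + P.gL) P.μΩ :=
    (by fun_prop : Measurable (fun z : ℝ × ℝ => z.2 + P.gL)).aemeasurable
  exact (((h7.mul h4).mul h1).add ((h6.mul h1).add (h5.const_mul P.a))).ennreal_ofReal

theorem hd_nonneg {v g : ℝ} (hv : v ∈ Ioo 0 P.VF) (hg : 0 < g) : 0 ≤ P.hd v g := by
  have := P.p_nonneg hv hg.le
  have := P.hgL; have := P.ha
  unfold hd; positivity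

theorem hd_int : ∫⁻ v in Ioo 0 P.VF, P.Hl v < ⊤ := by
  have h1 := P.hint2
  have h2 := P.hint3
  rw [P.μΩ_eq] at h1 h2
  have h3 := lintegral_prod (μ := volume.restrict (Ioo 0 P.VF)) (ν := volume.restrict (Ioi (0:ℝ)))
    (fun z : ℝ × ℝ => ENNReal.ofReal (P.hd z.1 z.2)) P.hd_aem
  unfold Hl
  rw [← h3]
  refine lt_of_le_of_lt ?_ (ENNReal.add_lt_top.2 ⟨h1, h2⟩)
  rw [← lintegral_add_left']
  · refine lintegral_mono fun z => ?_
    exact ENNReal.ofReal_add_le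
  · have h1 := P.p_aem
    have h3 := P.J_meas.aemeasurable (μ := P.μΩ)
    have h7 : AEMeasurable (fun z : ℝ × ℝ => z.2 + P.gL) P.μΩ :=
      (by fun_prop : Measurable (fun z : ℝ × ℝ => z.2 + P.gL)).aemeasurable
    exact ((h7.mul h3.abs).mul h1).ennreal_ofReal

theorem Hl_aem : AEMeasurable P.Hl (volume.restrict (Ioo 0 P.VF)) :=
  AEMeasurable.lintegral_prod_right' (f := fun z : ℝ × ℝ => ENNReal.ofReal (P.hd z.1 z.2)) P.hd_aem

theorem Hr_int : IntegrableOn P.Hr (Ioo 0 P.VF) :=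
  integrable_toReal_of_lintegral_ne_top P.Hl_aem P.hd_int.ne

theorem Hl_fin : ∀ᵐ v ∂(volume.restrict (Ioo 0 P.VF)), P.Hl v < ⊤ :=
  ae_lt_top' P.Hl_aem P.hd_int.ne

theorem Hr_nonneg (v : ℝ) : 0 ≤ P.Hr v := ENNReal.toReal_nonneg

theorem hd_le {v : ℝ} (hv : v ∈ Ioo 0 P.VF) (hf : P.Hl v < ⊤) {ρ G : ℝ} (hρ : 0 < ρ) (hρG : ρ ≤ G) :
    ∫ x in ρ..G, P.hd v x ≤ P.Hr v := by
  rw [intervalIntegral.integral_of_le hρG, integral_eq_lintegral_of_nonneg_ae]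
  · refine ENNReal.toReal_mono hf.ne ?_
    exact lintegral_mono_set (fun x hx => hρ.trans hx.1)
  · filter_upwards [ae_restrict_mem measurableSet_Ioc] with x hx
    exact P.hd_nonneg hv (hρ.trans hx.1)
  · exact ((P.hd_cont hv hρ).mono Ioc_subset_Icc_self).aestronglyMeasurable measurableSet_Ioc

theorem exists_v0 : ∃ v0 ∈ Ioo 0 P.VF, ∫⁻ g in Ioi (0:ℝ), ENNReal.ofReal ((P.J v0 g)^2 * P.p v0 g) < ⊤ := by
  have h1 := P.hint1
  rw [P.μΩ_eq] at h1
  have hm : AEMeasurable (fun z : ℝ × ℝ => ENNReal.ofReal ((P.J z.1 z.2)^2 * P.p z.1 z.2)) P.μΩ :=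
    (((P.J_meas.aemeasurable (μ := P.μΩ)).pow_const 2).mul P.p_aem).ennreal_ofReal
  have h3 := lintegral_prod (μ := volume.restrict (Ioo 0 P.VF)) (ν := volume.restrict (Ioi (0:ℝ)))
    (fun z : ℝ × ℝ => ENNReal.ofReal ((P.J z.1 z.2)^2 * P.p z.1 z.2)) hm
  have h4 : ∀ᵐ v ∂(volume.restrict (Ioo 0 P.VF)), ∫⁻ g in Ioi (0:ℝ), ENNReal.ofReal ((P.J v g)^2 * P.p v g) < ⊤ := by
    refine ae_lt_top' (AEMeasurable.lintegral_prod_right' (f := fun z : ℝ × ℝ => ENNReal.ofReal ((P.J z.1 z.2)^2 * P.p z.1 z.2)) hm) ?_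
    rw [← h3]
    exact h1.ne
  have h5 := h4.and (ae_restrict_mem measurableSet_Ioo)
  have : NeZero (volume.restrict (Ioo 0 P.VF)) := ⟨by
    intro h
    have := congrArg (fun μ => μ univ) h
    simp at this
    exact absurd P.hVF (not_lt.2 this)⟩
  obtain ⟨v, hv⟩ := h5.exists
  exact ⟨v, hv.2, hv.1⟩

theorem p_le_H : ∃ CM, 0 ≤ CM ∧ ∀ v ∈ Ioo 0 P.VF, P.Hl v < ⊤ → ∀ x, 0 < x → x ≤ P.gin / 2 →
    P.p v x ≤ CM * P.Hr v := by
  have hg := P.hgin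
  have ha := P.ha
  have hgL := P.hgL
  refine ⟨(4 / P.gin) * (2 / P.gin) + 1 / P.a, by positivity, ?_⟩
  intro v hv hf x hx hx2
  -- pointwise comparison
  have hcmp : ∀ y z, 0 < y → y ≤ z → |P.p v z - P.p v y| ≤ 1 / P.a * P.Hr v := by
    intro y z hy hyz
    have hs := P.slice (R := z) hv hy
    have i1 := ii_of_contOn hyz hs.cw1
    have e := intervalIntegral.integral_eq_sub_of_hasDerivAt (a := y) (b := z) (f := P.p v) (f' := P.pg v)
      (fun x hx => hs.d1 x (by rwa [uIcc_of_le hyz] at hx)) i1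
    rw [← e]
    refine (intervalIntegral.abs_integral_le_integral_abs hyz).trans ?_
    have i2 := ii_of_contOn hyz (P.hd_cont (G := z) hv hy)
    have h1 : ∫ x in y..z, |P.pg v x| ≤ ∫ x in y..z, 1 / P.a * P.hd v x := by
      refine intervalIntegral.integral_mono_on hyz i1.abs (i2.const_mul _) ?_
      intro x hx
      have hx0 : 0 < x := hy.trans_le hx.1
      have hp := P.p_nonneg hv hx0.le
      have q1 : 0 ≤ (x + P.gL) * |P.J v x| * P.p v x := by positivity
      have q2 : 0 ≤ |x - P.gin| * P.p v x := by positivity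
      have : P.a * |P.pg v x| ≤ P.hd v x := by unfold hd; linarith
      calc |P.pg v x| = 1 / P.a * (P.a * |P.pg v x|) := by field_simp
        _ ≤ _ := mul_le_mul_of_nonneg_left this (by positivity)
    rw [intervalIntegral.integral_const_mul] at h1
    exact h1.trans (mul_le_mul_of_nonneg_left (P.hd_le hv hf hy hyz) (by positivity))
  have hpt : ∀ y ∈ Icc (P.gin/4) (P.gin/2), P.p v x - 1 / P.a * P.Hr v ≤ 2 / P.gin * P.hd v y := by
    intro y hy
    have hy0 : 0 < y := by linarith [hy.1]
    have h1 : P.p v x ≤ P.p v y + 1 / P.a * P.Hr v := by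
      rcases le_total x y with h | h
      · have := (abs_le.1 (hcmp x y hx h)).1; linarith
      · have := (abs_le.1 (hcmp y x hy0 h)).2; linarith
    have hp := P.p_nonneg hv hy0.le
    have q1 : 0 ≤ (y + P.gL) * |P.J v y| * P.p v y := by positivity
    have q2 : 0 ≤ P.a * |P.pg v y| := by positivity
    have q3 : P.gin / 2 * P.p v y ≤ |y - P.gin| * P.p v y := by
      refine mul_le_mul_of_nonneg_right ?_ hp
      rw [abs_sub_comm]
      exact le_trans (by linarith [hy.2]) (le_abs_self _)
    have q4 : P.gin / 2 * P.p v y ≤ P.hd v y := by unfold hd; linarith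
    have q5 : P.p v y ≤ 2 / P.gin * P.hd v y := by
      calc P.p v y = 2 / P.gin * (P.gin / 2 * P.p v y) := by field_simp
        _ ≤ _ := mul_le_mul_of_nonneg_left q4 (by positivity)
    linarith
  have hle : P.gin/4 ≤ P.gin/2 := by linarith
  have i2 := ii_of_contOn hle (P.hd_cont (G := P.gin/2) hv (show 0 < P.gin/4 by linarith))
  have h1 := intervalIntegral.integral_mono_on hle intervalIntegrable_const (i2.const_mul (2 / P.gin)) hpt
  rw [intervalIntegral.integral_const, intervalIntegral.integral_const_mul, smul_eq_mul] at h1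
  have h2 := mul_le_mul_of_nonneg_left (P.hd_le hv hf (show 0 < P.gin/4 by linarith) hle) (show 0 ≤ 2 / P.gin by positivity)
  have h3 : (P.gin / 4) * (P.p v x - 1 / P.a * P.Hr v) ≤ 2 / P.gin * P.Hr v := by
    refine le_trans (le_of_eq ?_) (h1.trans h2); ring
  have h4 : P.p v x - 1 / P.a * P.Hr v ≤ (4 / P.gin) * (2 / P.gin * P.Hr v) := by
    calc P.p v x - 1 / P.a * P.Hr v = (4 / P.gin) * ((P.gin / 4) * (P.p v x - 1 / P.a * P.Hr v)) := by field_simp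
      _ ≤ _ := mul_le_mul_of_nonneg_left h3 (by positivity)
  linarith

end App

theorem ae_s {s : ℝ} (hs : s * s = 1) {Q : ℝ → Prop} (h : ∀ᵐ v, Q v) : ∀ᵐ t, Q (s * t) := by
  rcases mul_self_eq_one_iff.1 hs with rfl | rfl
  · simpa using h
  · have := (Measure.measurePreserving_neg (volume : Measure ℝ)).quasiMeasurePreserving.ae h
    simpa using this

namespace App
variable (P : App)

theorem master {s : ℝ} (hs : s * s = 1) {ε ρ G : ℝ} (hε : 0 < ε) (hρ : 0 < ρ)
    (hρG : ρ < G) {ζ ζ1 ζ2 : ℝ → ℝ} (hζ : C2On ζ ζ1 ζ2 ρ G) (hζ0 : ∀ x ∈ Icc ρ G, 0 ≤ ζ x)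
    (hb1 : ∀ t, s * t ∈ Ioo 0 P.VF → P.Wt s ε ζ t ρ = 0)
    (hb2 : ∀ t, s * t ∈ Ioo 0 P.VF → P.Wt s ε ζ t G = 0) (E : KEta) (e k : ℝ)
    {Hb : ℝ → ℝ} (hH0 : ∀ v ∈ Ioo 0 P.VF, 0 ≤ Hb v) (hHi : IntegrableOn Hb (Ioo 0 P.VF))
    (hSl : ∀ᵐ v ∂(volume.restrict (Ioo 0 P.VF)), P.Sl0 s ε ζ E e k ρ G (s * v) ≤ Hb v)
    {v0 v1 : ℝ} (h0 : v0 ∈ Ioo 0 P.VF) (h1 : v1 ∈ Ioo 0 P.VF) (hle : s * v0 ≤ s * v1) :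
    P.Yf s ε ζ E e k ρ G (s * v1) ≤ P.Yf s ε ζ E e k ρ G (s * v0) + ∫ v in Ioo 0 P.VF, Hb v := by
  have hsv : ∀ v, s * (s * v) = v := fun v => by rw [← mul_assoc, hs, one_mul]
  have hin : ∀ t ∈ Icc (s * v0) (s * v1), s * t ∈ Ioo 0 P.VF := by
    intro t ht
    rcases mul_self_eq_one_iff.1 hs with rfl | rfl
    · simp only [one_mul] at *; exact ⟨h0.1.trans_le ht.1, ht.2.trans_lt h1.2⟩
    · have := ht.1; have := ht.2; exact ⟨by linarith [h1.1], by linarith [h0.2]⟩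
  set Hc : ℝ → ℝ := (Ioo 0 P.VF).indicator Hb with hHc
  have hHcI : Integrable Hc := hHi.integrable_indicator measurableSet_Ioo
  have hs0 : s ≠ 0 := by rintro rfl; norm_num at hs
  have hHcs : Integrable (fun t => Hc (s * t)) := hHcI.comp_mul_left' hs0
  have hHc0 : ∀ v, 0 ≤ Hc v := fun v => indicator_nonneg (fun v hv => hH0 v hv) v
  have hSl' : ∀ᵐ t, s * t ∈ Ioo 0 P.VF → P.Sl0 s ε ζ E e k ρ G t ≤ Hb (s * t) := by
    have h := ae_s hs ((ae_restrict_iff' measurableSet_Ioo).1 hSl)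
    filter_upwards [h] with t ht h2
    have := ht h2
    rwa [hsv] at this
  set H : ℝ → ℝ := fun t => max (Hc (s * t)) (P.Sl0 s ε ζ E e k ρ G t) with hH
  have hHeq : H =ᵐ[volume.restrict (Icc (s * v0) (s * v1))] fun t => Hc (s * t) := by
    filter_upwards [ae_restrict_of_ae hSl', ae_restrict_mem measurableSet_Icc] with t ht htm
    have := hin t htm
    simp only [hH, hHc, indicator_of_mem this]
    exact max_eq_left (ht this)
  have hd := dini_left (Y := P.Yf s ε ζ E e k ρ G) (H := H) hle ?_ ?_ ?_
  · have e1 : ∫ y in (s * v0)..(s * v1), H y ≤ ∫ v in Ioo 0 P.VF, Hb v := by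
      rw [intervalIntegral.integral_of_le hle, ← integral_Icc_eq_integral_Ioc,
        integral_congr_ae hHeq]
      refine (setIntegral_le_integral hHcs (Eventually.of_forall fun t => hHc0 _)).trans ?_
      rw [Measure.integral_comp_mul_left Hc s, abs_inv, abs_s hs, inv_one, one_smul, hHc,
        integral_indicator measurableSet_Ioo]
    linarith
  · intro t ht
    exact (P.stepY hs (hin t ht) hε hρ hρG hζ hζ0 (hb1 t (hin t ht)) (hb2 t (hin t ht)) E e k).1.continuousWithinAt
  · exact (hHcs.integrableOn).congr hHeq.symm
  · intro t ht ε' hε'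
    have htm := hin t ⟨ht.1.le, ht.2⟩
    have h := (P.stepY hs htm hε hρ hρG hζ hζ0 (hb1 t htm) (hb2 t htm) E e k).2 ε' hε'
    filter_upwards [h, self_mem_nhdsWithin] with h hh hpos
    have hpos : 0 < h := hpos
    refine hh.trans (mul_le_mul_of_nonneg_right ?_ hpos.le)
    have : P.Sl0 s ε ζ E e k ρ G t ≤ H t := le_max_right _ _
    linarith

/-- master specialised to E1 -/
theorem masterE1 {s : ℝ} (hs : s * s = 1) {ε ρ G : ℝ} (hε : 0 < ε) (hρ : 0 < ρ)
    (hρG : ρ < G) {ζ ζ1 ζ2 : ℝ → ℝ} (hζ : C2On ζ ζ1 ζ2 ρ G) {c1 : ℝ} (hζ0 : ∀ x ∈ Icc ρ G, 0 ≤ ζ x ∧ ζ x ≤ c1)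
    (hζ1 : ∀ v ∈ Ioo 0 P.VF, ∀ x ∈ Icc ρ G, |P.J v x| * |ζ1 x| ≤ c1)
    (hb1 : ∀ t, s * t ∈ Ioo 0 P.VF → P.Wt s ε ζ t ρ = 0)
    (hb2 : ∀ t, s * t ∈ Ioo 0 P.VF → P.Wt s ε ζ t G = 0)
    {v0 v1 : ℝ} (h0 : v0 ∈ Ioo 0 P.VF) (h1 : v1 ∈ Ioo 0 P.VF) :
    P.Yf s ε ζ idK 1 0 ρ G (s * v1) ≤ P.Yf s ε ζ idK 1 0 ρ G (s * v0)
      + (c1 * (1 + (P.VE + 1) / P.σ)) * ∫ v in Ioo 0 P.VF, P.Hr v := by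
  have hsv : ∀ v, s * (s * v) = v := fun v => by rw [← mul_assoc, hs, one_mul]
  have hVF := P.hVF
  have hVE := P.hVE
  have hσ := P.hσ
  have hc1 : 0 ≤ c1 := (hζ0 ρ ⟨le_rfl, hρG.le⟩).1.trans (hζ0 ρ ⟨le_rfl, hρG.le⟩).2
  have hK : 0 ≤ c1 * (1 + (P.VE + 1) / P.σ) := by
    have : 0 < P.VE := hVF.trans hVE
    positivity
  have hSl : ∀ e : ℝ, e * e = 1 → ∀ᵐ v ∂(volume.restrict (Ioo 0 P.VF)), P.Sl0 s ε ζ idK e 0 ρ G (s * v) ≤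
      (c1 * (1 + (P.VE + 1) / P.σ)) * P.Hr v := by
    intro e he
    filter_upwards [P.Hl_fin, ae_restrict_mem measurableSet_Ioo] with v hf hv
    have hτ : s * (s * v) ∈ Ioo 0 P.VF := by rwa [hsv]
    refine (P.slopeE1 hs hτ hε hρ hρG hζ hζ0 (fun x hx => hζ1 _ hτ x hx) (hb1 _ hτ) (hb2 _ hτ) he).trans ?_
    rw [hsv]
    exact mul_le_mul_of_nonneg_left (P.hd_le hv hf hρ hρG.le) hK
  rw [← integral_const_mul]
  rcases le_total (s * v0) (s * v1) with h | h
  · exact P.master hs hε hρ hρG hζ (fun x hx => (hζ0 x hx).1) hb1 hb2 idK 1 0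
      (fun v hv => mul_nonneg hK (P.Hr_nonneg v)) (P.Hr_int.const_mul _) (hSl 1 (by norm_num)) h0 h1 h
  · have := P.master hs hε hρ hρG hζ (fun x hx => (hζ0 x hx).1) hb1 hb2 idK (-1) 0
      (fun v hv => mul_nonneg hK (P.Hr_nonneg v)) (P.Hr_int.const_mul _) (hSl (-1) (by norm_num)) h1 h0 h
    have e : ∀ t, P.Yf s ε ζ idK (-1) 0 ρ G t = - P.Yf s ε ζ idK 1 0 ρ G t := by
      intro t
      unfold Yf
      rw [← intervalIntegral.integral_neg]
      congr 1; funext x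
      simp only [idK]; ring
    rw [e, e] at this
    linarith

end App

theorem fatou_ii {ρ G : ℕ → ℝ} {F : ℕ → ℝ → ℝ} {f : ℝ → ℝ} {C : ℝ} (hρG : ∀ n, ρ n ≤ G n)
    (hc : ∀ n, ContinuousOn (F n) (Icc (ρ n) (G n))) (h0 : ∀ n, ∀ x ∈ Icc (ρ n) (G n), 0 ≤ F n x)
    (hC : ∀ n, ∫ x in (ρ n)..(G n), F n x ≤ C)
    (hlim : ∀ x > 0, Tendsto (fun n => (Ioc (ρ n) (G n)).indicator (F n) x) atTop (𝓝 (f x))) :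
    ∫⁻ x in Ioi (0:ℝ), ENNReal.ofReal (f x) ≤ ENNReal.ofReal C := by
  have hm : ∀ n, AEMeasurable ((Ioc (ρ n) (G n)).indicator (F n)) volume := fun n =>
    (aemeasurable_indicator_iff measurableSet_Ioc).2
      (((hc n).mono Ioc_subset_Icc_self).aemeasurable measurableSet_Ioc)
  have e1 : ∀ x ∈ Ioi (0:ℝ), ENNReal.ofReal (f x) =
      liminf (fun n => ENNReal.ofReal ((Ioc (ρ n) (G n)).indicator (F n) x)) atTop := by
    intro x hx
    exact ((ENNReal.continuous_ofReal.tendsto _).comp (hlim x hx)).liminf_eq.symm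
  rw [setLIntegral_congr_fun measurableSet_Ioi e1]
  refine (lintegral_liminf_le' fun n => (hm n).ennreal_ofReal.restrict).trans ?_
  refine liminf_le_of_frequently_le' (Eventually.frequently (Eventually.of_forall fun n => ?_))
  have e2 : ∀ x, ENNReal.ofReal ((Ioc (ρ n) (G n)).indicator (F n) x) =
      (Ioc (ρ n) (G n)).indicator (fun x => ENNReal.ofReal (F n x)) x := by
    intro x
    by_cases h : x ∈ Ioc (ρ n) (G n) <;> simp [h]
  refine (setLIntegral_le_lintegral _ _).trans ?_
  simp only [e2]
  rw [lintegral_indicator measurableSet_Ioc]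
  rw [← ofReal_integral_eq_lintegral_ofReal]
  · rw [← intervalIntegral.integral_of_le (hρG n)]
    exact ENNReal.ofReal_le_ofReal (hC n)
  · exact ((hc n).integrableOn_Icc).mono_set Ioc_subset_Icc_self
  · filter_upwards [ae_restrict_mem measurableSet_Ioc] with x hx
    exact h0 n x (Ioc_subset_Icc_self hx)

namespace App
variable (P : App)

theorem ii_le_lint {f : ℝ → ℝ} {I : ℝ≥0∞} (hI : I < ⊤) (h : ∫⁻ g in Ioi (0:ℝ), ENNReal.ofReal (f g) ≤ I)
    {ρ G : ℝ} (hρ : 0 < ρ) (hρG : ρ ≤ G) (hc : ContinuousOn f (Icc ρ G)) (h0 : ∀ x ∈ Icc ρ G, 0 ≤ f x) :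
    ∫ x in ρ..G, f x ≤ I.toReal := by
  rw [intervalIntegral.integral_of_le hρG, integral_eq_lintegral_of_nonneg_ae]
  · refine ENNReal.toReal_mono hI.ne (le_trans ?_ h)
    exact lintegral_mono_set (fun x hx => hρ.trans hx.1)
  · filter_upwards [ae_restrict_mem measurableSet_Ioc] with x hx
    exact h0 x (Ioc_subset_Icc_self hx)
  · exact (hc.mono Ioc_subset_Icc_self).aestronglyMeasurable measurableSet_Ioc

theorem Yf_eq {s : ℝ} (hs : s * s = 1) (ε : ℝ) (ζ : ℝ → ℝ) (E : KEta) (k ρ G v : ℝ) :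
    P.Yf s ε ζ E 1 k ρ G (s * v) =
      ∫ x in ρ..G, th ε (s * P.J v x) * ζ x * (s * P.J v x) * E.f (P.p v x - k) := by
  have hsv : s * (s * v) = v := by rw [← mul_assoc, hs, one_mul]
  unfold Yf Wt
  simp only [P.js_eq hs, hsv, one_mul]

theorem th_mul_nonneg {ε : ℝ} (hε : 0 < ε) (y : ℝ) : 0 ≤ th ε y * y := by
  rcases le_total y ε with h | h
  · rw [th_zero h]; simp
  · exact mul_nonneg (th_nonneg hε y) (hε.le.trans h)

theorem th_mul_le {ε : ℝ} (hε : 0 < ε) (y : ℝ) : th ε y * y ≤ (max y 0)^2 := by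
  rcases le_total y ε with h | h
  · rw [th_zero h, zero_mul]; positivity
  · have hy : 0 ≤ y := hε.le.trans h
    have := mul_le_mul_of_nonneg_right (th_le hε y) hy
    rw [max_eq_left hy] at *; rw [sq]; exact this

theorem Yint_cont {v : ℝ} (hv : v ∈ Ioo 0 P.VF) {s ε : ℝ} (hε : 0 < ε) {ζ ζ1 ζ2 : ℝ → ℝ} (E : KEta) (k : ℝ) {ρ G : ℝ}
    (hρ : 0 < ρ) (hζ : C2On ζ ζ1 ζ2 ρ G) :
    ContinuousOn (fun x => th ε (s * P.J v x) * ζ x * (s * P.J v x) * E.f (P.p v x - k)) (Icc ρ G) := by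
  have h1 : ContinuousOn (P.p v) (Icc ρ G) := (P.p_cont hv).mono fun x hx => hρ.le.trans hx.1
  have h2 := (P.J_cont v).continuousOn (s := Icc ρ G)
  have h3 := (th_cont hε).comp_continuousOn (h2.const_mul s)
  have h4 := E.cf.comp_continuousOn (h1.sub continuousOn_const (g := fun _ => k))
  exact ((h3.mul hζ.cw).mul (h2.const_mul s)).mul h4

theorem Yf_le {v : ℝ} (hv : v ∈ Ioo 0 P.VF) {I : ℝ≥0∞} (hI : I < ⊤)
    (h : ∫⁻ g in Ioi (0:ℝ), ENNReal.ofReal ((P.J v g)^2 * P.p v g) ≤ I)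
    {s : ℝ} (hs : s * s = 1) {ε : ℝ} (hε : 0 < ε) {ζ ζ1 ζ2 : ℝ → ℝ} {ρ G c : ℝ}
    (hρ : 0 < ρ) (hρG : ρ < G) (hζ : C2On ζ ζ1 ζ2 ρ G) (hζ0 : ∀ x ∈ Icc ρ G, 0 ≤ ζ x ∧ ζ x ≤ c) :
    P.Yf s ε ζ idK 1 0 ρ G (s * v) ≤ c * I.toReal := by
  rw [P.Yf_eq hs]
  have hc : 0 ≤ c := (hζ0 ρ ⟨le_rfl, hρG.le⟩).1.trans (hζ0 ρ ⟨le_rfl, hρG.le⟩).2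
  have h1 : ContinuousOn (P.p v) (Icc ρ G) := (P.p_cont hv).mono fun x hx => hρ.le.trans hx.1
  have h2 := (P.J_cont v).continuousOn (s := Icc ρ G)
  have h3 : ContinuousOn (fun x => (P.J v x)^2 * P.p v x) (Icc ρ G) := (h2.pow 2).mul h1
  have hp : ∀ x ∈ Icc ρ G, 0 ≤ P.p v x := fun x hx => P.p_nonneg hv (hρ.le.trans hx.1)
  have h4 := ii_le_lint hI h hρ hρG.le h3 (fun x hx => mul_nonneg (sq_nonneg _) (hp x hx))
  refine le_trans ?_ (mul_le_mul_of_nonneg_left h4 hc)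
  rw [← intervalIntegral.integral_const_mul]
  refine intervalIntegral.integral_mono_on hρG.le (ii_of_contOn hρG.le (P.Yint_cont hv hε idK 0 hρ hζ))
    ((ii_of_contOn hρG.le h3).const_mul c) ?_
  intro x hx
  have q1 : th ε (s * P.J v x) * (s * P.J v x) ≤ (P.J v x)^2 := by
    refine (th_mul_le hε _).trans ?_
    have : (P.J v x)^2 = (s * P.J v x)^2 := by
      rw [mul_pow, sq s, hs, one_mul]
    rw [this]
    rcases le_total (s * P.J v x) 0 with h | h
    · rw [max_eq_right h]; simp; positivity
    · rw [max_eq_left h]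
  have q2 := th_mul_nonneg hε (s * P.J v x)
  have q3 : ζ x * (th ε (s * P.J v x) * (s * P.J v x)) ≤ c * (P.J v x)^2 :=
    mul_le_mul (hζ0 x hx).2 q1 q2 hc
  have q4 := mul_le_mul_of_nonneg_right q3 (hp x hx)
  calc th ε (s * P.J v x) * ζ x * (s * P.J v x) * idK.f (P.p v x - 0)
      = ζ x * (th ε (s * P.J v x) * (s * P.J v x)) * P.p v x := by simp only [idK]; ring
    _ ≤ _ := q4
    _ = _ := by ring

theorem J_abs_le {v x : ℝ} (hv : v ∈ Ioo 0 P.VF) (hx : 0 ≤ x) : |P.J v x| ≤ P.VE * x + P.gL * P.VF := by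
  have h1 := P.hgL; have h2 := P.hVE; have := hv.1; have := hv.2
  rw [P.J_eq, abs_le]
  have q1 : 0 ≤ x * (P.VE - v) := by apply mul_nonneg hx; linarith
  have q2 : 0 ≤ x * v := by apply mul_nonneg hx; linarith
  have q3 : 0 ≤ P.gL * v := by positivity
  have q4 : 0 ≤ P.gL * (P.VF - v) := by apply mul_nonneg h1.le; linarith
  have q5 : 0 ≤ x * P.VE := by apply mul_nonneg hx; linarith
  constructor <;> nlinarith

theorem seq_tendsto : Tendsto (fun n : ℕ => 1 / ((n:ℝ) + 2)) atTop (𝓝 0) := by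
  have h := (tendsto_add_atTop_iff_nat 1).2 (tendsto_one_div_add_atTop_nhds_zero_nat (𝕜 := ℝ))
  refine h.congr fun n => ?_
  push_cast; ring_nf

set_option maxHeartbeats 1000000 in
theorem E1p : ∃ C, ∀ v ∈ Ioo 0 P.VF,
    ∫⁻ x in Ioi (0:ℝ), ENNReal.ofReal ((max (P.J v x) 0)^2 * P.p v x) ≤ ENNReal.ofReal C := by
  obtain ⟨v0, hv0, hI⟩ := P.exists_v0
  set I := ∫⁻ g in Ioi (0:ℝ), ENNReal.ofReal ((P.J v0 g)^2 * P.p v0 g) with hId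
  have hVF := P.hVF; have hVE := P.hVE; have hgL := P.hgL
  have hVE0 : 0 < P.VE := hVF.trans hVE
  set c1 := 1 + 6 * (P.VE + P.gL * P.VF) with hc1
  have hc10 : 0 < P.VE + P.gL * P.VF := by positivity
  refine ⟨c1 * I.toReal + (c1 * (1 + (P.VE + 1) / P.σ)) * ∫ v in Ioo 0 P.VF, P.Hr v, ?_⟩
  intro v hv
  set ε : ℕ → ℝ := fun n => 1 / ((n:ℝ) + 2) with hεd
  have hε : ∀ n, 0 < ε n := fun n => by simp only [hεd]; positivity
  have hεl : Tendsto ε atTop (𝓝 0) := seq_tendsto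
  set ρ : ℕ → ℝ := fun n => ε n / (2 * P.VE) with hρd
  have hρ : ∀ n, 0 < ρ n := fun n => by have := hε n; simp only [hρd]; positivity
  have hρl : Tendsto ρ atTop (𝓝 0) := by simpa using hεl.div_const (2 * P.VE)
  set G : ℕ → ℝ := fun n => (n:ℝ) + 1 + ρ n with hGd
  have hρG : ∀ n, ρ n < G n := fun n => by simp only [hGd]; have : (0:ℝ) ≤ n := Nat.cast_nonneg n; linarith
  have hG1 : ∀ n, 1 ≤ G n := fun n => by
    simp only [hGd]; have : (0:ℝ) ≤ n := Nat.cast_nonneg n; linarith [hρ n]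
  set ζ : ℕ → ℝ → ℝ := fun n x => (1 - (x / G n)^2)^3 with hζd
  have hζ : ∀ n, C2On (ζ n) (fun x => -6 * x / (G n)^2 * (1 - (x / G n)^2)^2)
      (fun x => -6 / (G n)^2 * (1 - (x / G n)^2)^2 + -6 * x / (G n)^2 * (2 * (1 - (x / G n)^2) * (-2 * x / (G n)^2)))
      (ρ n) (G n) := by
    intro n
    have hb : ∀ x, HasDerivAt (fun x : ℝ => 1 - (x / G n)^2) (-2 * x / (G n)^2) x := by
      intro x
      refine ((((hasDerivAt_id x).div_const (G n)).pow 2).const_sub 1).congr_deriv ?_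
      have hne : G n ≠ 0 := (by linarith [hG1 n] : 0 < G n).ne'
      simp only [id]; field_simp; norm_num; field_simp
    refine ⟨fun x _ => ?_, fun x _ => ?_, ?_⟩
    · refine ((hb x).pow 3).congr_deriv ?_
      norm_num; ring
    · have h1 : HasDerivAt (fun x : ℝ => -6 * x / (G n)^2) (-6 / (G n)^2) x := by
        refine (((hasDerivAt_id x).const_mul (-6)).div_const _).congr_deriv ?_; simp
      refine (h1.mul ((hb x).pow 2)).congr_deriv ?_
      norm_num
    · exact Continuous.continuousOn (by fun_prop)
  have hq : ∀ n, ∀ x ∈ Icc (ρ n) (G n), 0 ≤ 1 - (x / G n)^2 ∧ 1 - (x / G n)^2 ≤ 1 := by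
    intro n x hx
    have h1 : 0 ≤ x / G n := div_nonneg ((hρ n).le.trans hx.1) (by linarith [hG1 n])
    have h2 : x / G n ≤ 1 := (div_le_one (by linarith [hG1 n])).2 hx.2
    constructor <;> nlinarith
  have hζ0 : ∀ n, ∀ x ∈ Icc (ρ n) (G n), 0 ≤ ζ n x ∧ ζ n x ≤ c1 := by
    intro n x hx
    obtain ⟨h1, h2⟩ := hq n x hx
    exact ⟨pow_nonneg h1 3, (pow_le_one₀ h1 h2).trans (by simp only [hc1]; linarith)⟩
  have hζ1 : ∀ n, ∀ v ∈ Ioo 0 P.VF, ∀ x ∈ Icc (ρ n) (G n),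
      |P.J v x| * |-6 * x / (G n)^2 * (1 - (x / G n)^2)^2| ≤ c1 := by
    intro n v hv x hx
    obtain ⟨h1, h2⟩ := hq n x hx
    have hx0 : 0 ≤ x := (hρ n).le.trans hx.1
    have hGp := hG1 n
    have hG0 : 0 < G n := by linarith
    have a1 : |-6 * x / (G n)^2 * (1 - (x / G n)^2)^2| ≤ 6 / G n := by
      rw [abs_mul, abs_div, abs_mul, abs_of_nonneg hx0, abs_of_nonneg (pow_nonneg h1 2), abs_of_pos (pow_pos hG0 2)]
      have b1 : (1 - (x / G n)^2)^2 ≤ 1 := pow_le_one₀ h1 h2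
      have b2 : |(-6:ℝ)| * x / (G n)^2 ≤ 6 / G n := by
        rw [abs_neg, abs_of_pos (by norm_num : (0:ℝ) < 6), div_le_div_iff₀ (by positivity) hG0]
        nlinarith [mul_le_mul_of_nonneg_right hx.2 hG0.le]
      calc _ ≤ |(-6:ℝ)| * x / (G n)^2 * 1 := mul_le_mul_of_nonneg_left b1 (by positivity)
        _ ≤ _ := by rw [mul_one]; exact b2
    have a2 : |P.J v x| ≤ (P.VE + P.gL * P.VF) * G n := by
      refine (P.J_abs_le hv hx0).trans ?_
      have : 0 ≤ P.gL * P.VF := by positivity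
      nlinarith [mul_le_mul_of_nonneg_left hx.2 hVE0.le, mul_le_mul_of_nonneg_left hGp this]
    calc _ ≤ (P.VE + P.gL * P.VF) * G n * (6 / G n) := mul_le_mul a2 a1 (abs_nonneg _) (by positivity)
      _ = 6 * (P.VE + P.gL * P.VF) := by field_simp
      _ ≤ c1 := by simp only [hc1]; linarith
  have hs : (1:ℝ) * 1 = 1 := by norm_num
  have hb1 : ∀ n t, 1 * t ∈ Ioo 0 P.VF → P.Wt 1 (ε n) (ζ n) t (ρ n) = 0 := by
    intro n t ht
    rw [one_mul] at ht
    unfold Wt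
    rw [th_zero, zero_mul]
    unfold js
    have h1 : ρ n * P.VE = ε n / 2 := by simp only [hρd]; field_simp
    have h2 : 0 ≤ t * (P.gL + ρ n) := mul_nonneg ht.1.le (by linarith [hρ n])
    have := hε n
    linarith
  have hb2 : ∀ n t, 1 * t ∈ Ioo 0 P.VF → P.Wt 1 (ε n) (ζ n) t (G n) = 0 := by
    intro n t ht
    unfold Wt
    have : ζ n (G n) = 0 := by
      simp only [hζd]; rw [div_self (by linarith [hG1 n])]; norm_num
    rw [this, mul_zero]
  refine fatou_ii (ρ := ρ) (G := G) (F := fun n x => th (ε n) (1 * P.J v x) * ζ n x * (1 * P.J v x) * idK.f (P.p v x - 0))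
    (fun n => (hρG n).le) (fun n => P.Yint_cont hv (hε n) idK 0 (hρ n) (hζ n)) ?_ ?_ ?_
  · intro n x hx
    have q1 := th_mul_nonneg (hε n) (1 * P.J v x)
    have q2 := (hζ0 n x hx).1
    have q3 : 0 ≤ idK.f (P.p v x - 0) := by
      simp only [idK]; linarith [P.p_nonneg hv ((hρ n).le.trans hx.1)]
    refine mul_nonneg ?_ q3
    have := mul_nonneg q1 q2
    linarith
  · intro n
    rw [← P.Yf_eq hs]
    have := P.masterE1 hs (hε n) (hρ n) (hρG n) (hζ n) (hζ0 n) (hζ1 n) (hb1 n) (hb2 n) hv0 hv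
    have h2 := P.Yf_le hv0 hI le_rfl hs (hε n) (hρ n) (hρG n) (hζ n) (hζ0 n)
    linarith
  · intro x hx
    have hev : ∀ᶠ n in atTop, x ∈ Ioc (ρ n) (G n) := by
      have h1 : ∀ᶠ n in atTop, ρ n < x := (tendsto_order.1 hρl).2 x hx
      obtain ⟨N, hN⟩ := exists_nat_ge x
      filter_upwards [h1, eventually_ge_atTop N] with n h1 h2
      refine ⟨h1, ?_⟩
      have : (N:ℝ) ≤ n := by exact_mod_cast h2
      simp only [hGd]; linarith [hρ n]
    have hGl : Tendsto G atTop atTop := by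
      refine tendsto_atTop_mono (f := fun n : ℕ => (n:ℝ)) (fun n => ?_) tendsto_natCast_atTop_atTop
      simp only [hGd]; linarith [hρ n]
    have hζl : Tendsto (fun n => ζ n x) atTop (𝓝 1) := by
      have := ((hGl.const_div_atTop x).pow 2).const_sub 1 |>.pow 3
      simpa [hζd] using this
    have hT := (((th_tendsto hε hεl (1 * P.J v x)).mul hζl).mul_const (1 * P.J v x)).mul_const (idK.f (P.p v x - 0))
    have e : max (1 * P.J v x) 0 * 1 * (1 * P.J v x) * idK.f (P.p v x - 0) = (max (P.J v x) 0)^2 * P.p v x := by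
      simp only [idK, one_mul, sub_zero, mul_one]
      congr 1
      rcases le_total (P.J v x) 0 with h | h
      · rw [max_eq_right h]; ring
      · rw [max_eq_left h]; ring
    rw [← e]
    refine hT.congr' ?_
    filter_upwards [hev] with n hn
    rw [indicator_of_mem hn]

def gF : ℝ := P.gL * P.VF / (P.VE - P.VF)
theorem gF_pos : 0 < P.gF := by
  have := P.hgL; have := P.hVF; have : 0 < P.VE - P.VF := by linarith [P.hVE]
  unfold gF; positivity

theorem J_nonneg {v x : ℝ} (hv : v ∈ Ioo 0 P.VF) (hx : P.gF ≤ x) : 0 ≤ P.J v x := by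
  have h1 := P.hgL; have h2 : 0 < P.VE - P.VF := by linarith [P.hVE]
  have h3 : P.gF * (P.VE - P.VF) = P.gL * P.VF := by unfold gF; field_simp
  have h4 := P.gF_pos
  rw [P.J_eq]
  have q1 : P.gF * (P.VE - P.VF) ≤ x * (P.VE - P.VF) := mul_le_mul_of_nonneg_right hx h2.le
  have q2 : x * (P.VE - P.VF) ≤ x * (P.VE - v) :=
    mul_le_mul_of_nonneg_left (by linarith [hv.2]) (by linarith)
  have q3 : P.gL * v ≤ P.gL * P.VF := mul_le_mul_of_nonneg_left hv.2.le h1.le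
  linarith

set_option maxHeartbeats 1000000 in
theorem E1m : ∃ C, 0 ≤ C ∧ ∀ v ∈ Ioo 0 P.VF,
    ∫⁻ x in Ioi (0:ℝ), ENNReal.ofReal ((max (-P.J v x) 0)^2 * x * P.p v x) ≤ ENNReal.ofReal C := by
  obtain ⟨v0, hv0, hI⟩ := P.exists_v0
  set I := ∫⁻ g in Ioi (0:ℝ), ENNReal.ofReal ((P.J v0 g)^2 * P.p v0 g) with hId
  have hVF := P.hVF; have hVE := P.hVE; have hgL := P.hgL; have hσ := P.hσ
  have hVE0 : 0 < P.VE := hVF.trans hVE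
  have hgF := P.gF_pos
  set G := P.gF + 1 with hG
  have hG0 : 0 < G := by linarith
  set c1 := G + (P.VE * G + P.gL * P.VF) with hc1
  have hc10 : 0 < P.VE * G + P.gL * P.VF := by positivity
  have hHr : 0 ≤ ∫ v in Ioo 0 P.VF, P.Hr v := integral_nonneg fun v => P.Hr_nonneg v
  have hc1p : 0 ≤ c1 := by linarith
  refine ⟨c1 * I.toReal + (c1 * (1 + (P.VE + 1) / P.σ)) * ∫ v in Ioo 0 P.VF, P.Hr v, ?_, ?_⟩
  · have : 0 ≤ I.toReal := ENNReal.toReal_nonneg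
    positivity
  intro v hv
  set ε : ℕ → ℝ := fun n => 1 / ((n:ℝ) + 2) with hεd
  have hε : ∀ n, 0 < ε n := fun n => by simp only [hεd]; positivity
  have hεl : Tendsto ε atTop (𝓝 0) := seq_tendsto
  have hεG : ∀ n, ε n < G := fun n => by
    have : ε n < 1 := by
      simp only [hεd]; rw [div_lt_one (by positivity)]
      have : (0:ℝ) ≤ n := Nat.cast_nonneg n
      linarith
    linarith
  set ζ : ℕ → ℝ → ℝ := fun n x => x - ε n with hζd
  have hζ : ∀ n, C2On (ζ n) (fun x => 1) (fun x => 0) (ε n) G := by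
    intro n
    refine ⟨fun x _ => (hasDerivAt_id x).sub_const _, fun x _ => hasDerivAt_const _ _, continuousOn_const⟩
  have hζ0 : ∀ n, ∀ x ∈ Icc (ε n) G, 0 ≤ ζ n x ∧ ζ n x ≤ c1 := by
    intro n x hx
    have := hx.1; have := hx.2; have := hε n
    simp only [hζd, hc1]
    constructor <;> linarith
  have hζ1 : ∀ n, ∀ v ∈ Ioo 0 P.VF, ∀ x ∈ Icc (ε n) G, |P.J v x| * |(1:ℝ)| ≤ c1 := by
    intro n v hv x hx
    have hx0 : 0 ≤ x := (hε n).le.trans hx.1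
    rw [abs_one, mul_one]
    refine (P.J_abs_le hv hx0).trans ?_
    have := mul_le_mul_of_nonneg_left hx.2 hVE0.le
    simp only [hc1]; linarith
  have hs : (-1:ℝ) * -1 = 1 := by norm_num
  have hb1 : ∀ n t, -1 * t ∈ Ioo 0 P.VF → P.Wt (-1) (ε n) (ζ n) t (ε n) = 0 := by
    intro n t ht
    unfold Wt
    have : ζ n (ε n) = 0 := by simp only [hζd]; ring
    rw [this, mul_zero]
  have hb2 : ∀ n t, -1 * t ∈ Ioo 0 P.VF → P.Wt (-1) (ε n) (ζ n) t G = 0 := by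
    intro n t ht
    unfold Wt
    have h1 := P.J_nonneg ht (show P.gF ≤ G by linarith)
    have h2 := P.js_eq hs (-1 * t) G
    have h3 : (-1:ℝ) * (-1 * t) = t := by ring
    rw [h3] at h2
    rw [th_zero (by rw [h2]; linarith [hε n]), zero_mul]
  refine fatou_ii (ρ := ε) (G := fun _ => G) (F := fun n x => th (ε n) (-1 * P.J v x) * ζ n x * (-1 * P.J v x) * idK.f (P.p v x - 0))
    (fun n => (hεG n).le) (fun n => P.Yint_cont hv (hε n) idK 0 (hε n) (hζ n)) ?_ ?_ ?_
  · intro n x hx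
    have q1 := th_mul_nonneg (hε n) (-1 * P.J v x)
    have q2 := (hζ0 n x hx).1
    have q3 : 0 ≤ idK.f (P.p v x - 0) := by
      simp only [idK]; linarith [P.p_nonneg hv ((hε n).le.trans hx.1)]
    refine mul_nonneg ?_ q3
    have := mul_nonneg q1 q2
    linarith
  · intro n
    rw [← P.Yf_eq hs]
    have := P.masterE1 hs (hε n) (hε n) (hεG n) (hζ n) (hζ0 n) (hζ1 n) (hb1 n) (hb2 n) hv0 hv
    have h2 := P.Yf_le hv0 hI le_rfl hs (hε n) (hε n) (hεG n) (hζ n) (hζ0 n)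
    linarith
  · intro x hx
    have hx : 0 < x := hx
    have e : max (-1 * P.J v x) 0 * (x - 0) * (-1 * P.J v x) * idK.f (P.p v x - 0) = (max (-P.J v x) 0)^2 * x * P.p v x := by
      simp only [idK, neg_one_mul, sub_zero]
      rcases le_total (-P.J v x) 0 with h | h
      · rw [max_eq_right h]; ring
      · rw [max_eq_left h]; ring
    rcases le_or_gt x G with hxG | hxG
    · have hev : ∀ᶠ n in atTop, x ∈ Ioc (ε n) G := by
        filter_upwards [(tendsto_order.1 hεl).2 x hx] with n h1
        exact ⟨h1, hxG⟩
      have hT := (((th_tendsto hε hεl (-1 * P.J v x)).mul (hεl.const_sub x)).mul_const (-1 * P.J v x)).mul_const (idK.f (P.p v x - 0))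
      rw [← e]
      refine hT.congr' ?_
      filter_upwards [hev] with n hn
      rw [indicator_of_mem hn]
    · have h1 := P.J_nonneg hv (show P.gF ≤ x by linarith)
      rw [max_eq_right (by linarith)]
      have : ∀ n, (Ioc (ε n) G).indicator (fun x => th (ε n) (-1 * P.J v x) * ζ n x * (-1 * P.J v x) * idK.f (P.p v x - 0)) x = 0 :=
        fun n => indicator_of_notMem (fun h => absurd h.2 (not_le.2 hxG)) _
      simp only [this]
      simp

end App

theorem cub_c2 (ρ X l r : ℝ) : C2On (fun x => (x-ρ)^3*(X-x)^3)
    (fun x => 3*(x-ρ)^2*(X-x)^3 - 3*(x-ρ)^3*(X-x)^2)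
    (fun x => 6*(x-ρ)*(X-x)^3 - 18*(x-ρ)^2*(X-x)^2 + 6*(x-ρ)^3*(X-x)) l r := by
  have h1 : ∀ x : ℝ, HasDerivAt (fun x => x - ρ) 1 x := fun x => (hasDerivAt_id x).sub_const _
  have h2 : ∀ x : ℝ, HasDerivAt (fun x => X - x) (-1) x := fun x => (hasDerivAt_id x).const_sub _
  refine ⟨fun x _ => ?_, fun x _ => ?_, Continuous.continuousOn (by fun_prop)⟩
  · refine (((h1 x).pow 3).mul ((h2 x).pow 3)).congr_deriv ?_
    simp only [Pi.pow_apply]; norm_num; ring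
  · refine (((((h1 x).pow 2).const_mul 3).mul ((h2 x).pow 3)).sub ((((h1 x).pow 3).const_mul 3).mul ((h2 x).pow 2))).congr_deriv ?_
    simp only [Pi.pow_apply]; norm_num; ring

theorem cub_bd {ρ X x : ℝ} (h0 : 0 ≤ ρ) (h1 : ρ ≤ x) (h2 : x ≤ X) :
    |3*(x-ρ)^2*(X-x)^3 - 3*(x-ρ)^3*(X-x)^2| ≤ 6*X^4*x ∧
    |6*(x-ρ)*(X-x)^3 - 18*(x-ρ)^2*(X-x)^2 + 6*(x-ρ)^3*(X-x)| ≤ 30*X^3*x := by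
  set A := x - ρ with hA
  set B := X - x with hB
  have hA0 : 0 ≤ A := by linarith
  have hB0 : 0 ≤ B := by linarith
  have hAX : A ≤ X := by linarith
  have hAx : A ≤ x := by linarith
  have hBX : B ≤ X := by linarith
  have hX : 0 ≤ X := by linarith
  have hx : 0 ≤ x := by linarith
  have a1 : A*(A*B^3) ≤ x*(X*X^3) := by gcongr
  have a2 : A*(A^2*B^2) ≤ x*(X^2*X^2) := by gcongr
  have a3 : A*B^3 ≤ x*X^3 := by gcongr
  have a4 : A*(A*B^2) ≤ x*(X*X^2) := by gcongr
  have a5 : A*(A^2*B) ≤ x*(X^2*X) := by gcongr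
  have b1 : 0 ≤ A*(A*B^3) := by positivity
  have b2 : 0 ≤ A*(A^2*B^2) := by positivity
  have b3 : 0 ≤ A*B^3 := by positivity
  have b4 : 0 ≤ A*(A*B^2) := by positivity
  have b5 : 0 ≤ A*(A^2*B) := by positivity
  have e1 : 3*A^2*B^3 - 3*A^3*B^2 = 3*(A*(A*B^3)) - 3*(A*(A^2*B^2)) := by ring
  have e2 : 6*A*B^3 - 18*A^2*B^2 + 6*A^3*B = 6*(A*B^3) - 18*(A*(A*B^2)) + 6*(A*(A^2*B)) := by ring
  have e3 : x*(X*X^3) = X^4*x := by ring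
  have e4 : x*(X^2*X^2) = X^4*x := by ring
  have e5 : x*X^3 = X^3*x := by ring
  have e6 : x*(X*X^2) = X^3*x := by ring
  have e7 : x*(X^2*X) = X^3*x := by ring
  have b6 : 0 ≤ X^4*x := by positivity
  have b7 : 0 ≤ X^3*x := by positivity
  rw [e1, e2, abs_le, abs_le]
  refine ⟨⟨?_, ?_⟩, ⟨?_, ?_⟩⟩ <;> linarith

namespace App
variable (P : App)

structure Near (T jm : ℝ) : Prop where
  hT : 0 < T
  hTV : T < P.VF
  hjm : 0 < jm
  hsm : 40 * P.CC (3 * P.gF / 4) * T ≤ jm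
  hj : ∀ v, P.VF - T ≤ v → v ≤ P.VF → ∀ x, 0 ≤ x → x ≤ 3 * P.gF / 4 → jm ≤ -P.J v x

theorem exists_near : ∃ T jm, P.Near T jm := by
  have hVF := P.hVF; have hVE := P.hVE; have hgL := P.hgL; have hgF := P.gF_pos
  have hCC := P.CC_pos (R := 3 * P.gF / 4) (by positivity)
  have hd : 0 < P.VE - P.VF := by linarith
  set q := P.gL * P.VF / 8 with hq
  have hq0 : 0 < q := by positivity
  set R := 3 * P.gF / 4 with hR
  have hR0 : 0 < R := by positivity
  set T := min (P.VF / 2) (min (q / (40 * P.CC R)) (q / (P.gL + R))) with hT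
  have hT0 : 0 < T := by
    refine lt_min (by positivity) (lt_min (by positivity) (by positivity))
  have hT1 : T ≤ P.VF / 2 := min_le_left _ _
  have hT2 : T ≤ q / (40 * P.CC R) := (min_le_right _ _).trans (min_le_left _ _)
  have hT3 : T ≤ q / (P.gL + R) := (min_le_right _ _).trans (min_le_right _ _)
  refine ⟨T, q, hT0, by linarith, hq0, ?_, ?_⟩
  · rw [le_div_iff₀ (by positivity)] at hT2; linarith
  · intro v h1 h2 x h3 h4
    rw [le_div_iff₀ (by positivity)] at hT3
    have h5 : P.gF * (P.VE - P.VF) = P.gL * P.VF := by unfold gF; field_simp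
    rw [P.J_eq]
    have c1 : x * (P.VE - P.VF) ≤ R * (P.VE - P.VF) := mul_le_mul_of_nonneg_right h4 hd.le
    have c2 : R * (P.VE - P.VF) = 3 / 4 * (P.gL * P.VF) := by rw [← h5, hR]; ring
    have c3 : (P.VF - v) * (P.gL + x) ≤ T * (P.gL + R) :=
      mul_le_mul (by linarith) (by linarith) (by linarith) hT0.le
    have c4 : -(x * (P.VE - v) - P.gL * v) = P.gL * P.VF - x * (P.VE - P.VF) - (P.VF - v) * (P.gL + x) := by ring
    rw [c4]
    linarith

variable {P}
theorem Near.M2 {T jm : ℝ} (N : P.Near T jm) : ∃ C1, 0 ≤ C1 ∧ ∀ v ∈ Ioo 0 P.VF, P.VF - T ≤ v →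
    ∀ ρ, 0 < ρ → ρ ≤ P.gF / 2 → ∫ x in ρ..(P.gF / 2), x * P.p v x ≤ C1 := by
  obtain ⟨C, hC0, hC⟩ := P.E1m
  have hjm := N.hjm
  have hgF := P.gF_pos
  refine ⟨C / jm^2, by positivity, ?_⟩
  intro v hv hvT ρ hρ hρX
  have h1 : ContinuousOn (P.p v) (Icc ρ (P.gF / 2)) := (P.p_cont hv).mono fun x hx => hρ.le.trans hx.1
  have h2 := (P.J_cont v).continuousOn (s := Icc ρ (P.gF / 2))
  have h3 : ContinuousOn (fun x => (max (-P.J v x) 0)^2 * x * P.p v x) (Icc ρ (P.gF / 2)) :=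
    (((h2.neg.sup continuousOn_const).pow 2).mul continuousOn_id).mul h1
  have h4 : ContinuousOn (fun x => x * P.p v x) (Icc ρ (P.gF / 2)) := continuousOn_id.mul h1
  have hp : ∀ x ∈ Icc ρ (P.gF / 2), 0 ≤ P.p v x := fun x hx => P.p_nonneg hv (hρ.le.trans hx.1)
  have h5 := ii_le_lint ENNReal.ofReal_lt_top (hC v hv) hρ hρX h3 (fun x hx =>
    mul_nonneg (mul_nonneg (sq_nonneg _) (hρ.le.trans hx.1)) (hp x hx))
  rw [ENNReal.toReal_ofReal hC0] at h5
  rw [le_div_iff₀ (by positivity), mul_comm]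
  refine le_trans ?_ h5
  rw [← intervalIntegral.integral_const_mul]
  refine intervalIntegral.integral_mono_on hρX ((ii_of_contOn hρX h4).const_mul _) (ii_of_contOn hρX h3) ?_
  intro x hx
  have hx0 := hρ.le.trans hx.1
  have q1 := N.hj v hvT hv.2.le x hx0 (by linarith [hx.2])
  have q2 : jm^2 ≤ (max (-P.J v x) 0)^2 := pow_le_pow_left₀ hjm.le (q1.trans (le_max_left _ _)) 2
  rw [mul_assoc]
  exact mul_le_mul_of_nonneg_right q2 (mul_nonneg hx0 (hp x hx))

set_option maxHeartbeats 1000000 in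
theorem Near.M3a {T jm : ℝ} (N : P.Near T jm) : ∃ K, 0 ≤ K ∧ ∀ v ∈ Ioo 0 P.VF, P.VF - T < v →
    ∀ ρ, 0 < ρ → ρ < P.gF / 2 →
      ∫ x in ρ..(P.gF / 2), ((x-ρ)^3*(P.gF/2-x)^3) * (-P.J v x * P.p v x) ≤ K * (P.VF - v) := by
  obtain ⟨C1, hC10, hC1⟩ := N.M2
  have hgF := P.gF_pos
  have hCC := P.CC_pos (R := 3 * P.gF / 4) (by positivity)
  have ha := P.ha; have hσ := P.hσ
  set X := P.gF / 2 with hX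
  have hX0 : 0 < X := by positivity
  set R := 3 * P.gF / 4 with hR
  set K0 := P.a / P.σ * (30 * X^3) + P.CC R * (6 * X^4) with hK0
  have hK0p : 0 ≤ K0 := by positivity
  refine ⟨K0 * C1, by positivity, ?_⟩
  intro v hv hvT ρ hρ hρX
  have hs : (-1:ℝ) * -1 = 1 := by norm_num
  have hVF := P.hVF
  have hTV := N.hTV
  have hw : ∀ t ∈ Ioo (-P.VF) (-P.VF + T), -1 * t ∈ Ioo 0 P.VF := by
    intro t ht; have := ht.1; have := ht.2
    constructor <;> linarith
  have hjs : ∀ t x, P.js (-1) t x = -P.J (-1 * t) x := by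
    intro t x
    have h2 := P.js_eq hs (-1 * t) x
    have h3 : (-1:ℝ) * (-1 * t) = t := by ring
    rw [h3] at h2
    linarith
  set S := P.sys (-1) hs (-P.VF) (-P.VF + T) (ρ/2) R jm (by linarith [N.hT]) (by linarith) (by linarith) N.hjm hw
    (by
      intro t ht x hx
      rw [hjs]
      exact N.hj _ (by linarith [ht.2]) (by linarith [ht.1]) x (by linarith [hx.1]) hx.2)
    (by have := N.hsm; rw [← hR] at this; linarith) with hS
  have hSj : ∀ t x, S.j t x = -P.J (-1 * t) x := fun t x => (hjs t x)
  have hSu : ∀ t x, S.u t x = P.p (-1 * t) x := fun t x => rfl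
  have hφ := cub_c2 ρ X ρ X
  have hTest := S.test_c2 hρX.le hφ (by simp) (by simp)
  set φ : ℝ → ℝ := fun x => (x-ρ)^3*(X-x)^3 with hφd
  set NN : ℝ → ℝ := fun t => ∫ x in ρ..X, φ x * (S.j t x * S.u t x) with hNN
  have hL : S.L < ρ := by show ρ / 2 < ρ; linarith
  have hRR : X < S.R := by show X < R; linarith
  have hder : ∀ t ∈ Ioo (-P.VF) (-P.VF + T), HasDerivAt NN (∫ x in ρ..X, φ x * S.Rr t x) t := fun t ht =>
    (S.all_good t ht).deriv hL hρX hRR hTest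
  have hbd : ∀ t ∈ Ioo (-P.VF) (-P.VF + T), ∫ x in ρ..X, φ x * S.Rr t x ≤ K0 * C1 := by
    intro t ht
    have hw2 := (P.slice (R := X) (hw t ht) hρ)
    have hb := S.byparts hρX.le hφ hw2
    have e : ∀ x, S.Lop (P.p (-1*t)) (P.pg (-1*t)) (P.pgg (-1*t)) x = S.Rr t x := fun x => rfl
    simp only [e] at hb
    rw [hb]
    simp only [sub_self]
    have hp : ∀ x ∈ Icc ρ X, 0 ≤ P.p (-1*t) x := fun x hx => P.p_nonneg (hw t ht) (hρ.le.trans hx.1)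
    have hM := hC1 (-1*t) (hw t ht) (by linarith [ht.2]) ρ hρ hρX.le
    have h4 : ContinuousOn (fun x => x * P.p (-1*t) x) (Icc ρ X) := continuousOn_id.mul hw2.cw
    have h5 : ContinuousOn (fun x => (S.A * (6*(x-ρ)*(X-x)^3 - 18*(x-ρ)^2*(X-x)^2 + 6*(x-ρ)^3*(X-x)) - S.b x * (3*(x-ρ)^2*(X-x)^3 - 3*(x-ρ)^3*(X-x)^2)) * P.p (-1*t) x) (Icc ρ X) :=
      ((continuousOn_const.mul hφ.c).sub (S.cb.continuousOn.mul hφ.cw1)).mul hw2.cw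
    have hmono : ∫ x in ρ..X, (S.A * (6*(x-ρ)*(X-x)^3 - 18*(x-ρ)^2*(X-x)^2 + 6*(x-ρ)^3*(X-x)) - S.b x * (3*(x-ρ)^2*(X-x)^3 - 3*(x-ρ)^3*(X-x)^2)) * P.p (-1*t) x ≤ ∫ x in ρ..X, K0 * (x * P.p (-1*t) x) := by
      refine intervalIntegral.integral_mono_on hρX.le (ii_of_contOn hρX.le h5) ((ii_of_contOn hρX.le h4).const_mul _) ?_
      intro x hx
      rw [← mul_assoc]
      refine mul_le_mul_of_nonneg_right ?_ (hp x hx)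
      obtain ⟨c1, c2⟩ := cub_bd hρ.le hx.1 hx.2
      have c3 := S.bbd (x := x) ⟨by linarith [hx.1], by linarith [hx.2]⟩
      have c4 : S.Cc = P.CC R := rfl
      have c5 : S.A = P.a / P.σ := rfl
      rw [c4] at c3
      rw [c5]
      have c6 := mul_le_mul_of_nonneg_left ((le_abs_self _).trans c2) (show 0 ≤ P.a / P.σ by positivity)
      have c7 := mul_le_mul c3 c1 (abs_nonneg _) hCC.le
      rw [← abs_mul] at c7
      have c8 := (neg_le_abs _).trans c7
      simp only [hK0]
      linarith
    rw [intervalIntegral.integral_const_mul] at hmono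
    have := mul_le_mul_of_nonneg_left hM hK0p
    have z : ((0:ℝ)^3) = 0 := by norm_num
    have z2 : ((0:ℝ)^2) = 0 := by norm_num
    simp only [hφd, sub_self, z, z2, mul_zero, zero_mul, add_zero, sub_zero]
    linarith
  -- decay at the end
  obtain ⟨Kg, hKg0, hKg⟩ := S.gap hL hρX.le hRR (n := 0) le_rfl
  have hgd : S.GapData (-P.VF) (-P.VF + T) 0 (fun _ => 0) (fun _ => 0) (fun _ => 0) := by
    refine ⟨le_rfl, by linarith [N.hT], le_rfl, fun t ht => S.all_good t ht, C2On.const 0 _ _, ?_, ?_⟩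
    · intro x hx; simp
    · intro x hx
      have hx1 : ρ / 2 ≤ x := hx.1
      have hx2 : x ≤ R := hx.2
      have hx0 : 0 < x := by linarith
      have hz : P.p P.VF x = 0 := by
        have h := (P.hp.bc_v_low x ⟨hx0, by
          have : P.gL * P.VF / (P.VE - P.VF) = P.gF := rfl
          rw [this]; linarith⟩).2
        have hJ := N.hj P.VF (by linarith [N.hT]) le_rfl x hx0.le hx2
        have hJ2 : P.J P.VF x ≠ 0 := by intro h0; rw [h0] at hJ; linarith [N.hjm]
        rcases mul_eq_zero.1 h with h | h
        · exact absurd h hJ2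
        · exact h
      have hc := P.hp.cont_v x (mem_Ici.2 hx0.le) P.VF ⟨hVF.le, le_rfl⟩
      rw [ContinuousWithinAt] at hc
      simp only [hz] at hc
      have hm : Tendsto (fun t : ℝ => -1 * t) (𝓝[>] (-P.VF)) (𝓝[Icc 0 P.VF] P.VF) := by
        refine tendsto_nhdsWithin_iff.2 ⟨?_, ?_⟩
        · have : Tendsto (fun t : ℝ => -1 * t) (𝓝 (-P.VF)) (𝓝 (-1 * -P.VF)) := (continuous_const.mul continuous_id).tendsto _
          rw [neg_one_mul, neg_neg] at this
          exact this.mono_left nhdsWithin_le_nhds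
        · filter_upwards [Ioo_mem_nhdsGT (show -P.VF < 0 by linarith)] with t ht
          exact ⟨by linarith [ht.2], by linarith [ht.1]⟩
      exact hc.comp hm
  have hgap := hKg _ _ _ _ _ hgd
  obtain ⟨Cφ, hCφ0, hCφ⟩ := contOn_bdd hφ.cw
  have hsmall : ∀ t ∈ Ioo (-P.VF) (-P.VF + T), NN t ≤ (Cφ * (P.CC R * Kg) * (X - ρ)) * (t + P.VF) := by
    intro t ht
    have cS := (S.c2 t ht).cw.mono (show Icc ρ X ⊆ Icc S.L S.R from Icc_subset_Icc hL.le hRR.le)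
    have c1 : ContinuousOn (fun x => φ x * (S.j t x * S.u t x)) (Icc ρ X) :=
      hφ.cw.mul ((S.cj t).continuousOn.mul cS)
    have := intervalIntegral.integral_mono_on hρX.le (ii_of_contOn hρX.le c1)
      (intervalIntegrable_const (c := Cφ * (P.CC R * (Kg * (t + P.VF))))) ?_
    · rw [intervalIntegral.integral_const, smul_eq_mul] at this
      simp only [hNN]
      refine this.trans (le_of_eq ?_); ring
    · intro x hx
      have hxx : x ∈ Icc S.L S.R := ⟨hL.le.trans hx.1, hx.2.trans hRR.le⟩
      have d1 := hgap t ht x hx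
      rw [sub_zero, sub_neg_eq_add] at d1
      have d2 := S.jub ht hxx
      have d3 := (S.jpos ht hxx).le
      have d4 := S.u_nonneg t ht x hxx
      have d5 : S.j t x * S.u t x ≤ P.CC R * (Kg * (t + P.VF)) :=
        mul_le_mul d2 ((le_abs_self _).trans d1) d4 hCC.le
      exact mul_le_mul ((le_abs_self _).trans (hCφ x hx)) d5 (mul_nonneg d3 d4) hCφ0
  have htv : -v ∈ Ioo (-P.VF) (-P.VF + T) := ⟨by linarith [hv.2], by linarith⟩
  have hMVT : ∀ t' ∈ Ioo (-P.VF) (-v), NN (-v) - NN t' ≤ K0 * C1 * (-v - t') := by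
    intro t' ht'
    have hsub : Icc t' (-v) ⊆ Ioo (-P.VF) (-P.VF + T) := fun y hy =>
      ⟨ht'.1.trans_le hy.1, hy.2.trans_lt htv.2⟩
    refine Convex.image_sub_le_mul_sub_of_deriv_le (convex_Icc t' (-v))
      (fun y hy => (hder y (hsub hy)).continuousAt.continuousWithinAt)
      (fun y hy => (hder y (hsub (interior_subset hy))).differentiableAt.differentiableWithinAt)
      (fun y hy => ?_) t' ⟨le_rfl, ht'.2.le⟩ (-v) ⟨ht'.2.le, le_rfl⟩ ht'.2.le
    rw [(hder y (hsub (interior_subset hy))).deriv]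
    exact hbd y (hsub (interior_subset hy))
  have hfin : NN (-v) ≤ K0 * C1 * (P.VF - v) := by
    refine le_of_forall_pos_le_add fun ε hε => ?_
    set M := (Cφ * (P.CC R * Kg) * (X - ρ)) with hM
    have hM0 : 0 ≤ M := by
      have : 0 ≤ X - ρ := by linarith
      positivity
    obtain ⟨h, hh⟩ := exists_between (show 0 < min (P.VF - v) (ε / (M + 1)) from
      lt_min (by linarith [hv.2]) (by positivity))
    have hh1 : h < P.VF - v := hh.2.trans_le (min_le_left _ _)
    have hh2 : h < ε / (M + 1) := hh.2.trans_le (min_le_right _ _)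
    rw [lt_div_iff₀ (by positivity)] at hh2
    have k1 := hMVT (-P.VF + h) ⟨by linarith [hh.1], by linarith⟩
    have k2 := hsmall (-P.VF + h) ⟨by linarith [hh.1], by linarith⟩
    have k3 : -P.VF + h + P.VF = h := by ring
    rw [k3] at k2
    have k4 : K0 * C1 * (-v - (-P.VF + h)) ≤ K0 * C1 * (P.VF - v) :=
      mul_le_mul_of_nonneg_left (by linarith [hh.1]) (by positivity)
    have := hh.1
    linarith
  refine le_trans (le_of_eq ?_) hfin
  simp only [hNN, hSj, hSu, hφd]
  have e : (-1:ℝ) * -v = v := by ring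
  rw [e]

end App

namespace App
variable {P : App}

theorem Near.M3 {T jm : ℝ} (N : P.Near T jm) : ∃ C3, 0 ≤ C3 ∧ ∀ v ∈ Ioo 0 P.VF, P.VF - T < v →
    ∀ m, 0 < m → m ≤ P.gF / 4 → ∫ x in m..(P.gF / 4), x * P.p v x ≤ C3 * (P.VF - v) / m^2 := by
  obtain ⟨K, hK0, hK⟩ := N.M3a
  have hjm := N.hjm
  have hgF := P.gF_pos
  set Y := P.gF / 4 with hY
  have hY0 : 0 < Y := by positivity
  refine ⟨8 * K / (Y^3 * jm), by positivity, ?_⟩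
  intro v hv hvT m hm hmY
  have h := hK v hv hvT (m/2) (by linarith) (by linarith)
  set X := P.gF / 2 with hX
  have hXY : X = 2 * Y := by rw [hX, hY]; ring
  have h1 : ContinuousOn (P.p v) (Icc (m/2) X) := (P.p_cont hv).mono fun x hx => (by linarith : 0 ≤ m/2).trans hx.1
  have h2 := (P.J_cont v).continuousOn (s := Icc (m/2) X)
  have hp : ∀ x ∈ Icc (m/2) X, 0 ≤ P.p v x := fun x hx => P.p_nonneg hv ((by linarith : 0 ≤ m/2).trans hx.1)
  have hJ : ∀ x ∈ Icc (m/2) X, jm ≤ -P.J v x := fun x hx =>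
    N.hj v hvT.le hv.2.le x ((by linarith : 0 ≤ m/2).trans hx.1) (by linarith [hx.2])
  have h3 : ContinuousOn (fun x => ((x-m/2)^3*(X-x)^3) * (-P.J v x * P.p v x)) (Icc (m/2) X) :=
    (Continuous.continuousOn (by fun_prop)).mul (h2.neg.mul h1)
  have hmX : m / 2 ≤ X := by linarith
  have i3 := ii_of_contOn hmX h3
  have hmono := intervalIntegral.integral_mono_interval (c := m/2) (d := X) (a := m) (b := Y) (by linarith) hmY (by linarith)
    (f := fun x => ((x-m/2)^3*(X-x)^3) * (-P.J v x * P.p v x)) (μ := volume) ?_ i3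
  · have hsub : Icc m Y ⊆ Icc (m/2) X := Icc_subset_Icc (by linarith) (by linarith)
    have h4 : ContinuousOn (fun x => x * P.p v x) (Icc m Y) := continuousOn_id.mul (h1.mono hsub)
    have hm2 := intervalIntegral.integral_mono_on hmY ((ii_of_contOn hmY h4).const_mul (m^2 * (Y^3 * jm) / 8))
      (ii_of_contOn hmY (h3.mono hsub)) ?_
    · rw [intervalIntegral.integral_const_mul] at hm2
      have h5 := hm2.trans (hmono.trans h)
      have e : 8 * K / (Y^3 * jm) * (P.VF - v) / m^2 = K * (P.VF - v) / (m^2 * (Y^3 * jm) / 8) := by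
        field_simp
      rw [e, le_div_iff₀ (by positivity), mul_comm]
      exact h5
    · intro x hx
      have hx0 : 0 < x := hm.trans_le hx.1
      have c1 : x / 2 ≤ x - m / 2 := by linarith [hx.1]
      have c2 : Y ≤ X - x := by linarith [hx.2]
      have d1 : 0 ≤ x - m / 2 := by linarith
      have d2 : 0 ≤ X - x := by linarith
      have c3 : (x/2)^3 ≤ (x - m/2)^3 := pow_le_pow_left₀ (by positivity) c1 3
      have c4 : Y^3 ≤ (X - x)^3 := pow_le_pow_left₀ (by positivity) c2 3
      have c5 : m^2 ≤ x^2 := pow_le_pow_left₀ hm.le hx.1 2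
      have hpx := hp x (hsub hx)
      have c6 : jm * P.p v x ≤ -P.J v x * P.p v x := mul_le_mul_of_nonneg_right (hJ x (hsub hx)) hpx
      have c7 : (x/2)^3 * Y^3 ≤ (x - m/2)^3 * (X-x)^3 := mul_le_mul c3 c4 (by positivity) (by positivity)
      have c8 : (x/2)^3 * Y^3 * (jm * P.p v x) ≤ (x - m/2)^3 * (X-x)^3 * (-P.J v x * P.p v x) :=
        mul_le_mul c7 c6 (by positivity) (by positivity)
      refine le_trans ?_ c8
      have c9 := mul_le_mul_of_nonneg_right c5 (show 0 ≤ x * (Y^3 * jm * P.p v x) / 8 by positivity)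
      calc _ = m^2 * (x * (Y^3 * jm * P.p v x) / 8) := by ring
        _ ≤ _ := c9
        _ = _ := by ring
  · filter_upwards [ae_restrict_mem measurableSet_Ioc] with x hx
    have hx' := Ioc_subset_Icc_self hx
    have c1 : 0 ≤ x - m/2 := by linarith [hx.1]
    have c2 : 0 ≤ X - x := by linarith [hx.2]
    have c3 := hp x hx'
    have c4 : 0 ≤ -P.J v x := hjm.le.trans (hJ x hx')
    show 0 ≤ ((x-m/2)^3*(X-x)^3) * (-P.J v x * P.p v x)
    positivity

theorem small_H (c η : ℝ) (hc : 0 < c) (hη : 0 < η) :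
    ∃ v ∈ Ioo 0 P.VF, P.VF - η < v ∧ P.Hl v < ⊤ ∧ (P.VF - v) * P.Hr v ≤ c := by
  by_contra hcon
  push Not at hcon
  set v1 := max 0 (P.VF - η) with hv1
  have hV := P.hVF
  have hv1V : v1 < P.VF := max_lt hV (by linarith)
  have hsub : Ioo v1 P.VF ⊆ Ioo 0 P.VF := Ioo_subset_Ioo (le_max_left _ _) le_rfl
  have hi : IntegrableOn (fun v => (v - P.VF)⁻¹) (Ioo v1 P.VF) := by
    refine Integrable.mono' ((P.Hr_int.mono_set hsub).const_mul (1/c)) ?_ ?_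
    · exact (by fun_prop : Measurable fun v : ℝ => (v - P.VF)⁻¹).aestronglyMeasurable
    · filter_upwards [ae_restrict_of_ae_restrict_of_subset hsub P.Hl_fin, ae_restrict_mem measurableSet_Ioo] with v hf hv
      have h1 := hcon v (hsub hv) ((le_max_right _ _).trans_lt hv.1) hf
      have h2 : 0 < P.VF - v := by linarith [hv.2]
      have hHp : 0 < P.Hr v := (mul_pos_iff_of_pos_left h2).1 (hc.trans h1)
      rw [norm_inv, norm_eq_abs, abs_sub_comm, abs_of_pos h2, inv_le_comm₀ h2 (mul_pos (one_div_pos.2 hc) hHp)]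
      rw [mul_inv, one_div, inv_inv, ← div_eq_mul_inv, div_le_iff₀ hHp]
      exact h1.le
  have h2 : IntervalIntegrable (fun v => (v - P.VF)⁻¹) volume v1 P.VF := by
    rw [intervalIntegrable_iff_integrableOn_Ioo_of_le hv1V.le]; exact hi
  rcases intervalIntegrable_sub_inv_iff.1 h2 with h | h
  · exact absurd h hv1V.ne
  · exact h right_mem_uIcc

theorem Near.M4 {T jm : ℝ} (N : P.Near T jm) (κ η : ℝ) (hκ : 0 < κ) (hη : 0 < η) :
    ∃ v ∈ Ioo 0 P.VF, P.VF - η < v ∧ ∀ ρ, 0 < ρ → ρ ≤ P.gF / 4 → ∫ x in ρ..(P.gF / 4), x * P.p v x ≤ κ := by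
  obtain ⟨C0, hC00, hC0⟩ := N.M3
  obtain ⟨CM, hCM0, hCM⟩ := P.p_le_H
  have hgF := P.gF_pos
  have hgin := P.hgin
  set C3 := C0 + 1 with hC3
  have hC3p : 0 < C3 := by linarith
  set Y := P.gF / 4 with hY
  set m0 := min (P.gin / 2) Y with hm0
  have hm0p : 0 < m0 := lt_min (by positivity) (by positivity)
  set η' := min (min η T) (κ * m0^2 / (2 * C3)) with hη'
  have hη'0 : 0 < η' := lt_min (lt_min hη N.hT) (by positivity)
  obtain ⟨v, hv, hvη, hf, hH⟩ := small_H (P := P) (κ^2 / (4 * C3 * (CM + 1))) η' (by positivity) hη'0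
  have e1 : η' ≤ η := (min_le_left _ _).trans (min_le_left _ _)
  have e2 : η' ≤ T := (min_le_left _ _).trans (min_le_right _ _)
  have e3 : η' ≤ κ * m0^2 / (2 * C3) := min_le_right _ _
  refine ⟨v, hv, by linarith, ?_⟩
  intro ρ hρ hρY
  set τ := P.VF - v with hτ
  have hτ0 : 0 < τ := by linarith [hv.2]
  set m := Real.sqrt (2 * C3 * τ / κ) with hm
  have hmp : 0 < m := Real.sqrt_pos.2 (by positivity)
  have hmsq : m^2 = 2 * C3 * τ / κ := Real.sq_sqrt (by positivity)
  have hmm0 : m ≤ m0 := by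
    rw [hm]
    refine Real.sqrt_le_iff.2 ⟨hm0p.le, ?_⟩
    rw [div_le_iff₀ hκ]
    have : τ ≤ κ * m0^2 / (2 * C3) := by linarith
    rw [le_div_iff₀ (by positivity)] at this
    linarith
  have hmY : m ≤ Y := hmm0.trans (min_le_right _ _)
  have hmg : m ≤ P.gin / 2 := hmm0.trans (min_le_left _ _)
  have hA : ∀ r, m ≤ r → r ≤ Y → ∫ x in r..Y, x * P.p v x ≤ κ / 2 := by
    intro r h1 h2
    have hr : 0 < r := hmp.trans_le h1
    refine (hC0 v hv (by linarith) r hr h2).trans ?_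
    rw [div_le_iff₀ (by positivity)]
    have c1 : m^2 ≤ r^2 := pow_le_pow_left₀ hmp.le h1 2
    have c2 : κ / 2 * m^2 = C3 * τ := by rw [hmsq]; field_simp
    have c3 := mul_le_mul_of_nonneg_left c1 (show 0 ≤ κ / 2 by positivity)
    have c4 : C0 * (P.VF - v) ≤ C3 * τ := mul_le_mul_of_nonneg_right (by linarith) hτ0.le
    linarith
  rcases le_total m ρ with h | h
  · linarith [hA ρ h hρY]
  · have hc : ContinuousOn (fun x => x * P.p v x) (Icc ρ Y) :=
      continuousOn_id.mul ((P.p_cont hv).mono fun x hx => hρ.le.trans hx.1)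
    have i1 := ii_of_contOn h (hc.mono (Icc_subset_Icc le_rfl hmY))
    have i2 := ii_of_contOn hmY (hc.mono (Icc_subset_Icc h le_rfl))
    rw [← intervalIntegral.integral_add_adjacent_intervals i1 i2]
    have hB : ∫ x in ρ..m, x * P.p v x ≤ κ / 2 := by
      have hHr := P.Hr_nonneg v
      have h1 := intervalIntegral.integral_mono_on h i1 (intervalIntegrable_const (c := m * (CM * P.Hr v))) ?_
      · rw [intervalIntegral.integral_const, smul_eq_mul] at h1
        refine h1.trans ?_
        have c1 : (m - ρ) * (m * (CM * P.Hr v)) ≤ m * (m * (CM * P.Hr v)) :=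
          mul_le_mul_of_nonneg_right (by linarith) (by positivity)
        refine c1.trans ?_
        have c2 : m * (m * (CM * P.Hr v)) = 2 * C3 * CM / κ * (τ * P.Hr v) := by
          calc _ = m^2 * (CM * P.Hr v) := by ring
            _ = _ := by rw [hmsq]; ring
        rw [c2]
        refine (mul_le_mul_of_nonneg_left hH (by positivity)).trans ?_
        rw [div_mul_div_comm, div_le_div_iff₀ (by positivity) (by norm_num)]
        have : 0 ≤ C3 * κ^2 := by positivity
        nlinarith
      · intro x hx
        have hx0 : 0 < x := hρ.trans_le hx.1
        exact mul_le_mul hx.2 (hCM v hv hf x hx0 (hx.2.trans hmg)) (P.p_nonneg hv hx0.le) hmp.le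
    linarith [hA m le_rfl hmY]

end App

theorem zeta_c2 {δ : ℝ} (hδ : 0 < δ) (ρ G : ℝ) : C2On (fun x => (x-ρ)/(x-ρ+δ)) (fun x => δ/(x-ρ+δ)^2)
    (fun x => -2*δ/(x-ρ+δ)^3) ρ G := by
  have h1 : ∀ x : ℝ, HasDerivAt (fun x => x - ρ) 1 x := fun x => (hasDerivAt_id x).sub_const _
  have h2 : ∀ x : ℝ, HasDerivAt (fun x => x - ρ + δ) 1 x := fun x => (h1 x).add_const _
  have hp : ∀ x ∈ Icc ρ G, 0 < x - ρ + δ := fun x hx => by linarith [hx.1]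
  refine ⟨fun x hx => ?_, fun x hx => ?_, ?_⟩
  · have := (hp x hx).ne'
    refine ((h1 x).div (h2 x) this).congr_deriv ?_
    field_simp; ring
  · have := (hp x hx).ne'
    refine ((hasDerivAt_const x δ).div ((h2 x).pow 2) (pow_ne_zero 2 this)).congr_deriv ?_
    simp only [Pi.pow_apply]
    field_simp; norm_num; ring
  · refine ContinuousOn.div continuousOn_const (Continuous.continuousOn (by fun_prop)) ?_
    intro x hx
    exact pow_ne_zero 3 (hp x hx).ne'

theorem zeta_bd {δ ρ x : ℝ} (hδ : 0 < δ) (hx : ρ ≤ x) :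
    0 ≤ (x-ρ)/(x-ρ+δ) ∧ (x-ρ)/(x-ρ+δ) ≤ 1 ∧ (x-ρ)/(x-ρ+δ) ≤ (x-ρ)/δ := by
  have h0 : 0 ≤ x - ρ := by linarith
  refine ⟨by positivity, ?_, ?_⟩
  · rw [div_le_one (by positivity)]; linarith
  · exact div_le_div_of_nonneg_left h0 hδ (by linarith)

namespace App
variable (P : App)

theorem eta_p_cont (k : ℝ) {ρ : ℝ} (hρ : 0 ≤ ρ) :
    ContinuousOn (fun w => etaK.f (P.p w ρ - k)) (Icc 0 P.VF) :=
  etaK.cf.comp_continuousOn ((P.hp.cont_v ρ (mem_Ici.2 hρ)).sub continuousOn_const)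

theorem eta_p_le {k : ℝ} (hk : 0 ≤ k) {v x : ℝ} (hv : v ∈ Ioo 0 P.VF) (hx : 0 ≤ x) :
    etaK.f (P.p v x - k) ≤ P.p v x := by
  have := P.p_nonneg hv hx
  exact (etaK_le _).trans (max_le (by linarith) this)

theorem F_small {k : ℝ} (hk0 : 0 ≤ k) (hk : ∀ w ∈ Ioo 0 P.VF, P.p w 0 ≤ k) (δ r : ℝ) (hδ : 0 < δ) (hr : 0 < r) :
    ∃ ρ, 0 < ρ ∧ ρ < r ∧ ∫ w in Ioo 0 P.VF, etaK.f (P.p w ρ - k) ≤ δ := by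
  obtain ⟨CM, hCM0, hCM⟩ := P.p_le_H
  have hgin := P.hgin
  set m := min (P.gin / 2) r with hm
  have hm0 : 0 < m := lt_min (by positivity) hr
  set ρ : ℕ → ℝ := fun n => m * (1 / ((n:ℝ) + 2)) with hρ
  have hρ0 : ∀ n, 0 < ρ n := fun n => by simp only [hρ]; positivity
  have hρm : ∀ n, ρ n < m := fun n => by
    have : 1 / ((n:ℝ) + 2) < 1 := by
      rw [div_lt_one (by positivity)]
      have : (0:ℝ) ≤ n := Nat.cast_nonneg n
      linarith
    simp only [hρ]
    nlinarith
  have hρl : Tendsto ρ atTop (𝓝 0) := by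
    have h := seq_tendsto.const_mul m
    rw [mul_zero] at h
    exact h
  have hT : Tendsto (fun n => ∫ w in Ioo 0 P.VF, etaK.f (P.p w (ρ n) - k)) atTop
      (𝓝 (∫ w in Ioo 0 P.VF, (0:ℝ))) := by
    refine tendsto_integral_of_dominated_convergence (fun w => CM * P.Hr w) ?_ (P.Hr_int.const_mul CM) ?_ ?_
    · intro n
      exact ((P.eta_p_cont k (hρ0 n).le).mono Ioo_subset_Icc_self).aestronglyMeasurable measurableSet_Ioo
    · intro n
      filter_upwards [P.Hl_fin, ae_restrict_mem measurableSet_Ioo] with w hf hw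
      rw [norm_eq_abs, abs_of_nonneg (etaK_nonneg _)]
      exact (P.eta_p_le hk0 hw (hρ0 n).le).trans (hCM w hw hf _ (hρ0 n) ((hρm n).le.trans (min_le_left _ _)))
    · filter_upwards [ae_restrict_mem measurableSet_Ioo] with w hw
      have h1 : Tendsto (fun n => P.p w (ρ n)) atTop (𝓝 (P.p w 0)) := by
        refine ((P.p_cont hw) 0 (mem_Ici.2 le_rfl)).tendsto.comp (tendsto_nhdsWithin_iff.2 ⟨hρl, ?_⟩)
        exact Eventually.of_forall fun n => mem_Ici.2 (hρ0 n).le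
      have h2 := (etaK.cf.tendsto (P.p w 0 - k)).comp (h1.sub_const k)
      rw [etaK_of_nonpos (by linarith [hk w hw])] at h2
      exact h2
  rw [integral_zero] at hT
  obtain ⟨n, hn⟩ := ((tendsto_order.1 hT).2 δ hδ).exists
  exact ⟨ρ n, hρ0 n, (hρm n).trans_le (min_le_right _ _), hn.le⟩

theorem Jm_le {v x : ℝ} (hv : v ∈ Ioo 0 P.VF) (hx : 0 ≤ x) : max (-P.J v x) 0 ≤ P.gL * P.VF := by
  have h1 := P.hgL; have h2 := P.hVF; have h3 := P.hVE
  refine max_le ?_ (by positivity)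
  rw [P.J_eq]
  have q1 : 0 ≤ x * (P.VE - v) := mul_nonneg hx (by linarith [hv.2])
  have q2 : P.gL * v ≤ P.gL * P.VF := mul_le_mul_of_nonneg_left hv.2.le h1.le
  linarith

/-- initial bound -/
theorem Y0_bd {C0 : ℝ} (hC00 : 0 ≤ C0) (hC0 : ∀ v ∈ Ioo 0 P.VF,
    ∫⁻ x in Ioi (0:ℝ), ENNReal.ofReal ((max (-P.J v x) 0)^2 * x * P.p v x) ≤ ENNReal.ofReal C0)
    {v δ ε ρ k : ℝ} (hv : v ∈ Ioo 0 P.VF) (hδ : 0 < δ) (hε : 0 < ε) (hρ : 0 < ρ) (hρF : ρ < P.gF / 4) (hk : 0 ≤ k)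
    (hM : ∫ x in ρ..(P.gF / 4), x * P.p v x ≤ δ) :
    P.Yf (-1) ε (fun x => (x-ρ)/(x-ρ+δ)) etaK 1 k ρ (P.gF + 1) (-1 * v) ≤
      (P.gL * P.VF)^2 + C0 / (P.gF / 4) := by
  have hs : (-1:ℝ) * -1 = 1 := by norm_num
  have hgL := P.hgL; have hVF := P.hVF
  rw [P.Yf_eq hs]
  have hgF := P.gF_pos
  set Y := P.gF / 4 with hY
  have hY0 : 0 < Y := by positivity
  have hYG : Y ≤ P.gF + 1 := by linarith
  have hζ := zeta_c2 hδ ρ (P.gF + 1)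
  have hc := P.Yint_cont (s := -1) hv hε etaK k hρ hζ
  have hpc : ContinuousOn (P.p v) (Icc ρ (P.gF + 1)) := (P.p_cont hv).mono fun x hx => hρ.le.trans hx.1
  have i1 := ii_of_contOn hρF.le (hc.mono (Icc_subset_Icc le_rfl hYG))
  have i2 := ii_of_contOn hYG (hc.mono (Icc_subset_Icc hρF.le le_rfl))
  rw [← intervalIntegral.integral_add_adjacent_intervals i1 i2]
  have hpt : ∀ x ∈ Icc ρ (P.gF + 1), th ε (-1 * P.J v x) * ((x-ρ)/(x-ρ+δ)) * (-1 * P.J v x) * etaK.f (P.p v x - k) ≤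
      (max (-P.J v x) 0)^2 * ((x-ρ)/(x-ρ+δ)) * P.p v x := by
    intro x hx
    have hx0 : 0 ≤ x := hρ.le.trans hx.1
    obtain ⟨z1, z2, z3⟩ := zeta_bd hδ hx.1
    have t1 := th_mul_le hε (-1 * P.J v x)
    have t2 := th_mul_nonneg hε (-1 * P.J v x)
    rw [neg_one_mul] at *
    have e1 := P.eta_p_le hk hv hx0
    have m1 := mul_le_mul_of_nonneg_right t1 z1
    have m2 := mul_le_mul m1 e1 (etaK_nonneg _) (mul_nonneg (sq_nonneg _) z1)
    refine le_trans (le_of_eq ?_) m2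
    ring
  have hA := intervalIntegral.integral_mono_on hρF.le i1
    ((ii_of_contOn hρF.le ((continuousOn_id.mul hpc).mono (Icc_subset_Icc le_rfl hYG))).const_mul ((P.gL * P.VF)^2 / δ)) ?_
  · have hB3 : ContinuousOn (fun x => (max (-P.J v x) 0)^2 * x * P.p v x) (Icc Y (P.gF + 1)) :=
      ((((P.J_cont v).continuousOn.neg.sup continuousOn_const).pow 2).mul continuousOn_id).mul
        (hpc.mono (Icc_subset_Icc hρF.le le_rfl))
    have hB := intervalIntegral.integral_mono_on hYG i2 ((ii_of_contOn hYG hB3).const_mul (1 / Y)) ?_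
    · have hB2 := ii_le_lint ENNReal.ofReal_lt_top (hC0 v hv) hY0 hYG hB3 (fun x hx =>
        mul_nonneg (mul_nonneg (sq_nonneg _) (hY0.le.trans hx.1)) (P.p_nonneg hv (hY0.le.trans hx.1)))
      rw [ENNReal.toReal_ofReal hC00] at hB2
      rw [intervalIntegral.integral_const_mul] at hA hB
      have hA2 := mul_le_mul_of_nonneg_left hM (show 0 ≤ (P.gL * P.VF)^2 / δ by positivity)
      have hA3 : (P.gL * P.VF)^2 / δ * δ = (P.gL * P.VF)^2 := by field_simp
      have hB4 := mul_le_mul_of_nonneg_left hB2 (show 0 ≤ 1 / Y by positivity)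
      have hB5 : 1 / Y * C0 = C0 / Y := by ring
      rw [hA3] at hA2
      rw [hB5] at hB4
      exact add_le_add (hA.trans hA2) (hB.trans hB4)
    · intro x hx
      have hx' : x ∈ Icc ρ (P.gF + 1) := ⟨hρF.le.trans hx.1, hx.2⟩
      have hx0 : 0 ≤ x := hY0.le.trans hx.1
      obtain ⟨z1, z2, z3⟩ := zeta_bd hδ hx'.1
      refine (hpt x hx').trans ?_
      have z4 : (x-ρ)/(x-ρ+δ) ≤ 1 / Y * x := by
        refine z2.trans ?_
        rw [one_div, ← div_eq_inv_mul, one_le_div hY0]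
        exact hx.1
      have m1 := mul_le_mul_of_nonneg_right (mul_le_mul_of_nonneg_left z4 (sq_nonneg (max (-P.J v x) 0))) (P.p_nonneg hv hx0)
      refine m1.trans (le_of_eq ?_)
      ring
  · intro x hx
    have hx' : x ∈ Icc ρ (P.gF + 1) := ⟨hx.1, hx.2.trans hYG⟩
    have hx0 : 0 ≤ x := hρ.le.trans hx.1
    obtain ⟨z1, z2, z3⟩ := zeta_bd hδ hx'.1
    refine (hpt x hx').trans ?_
    have z4 : (x-ρ)/(x-ρ+δ) ≤ x / δ := z3.trans (div_le_div_of_nonneg_right (by linarith) hδ.le)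
    have z5 : (max (-P.J v x) 0)^2 ≤ (P.gL * P.VF)^2 := pow_le_pow_left₀ (le_max_right _ _) (P.Jm_le hv hx0) 2
    have m1 := mul_le_mul_of_nonneg_right (mul_le_mul z5 z4 z1 (sq_nonneg _)) (P.p_nonneg hv hx0)
    refine m1.trans (le_of_eq ?_)
    simp only [Pi.mul_apply, id_eq]
    ring

set_option maxHeartbeats 1000000 in
theorem E2_step : ∃ k C, 0 ≤ k ∧ 0 ≤ C ∧ ∀ v ∈ Ioo 0 P.VF, ∀ δ, 0 < δ → ∃ ρ, 0 < ρ ∧ ρ < δ ∧ ρ < P.gF / 4 ∧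
    P.Yf (-1) δ (fun x => (x-ρ)/(x-ρ+δ)) etaK 1 k ρ (P.gF + 1) (-1 * v) ≤ C := by
  obtain ⟨B, hB⟩ := P.p_bdd (x := 0) le_rfl
  obtain ⟨C0, hC00, hC0⟩ := P.E1m
  obtain ⟨T, jm, N⟩ := P.exists_near
  have hgF := P.gF_pos
  have hgL := P.hgL; have hVF := P.hVF; have hVE := P.hVE; have ha := P.ha; have hσ := P.hσ; have hgin := P.hgin
  have hVE0 : 0 < P.VE := hVF.trans hVE
  have hs : (-1:ℝ) * -1 = 1 := by norm_num
  set k := |B| with hk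
  have hk0 : 0 ≤ k := abs_nonneg B
  have hkB : ∀ w ∈ Ioo 0 P.VF, P.p w 0 ≤ k := fun w hw => (hB w hw).trans (le_abs_self B)
  set G := P.gF + 1 with hG
  have hG0 : 0 < G := by linarith
  set C2 := (((P.VE * G + P.gL * P.VF) * (G + P.gin) + P.VE * P.a) / (P.a * P.σ) + (1 / (P.σ * P.gL) + 1)) with hC2
  have hC20 : 0 ≤ C2 := by positivity
  set D := P.a / P.σ * (P.gL * P.VF) with hD
  have hD0 : 0 ≤ D := by positivity
  have hHr : 0 ≤ ∫ v in Ioo 0 P.VF, P.Hr v := integral_nonneg fun v => P.Hr_nonneg v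
  refine ⟨k, ((P.gL * P.VF)^2 + C0 / (P.gF / 4)) + (C2 * (∫ v in Ioo 0 P.VF, P.Hr v) + D), hk0, by positivity, ?_⟩
  intro v hv δ hδ
  obtain ⟨v0, hv0, hvv0, hM⟩ := N.M4 δ (P.VF - v) hδ (by linarith [hv.2])
  obtain ⟨ρ, hρ, hρr, hF⟩ := P.F_small hk0 hkB δ (min δ (P.gF / 4)) hδ (lt_min hδ (by positivity))
  have hρδ : ρ < δ := hρr.trans_le (min_le_left _ _)
  have hρF : ρ < P.gF / 4 := hρr.trans_le (min_le_right _ _)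
  have hρG : ρ < G := by linarith
  refine ⟨ρ, hρ, hρδ, hρF, ?_⟩
  have hY0 := P.Y0_bd hC00 hC0 hv0 hδ hδ hρ hρF hk0 (hM ρ hρ hρF.le)
  have hζ := zeta_c2 hδ ρ G
  have hjG : ∀ t, -1 * t ∈ Ioo 0 P.VF → P.js (-1) t G ≤ 0 := by
    intro t ht
    have h1 := P.J_nonneg ht (show P.gF ≤ G by linarith)
    have h2 := P.js_eq hs (-1 * t) G
    have h3 : (-1:ℝ) * (-1 * t) = t := by ring
    rw [h3] at h2
    linarith
  have hζρ : (ρ - ρ) / (ρ - ρ + δ) = 0 := by simp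
  have iη : IntegrableOn (fun w => etaK.f (P.p w ρ - k)) (Ioo 0 P.VF) :=
    ((P.eta_p_cont k hρ.le).integrableOn_Icc).mono_set Ioo_subset_Icc_self
  have i1 : IntegrableOn (fun w => C2 * P.Hr w) (Ioo 0 P.VF) := P.Hr_int.const_mul C2
  have i2 : IntegrableOn (fun w => D / δ * etaK.f (P.p w ρ - k)) (Ioo 0 P.VF) := iη.const_mul (D / δ)
  have hmaster := P.master hs (ε := δ) hδ hρ hρG hζ (fun x hx => (zeta_bd hδ hx.1).1)
    (fun t ht => by unfold Wt; simp only [hζρ, mul_zero])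
    (fun t ht => by
      unfold Wt
      rw [th_zero ((hjG t ht).trans hδ.le), zero_mul]) etaK 1 k
    (Hb := fun w => C2 * P.Hr w + D / δ * etaK.f (P.p w ρ - k)) ?_ ?_ ?_ hv0 hv (by linarith)
  · rw [integral_add i1 i2, integral_const_mul, integral_const_mul] at hmaster
    have h1 : D / δ * ∫ w in Ioo 0 P.VF, etaK.f (P.p w ρ - k) ≤ D := by
      refine (mul_le_mul_of_nonneg_left hF (by positivity)).trans (le_of_eq ?_)
      field_simp
    linarith
  · intro w hw
    have := P.Hr_nonneg w
    have := etaK_nonneg (P.p w ρ - k)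
    positivity
  · exact i1.add i2
  · filter_upwards [P.Hl_fin, ae_restrict_mem measurableSet_Ioo] with w hf hw
    have e : (-1:ℝ) * (-1 * w) = w := by ring
    have hτ : (-1:ℝ) * (-1 * w) ∈ Ioo 0 P.VF := by rwa [e]
    have h := P.slopeE2 hτ (ε := δ) hδ hρ hρG hζ (fun x hx => ⟨(zeta_bd hδ hx.1).1, (zeta_bd hδ hx.1).2.1⟩)
      (fun x hx => by have := hx.1; positivity)
      (fun x hx => by
        have h1 : 0 < x - ρ + δ := by linarith [hx.1]
        rw [neg_mul, neg_div]
        exact neg_nonpos.2 (by positivity)) hζρ (hjG _ hτ) hk0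
    rw [e] at h
    refine h.trans ?_
    have h2 := mul_le_mul_of_nonneg_left (P.hd_le hw hf hρ hρG.le) hC20
    have h3 : D * (δ / (ρ - ρ + δ)^2) * etaK.f (P.p w ρ - k) = D / δ * etaK.f (P.p w ρ - k) := by
      congr 1
      rw [sub_self, zero_add]; field_simp
    rw [h3]
    linarith

theorem E2m : ∃ C, ∀ v ∈ Ioo 0 P.VF,
    ∫⁻ x in Ioi (0:ℝ), ENNReal.ofReal ((max (-P.J v x) 0)^2 * P.p v x) ≤ ENNReal.ofReal C := by
  obtain ⟨k, C, hk0, hC0, hC⟩ := P.E2_step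
  have hgF := P.gF_pos
  have hs : (-1:ℝ) * -1 = 1 := by norm_num
  set M := (P.gL * P.VF)^2 * (k + 3) with hM
  have hM0 : 0 ≤ M := by positivity
  refine ⟨C + M * P.gF, ?_⟩
  intro v hv
  set ε : ℕ → ℝ := fun n => 1 / ((n:ℝ) + 2) with hεd
  have hε : ∀ n, 0 < ε n := fun n => by simp only [hεd]; positivity
  have hεl : Tendsto ε atTop (𝓝 0) := seq_tendsto
  choose ρ hρ hρε hρF hY using fun n => hC v hv (ε n) (hε n)
  have hρl : Tendsto ρ atTop (𝓝 0) := squeeze_zero (fun n => (hρ n).le) (fun n => (hρε n).le) hεl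
  set G := P.gF + 1 with hG
  have hρG : ∀ n, ρ n < G := fun n => by have := hρF n; linarith
  have hFat : ∫⁻ x in Ioi (0:ℝ), ENNReal.ofReal ((max (-P.J v x) 0)^2 * etaK.f (P.p v x - k)) ≤ ENNReal.ofReal C := by
    refine fatou_ii (ρ := ρ) (G := fun _ => G) (F := fun n x => th (ε n) (-1 * P.J v x) * ((x - ρ n) / (x - ρ n + ε n)) * (-1 * P.J v x) * etaK.f (P.p v x - k))
      (fun n => (hρG n).le) (fun n => P.Yint_cont hv (hε n) etaK k (hρ n) (zeta_c2 (hε n) (ρ n) G)) ?_ ?_ ?_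
    · intro n x hx
      have q1 := th_mul_nonneg (hε n) (-1 * P.J v x)
      have q2 := (zeta_bd (hε n) hx.1).1
      refine mul_nonneg ?_ (etaK_nonneg _)
      have := mul_nonneg q1 q2
      linarith
    · intro n
      rw [← P.Yf_eq hs]
      exact hY n
    · intro x hx
      have hx : 0 < x := hx
      have e : max (-1 * P.J v x) 0 * ((x - 0) / (x - 0 + 0)) * (-1 * P.J v x) * etaK.f (P.p v x - k) = (max (-P.J v x) 0)^2 * etaK.f (P.p v x - k) := by
        rw [sub_zero, add_zero, div_self hx.ne', neg_one_mul]
        rcases le_total (-P.J v x) 0 with h | h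
        · rw [max_eq_right h]; ring
        · rw [max_eq_left h]; ring
      rcases le_or_gt x G with hxG | hxG
      · have hev : ∀ᶠ n in atTop, x ∈ Ioc (ρ n) G := by
          filter_upwards [(tendsto_order.1 hρl).2 x hx] with n h1
          exact ⟨h1, hxG⟩
        have hz : Tendsto (fun n => (x - ρ n) / (x - ρ n + ε n)) atTop (𝓝 ((x - 0) / (x - 0 + 0))) :=
          (hρl.const_sub x).div ((hρl.const_sub x).add hεl) (by simpa using hx.ne')
        have hT := (((th_tendsto hε hεl (-1 * P.J v x)).mul hz).mul_const (-1 * P.J v x)).mul_const (etaK.f (P.p v x - k))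
        rw [← e]
        refine hT.congr' ?_
        filter_upwards [hev] with n hn
        rw [indicator_of_mem hn]
      · have h1 := P.J_nonneg hv (show P.gF ≤ x by linarith)
        rw [max_eq_right (by linarith)]
        have : ∀ n, (Ioc (ρ n) G).indicator (fun x => th (ε n) (-1 * P.J v x) * ((x - ρ n) / (x - ρ n + ε n)) * (-1 * P.J v x) * etaK.f (P.p v x - k)) x = 0 :=
          fun n => indicator_of_notMem (fun h => absurd h.2 (not_le.2 hxG)) _
        simp only [this]
        simp
  have hpt : ∀ x ∈ Ioi (0:ℝ), ENNReal.ofReal ((max (-P.J v x) 0)^2 * P.p v x) ≤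
      ENNReal.ofReal ((max (-P.J v x) 0)^2 * etaK.f (P.p v x - k)) + (Ioc 0 P.gF).indicator (fun _ => ENNReal.ofReal M) x := by
    intro x hx
    have hx : 0 < x := hx
    rcases le_or_gt x P.gF with h | h
    · rw [indicator_of_mem (show x ∈ Ioc 0 P.gF from ⟨hx, h⟩), ← ENNReal.ofReal_add (mul_nonneg (sq_nonneg _) (etaK_nonneg _)) hM0]
      refine ENNReal.ofReal_le_ofReal ?_
      have a1 := le_etaK (P.p v x - k)
      have a2 : (max (-P.J v x) 0)^2 ≤ (P.gL * P.VF)^2 := pow_le_pow_left₀ (le_max_right _ _) (P.Jm_le hv hx.le) 2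
      have a3 := mul_le_mul_of_nonneg_right a2 (show 0 ≤ k + 3 by linarith)
      have a4 := mul_le_mul_of_nonneg_left (show P.p v x ≤ etaK.f (P.p v x - k) + (k + 3) by linarith) (sq_nonneg (max (-P.J v x) 0))
      rw [mul_add] at a4
      linarith
    · rw [max_eq_right (by linarith [P.J_nonneg hv h.le])]
      simp
  refine (setLIntegral_mono' measurableSet_Ioi hpt).trans ?_
  rw [lintegral_add_right _ (measurable_const.indicator measurableSet_Ioc), ENNReal.ofReal_add hC0 (by positivity)]
  refine add_le_add hFat ?_
  refine (setLIntegral_le_lintegral _ _).trans ?_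
  rw [lintegral_indicator measurableSet_Ioc, setLIntegral_const, Real.volume_Ioc, sub_zero, ← ENNReal.ofReal_mul hM0]

theorem final : ∃ C : ℝ, ∀ v ∈ Ioo 0 P.VF, ∫ g in Ioi (0:ℝ), (P.J v g)^2 * P.p v g ≤ C := by
  obtain ⟨A, hA⟩ := P.E1p
  obtain ⟨B, hB⟩ := P.E2m
  refine ⟨|A| + |B|, ?_⟩
  intro v hv
  by_cases hi : IntegrableOn (fun g => (P.J v g)^2 * P.p v g) (Ioi 0)
  · rw [integral_eq_lintegral_of_nonneg_ae ?_ hi.aestronglyMeasurable]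
    · refine ENNReal.toReal_le_of_le_ofReal (by positivity) ?_
      have hpc : ContinuousOn (P.p v) (Ioi 0) := (P.p_cont hv).mono Ioi_subset_Ici_self
      have hc : ContinuousOn (fun x => (max (P.J v x) 0)^2 * P.p v x) (Ioi 0) :=
        (((P.J_cont v).continuousOn.sup continuousOn_const).pow 2).mul hpc
      have hpt : ∀ x ∈ Ioi (0:ℝ), ENNReal.ofReal ((P.J v x)^2 * P.p v x) ≤
          ENNReal.ofReal ((max (P.J v x) 0)^2 * P.p v x) + ENNReal.ofReal ((max (-P.J v x) 0)^2 * P.p v x) := by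
        intro x hx
        have hx : 0 < x := hx
        have hp := P.p_nonneg hv hx.le
        rw [← ENNReal.ofReal_add (by positivity) (by positivity)]
        refine ENNReal.ofReal_le_ofReal (le_of_eq ?_)
        rcases le_total (P.J v x) 0 with h | h
        · rw [max_eq_right h, max_eq_left (by linarith)]; ring
        · rw [max_eq_left h, max_eq_right (by linarith)]; ring
      refine (setLIntegral_mono' measurableSet_Ioi hpt).trans ?_
      rw [lintegral_add_left' (hc.aemeasurable measurableSet_Ioi).ennreal_ofReal,
        ENNReal.ofReal_add (abs_nonneg _) (abs_nonneg _)]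
      exact add_le_add ((hA v hv).trans (ENNReal.ofReal_le_ofReal (le_abs_self _)))
        ((hB v hv).trans (ENNReal.ofReal_le_ofReal (le_abs_self _)))
    · filter_upwards [ae_restrict_mem measurableSet_Ioi] with x hx
      have hx : 0 < x := hx
      have hp := P.p_nonneg hv hx.le
      show 0 ≤ (P.J v x)^2 * P.p v x
      positivity
  · rw [integral_undef hi]
    positivity

end App

end Aux

/-- uniform-in-`v` bound for `∫ J² p dg`. -/
theorem stmt4 (VF VE gL gin a σE : ℝ)
    (hVF : 0 < VF) (hVE : VF < VE) (hgL : 0 < gL) (hgin : 0 < gin)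
    (ha : 0 < a) (hσE : 0 < σE)
    (p : ℝ → ℝ → ℝ) (hp : StatSol VF VE gL gin a σE p)
    (hint1 : ∫⁻ x in (Ioo (0:ℝ) VF) ×ˢ (Ioi (0:ℝ)),
        ENNReal.ofReal ((Jflux VE gL x.1 x.2) ^ 2 * p x.1 x.2) < ⊤)
    (hint2 : ∫⁻ x in (Ioo (0:ℝ) VF) ×ˢ (Ioi (0:ℝ)),
        ENNReal.ofReal ((x.2 + gL) * |Jflux VE gL x.1 x.2| * p x.1 x.2) < ⊤)
    (hint3 : ∫⁻ x in (Ioo (0:ℝ) VF) ×ˢ (Ioi (0:ℝ)),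
        ENNReal.ofReal (|x.2 - gin| * p x.1 x.2 + a * |deriv (fun g => p x.1 g) x.2|) < ⊤) :
    ∃ C : ℝ, ∀ v ∈ Ioo 0 VF, ∫ g in Ioi (0:ℝ), (Jflux VE gL v g) ^ 2 * p v g ≤ C := by
  exact App.final ⟨VF, VE, gL, gin, a, σE, p, hVF, hVE, hgL, hgin, ha, hσE, hp, hint1, hint2, hint3⟩
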